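/- Let w be a Grassmannian permutation with its (unique) descent in position k. Then for every bumpless pipe dream B in BPD(w), Q̃(φ(B)) = γ(B); that is, the Gao–Huang bijection φ: BPD(w) → PD(w), Weigandt's bijection γ: BPD(w) → SSYT_k(λ(w)), and the Edelman–Greene recording-tableau map Q̃: PD(w) → SSYT_k(λ(w)) form a commuting triangle. -/

import Mathlib

/- Common definitions for formalizing "Lenart's bijection via bumpless pipe dreams"
   (Gregory–Hamaker). -/

namespace BPDPaper

/-! ### Permutations of the positive integers -/

/-- We model permutations of the positive integers as permutations of `ℕ`
(fixing `0`, with finite support). -/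
abbrev Perm' := Equiv.Perm ℕ

/-- The simple transposition `s_a = t_{a,a+1}`. -/
def sT (a : ℕ) : Perm' := Equiv.swap a (a + 1)

/-- The transposition `t_{ij}`. -/
def tT (i j : ℕ) : Perm' := Equiv.swap i j

/-- The product `s_{a_1} ⋯ s_{a_p}` of a word. -/
def wordProd (l : List ℕ) : Perm' := (l.map sT).prod

/-- `l` is a word for `w` (in the letters `s_1, s_2, …`). -/
def IsWord (w : Perm') (l : List ℕ) : Prop := (∀ x ∈ l, 1 ≤ x) ∧ wordProd l = w

/-- The Coxeter length `ℓ(w)`: the minimal length of a word for `w`. -/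
noncomputable def plen (w : Perm') : ℕ :=
  sInf {m | ∃ l : List ℕ, IsWord w l ∧ l.length = m}

/-- `l` is a reduced word for `w`. -/
def IsReducedWord (w : Perm') (l : List ℕ) : Prop := IsWord w l ∧ l.length = plen w

/-- A permutation of the positive integers: fixes `0` and all but finitely many points. -/
def IsPerm (w : Perm') : Prop := w 0 = 0 ∧ {k | w k ≠ k}.Finite

/-- `k` is a descent of `w`. -/
def Descent (w : Perm') (k : ℕ) : Prop := 1 ≤ k ∧ w (k + 1) < w k

/-- `w` is Grassmannian: at most one descent. -/
def Grassmannian (w : Perm') : Prop := IsPerm w ∧ Set.Subsingleton {k | Descent w k}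

/-- `w` is vexillary: no indices `i < j < k < l` with `w j < w i < w l < w k`
(pattern 2143 avoidance). -/
def Vexillary (w : Perm') : Prop := IsPerm w ∧
  ¬ ∃ i j k l : ℕ, 1 ≤ i ∧ i < j ∧ j < k ∧ k < l ∧ w j < w i ∧ w i < w l ∧ w l < w k

/-- The code `c_i(w) = #{j > i : w j < w i}`. -/
noncomputable def codeOf (w : Perm') (i : ℕ) : ℕ := Nat.card {j : ℕ | i < j ∧ w j < w i}

/-- Insert into a weakly decreasing list, keeping it weakly decreasing. -/
def insDesc (x : ℕ) : List ℕ → List ℕ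
  | [] => [x]
  | y :: ys => if y < x then x :: y :: ys else y :: insDesc x ys

/-- Sort a list into weakly decreasing order. -/
def sortDesc (l : List ℕ) : List ℕ := l.foldr insDesc []

/-- The shape `λ(w)`: the code `(c_1(w), …, c_n(w))` sorted decreasingly, zeros dropped
(`n` is any bound on the support of `w`). -/
noncomputable def shapeOf (w : Perm') (n : ℕ) : List ℕ :=
  (sortDesc ((List.range' 1 n).map (codeOf w))).filter (fun x => decide (0 < x))

/-- The Rothe diagram `D_w = {(i, w j) : i < j, w j < w i}` (matrix coordinates). -/
def RotheDiagram (w : Perm') : Set (ℕ × ℕ) :=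
  {p | 1 ≤ p.1 ∧ ∃ j, p.1 < j ∧ w j < w p.1 ∧ p.2 = w j}

/-- `φ_i`: the row index of the southeast-most box of `D_w` on the diagonal through
`(i, λ_i)`. -/
noncomputable def flagEntry (w : Perm') (i li : ℕ) : ℕ :=
  sSup {r : ℕ | ∃ c : ℕ, (r, c) ∈ RotheDiagram w ∧ (c : ℤ) - (r : ℤ) = (li : ℤ) - (i : ℤ)}

/-- The flag `φ(w) = (φ_1, …, φ_m)` of a vexillary permutation. -/
noncomputable def flagOf (w : Perm') (n : ℕ) : List ℕ :=
  (List.range (shapeOf w n).length).map (fun k => flagEntry w (k + 1) ((shapeOf w n).getD k 0))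

/-- `ρ(w)_i`: the `i`-th row of the smallest partition whose Young diagram contains `D_w`. -/
noncomputable def rhoRow (w : Perm') (i : ℕ) : ℕ :=
  sSup {c : ℕ | ∃ r : ℕ, i ≤ r ∧ (r, c) ∈ RotheDiagram w}

/-! ### Tableaux (lists of rows), flagged SSYT, jeu de taquin -/

/-- Semistandard Young tableau of partition shape, presented as a list of rows. -/
def IsSSYT (T : List (List ℕ)) : Prop :=
  (∀ row ∈ T, row ≠ []) ∧
  List.Chain' (fun r1 r2 : List ℕ => r2.length ≤ r1.length) T ∧
  (∀ row ∈ T, List.Chain' (· ≤ ·) row) ∧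
  (∀ i j : ℕ, i + 1 < T.length → j < (T.getD (i + 1) []).length →
    (T.getD i []).getD j 0 < (T.getD (i + 1) []).getD j 0)

/-- `φ`-flagged semistandard Young tableaux of shape `λ`: the last entry of row `i`
is at most `φ_i`. -/
def IsFlaggedSSYT (lam phi : List ℕ) (T : List (List ℕ)) : Prop :=
  IsSSYT T ∧ T.map List.length = lam ∧
  ∀ i : ℕ, i < T.length → (T.getD i []).getLastD 0 ≤ phi.getD i 0

/-- Semistandard Young tableaux with all entries at most `k` (`SSYT_k`). -/
def IsSSYTBounded (k : ℕ) (T : List (List ℕ)) : Prop :=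
  IsSSYT T ∧ ∀ row ∈ T, ∀ x ∈ row, x ≤ k

/-- Set an entry of a tableau. -/
def setEntry (T : List (List ℕ)) (r c x : ℕ) : List (List ℕ) :=
  T.set r ((T.getD r []).set c x)

/-- One jeu de taquin slide with the empty tile at `(r, c)` (0-indexed):
swap the empty tile with the smaller of the entries to its right and below
(ties move down; missing boxes are `∞`); when both are missing, delete the cell. -/
def jdtAux : ℕ → List (List ℕ) → ℕ → ℕ → List (List ℕ)
  | 0, T, _, _ => T
  | fuel + 1, T, r, c =>
    match (T.getD r [])[c + 1]?, (T.getD (r + 1) [])[c]? with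
    | none, none => (T.set r ((T.getD r []).take c)).filter (fun row => !row.isEmpty)
    | some x, none => jdtAux fuel (setEntry T r c x) r (c + 1)
    | none, some y => jdtAux fuel (setEntry T r c y) (r + 1) c
    | some x, some y =>
      if x < y then jdtAux fuel (setEntry T r c x) r (c + 1)
      else jdtAux fuel (setEntry T r c y) (r + 1) c

/-- `jdt(T)`: remove the top-left box of `T` and rectify by jeu de taquin. -/
def jdt (T : List (List ℕ)) : List (List ℕ) :=
  jdtAux ((T.map List.length).sum + 1) T 0 0

/-! ### Edelman–Greene column insertion and the recording tableau -/

/-- Edelman–Greene insertion of `x` into one increasing column `C`.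
Returns the new column together with `none` (if `x` was appended, creating a new box)
or `some y` (where `y` is to be inserted into the next column). -/
def colIns (x : ℕ) (C : List ℕ) : List ℕ × Option ℕ :=
  if C.all (fun c => decide (c < x)) then (C ++ [x], none)
  else if x ∈ C ∧ (x + 1) ∈ C then (C, some (x + 1))
  else
    match C.find? (fun c => decide (x < c)) with
    | some ck => (C.map (fun c => if c = ck then x else c), some ck)
    | none => (C, none)

/-- Edelman–Greene insertion of `x` into a tableau presented as a list of columns.
Returns the new columns and the (0-indexed) column containing the new box. -/
def egInsert : List (List ℕ) → ℕ → (List (List ℕ)) × ℕ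
  | [], x => ([[x]], 0)
  | C :: rest, x =>
    match colIns x C with
    | (C', none) => (C' :: rest, 0)
    | (C', some y) =>
      let res := egInsert rest y
      (C' :: res.1, res.2 + 1)

/-- One step of the Edelman–Greene algorithm on the pair (insertion, recording) tableau:
insert `ra.2` into `P` and record `ra.1` in the new box of `Q`. -/
def egStep (PQ : (List (List ℕ)) × (List (List ℕ))) (ra : ℕ × ℕ) :
    (List (List ℕ)) × (List (List ℕ)) :=
  let res := egInsert PQ.1 ra.2
  let Q := PQ.2
  let Q' := if res.2 < Q.length then Q.set res.2 (Q.getD res.2 [] ++ [ra.1]) else Q ++ [[ra.1]]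
  (res.1, Q')

/-- A biword `(r_1,…,r_l ; a_1,…,a_l)`. -/
structure Biword where
  top : List ℕ
  bot : List ℕ

/-- The (insertion, recording) column tableaux of a biword under Edelman–Greene insertion. -/
def egPQ (P : Biword) : (List (List ℕ)) × (List (List ℕ)) :=
  (P.top.zip P.bot).foldl egStep ([], [])

/-- Convert a tableau presented as a list of columns into a list of rows. -/
def colsToRows (cols : List (List ℕ)) : List (List ℕ) :=
  (List.range ((cols.map List.length).foldr max 0)).map
    (fun i => cols.filterMap (fun col => col[i]?))

/-- The Edelman–Greene recording tableau `Q̃` of a biword (as a list of rows). -/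
def Qtilde (P : Biword) : List (List ℕ) := colsToRows (egPQ P).2

/-- The Edelman–Greene insertion tableau `P̃` of a biword (as a list of rows). -/
def Ptilde (P : Biword) : List (List ℕ) := colsToRows (egPQ P).1

/-- `(r ; a)` is a reduced compatible sequence for `w`: `a` is a reduced word for `w`,
`r` is weakly increasing, `r_i ≤ a_i`, and `r_i < r_{i+1}` whenever `a_i < a_{i+1}`.
Membership in `PD(w)`. -/
def IsCompatible (w : Perm') (P : Biword) : Prop :=
  IsReducedWord w P.bot ∧
  List.Chain' (· ≤ ·) P.top ∧
  List.Forall₂ (· ≤ ·) P.top P.bot ∧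
  (∀ m : ℕ, m + 1 < P.bot.length →
    P.bot.getD m 0 < P.bot.getD (m + 1) 0 → P.top.getD m 0 < P.top.getD (m + 1) 0)

/-! ### Bumpless pipe dreams -/

/-- The tiles: blank, vertical, horizontal, ⌐-elbow (S–E, "r"), ⌟-elbow (W–N, "j"),
crossing, and the bump tile (for almost bumpless pipe dreams). -/
inductive Tile
  | blank | vert | horiz | se | nw | cross | bump
deriving DecidableEq

/-- A square grid of tiles; rows and columns are 1-indexed, rows increase downward. -/
structure Grid where
  n : ℕ
  tile : ℕ → ℕ → Tile

inductive Dir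
  | north | east
deriving DecidableEq

def hasN : Tile → Bool
  | .vert => true | .nw => true | .cross => true | .bump => true | _ => false
def hasS : Tile → Bool
  | .vert => true | .se => true | .cross => true | .bump => true | _ => false
def hasE : Tile → Bool
  | .horiz => true | .se => true | .cross => true | .bump => true | _ => false
def hasW : Tile → Bool
  | .horiz => true | .nw => true | .cross => true | .bump => true | _ => false

/-- The outgoing direction of a pipe through a tile, given the incoming heading
(`north` = entered through the south edge, `east` = entered through the west edge). -/
def outDir : Tile → Dir → Option Dir
  | .vert, .north => some .north
  | .cross, .north => some .north
  | .se, .north => some .east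
  | .bump, .north => some .east
  | .horiz, .east => some .east
  | .cross, .east => some .east
  | .nw, .east => some .north
  | .bump, .east => some .north
  | _, _ => none

/-- Trace a pipe; returns the row in which it exits through the east edge of the grid. -/
def traceAux (g : Grid) : ℕ → ℕ → ℕ → Dir → Option ℕ
  | 0, _, _, _ => none
  | fuel + 1, x, y, d =>
    match outDir (g.tile x y) d with
    | none => none
    | some Dir.north => if x ≤ 1 then none else traceAux g fuel (x - 1) y Dir.north
    | some Dir.east => if g.n ≤ y then some x else traceAux g fuel x (y + 1) Dir.east

/-- The exit row of the pipe entering at the bottom of column `c`. -/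
def exitRow (g : Grid) (c : ℕ) : Option ℕ := traceAux g (2 * g.n + 2) g.n c Dir.north

/-- The list of states `(row, column, heading)` visited by a pipe. -/
def pathAux (g : Grid) : ℕ → ℕ → ℕ → Dir → List (ℕ × ℕ × Dir)
  | 0, _, _, _ => []
  | fuel + 1, x, y, d =>
    (x, y, d) ::
      (match outDir (g.tile x y) d with
       | none => []
       | some Dir.north => if x ≤ 1 then [] else pathAux g fuel (x - 1) y Dir.north
       | some Dir.east => if g.n ≤ y then [] else pathAux g fuel x (y + 1) Dir.east)

/-- The path of the pipe entering at the bottom of column `c`. -/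
def pipePath (g : Grid) (c : ℕ) : List (ℕ × ℕ × Dir) := pathAux g (2 * g.n + 2) g.n c Dir.north

/-- Pipe `c` passes through position `z`. -/
def passes (g : Grid) (c : ℕ) (z : ℕ × ℕ) : Prop :=
  ∃ d : Dir, (z.1, z.2, d) ∈ pipePath g c

def InGrid (g : Grid) (i j : ℕ) : Prop := 1 ≤ i ∧ i ≤ g.n ∧ 1 ≤ j ∧ j ≤ g.n

/-- A (reduced) bumpless pipe dream: tiles match along edges; pipes enter along the
bottom and exit along the right; no bump tiles; no two pipes cross more than once.
(Tiles outside the grid are normalized to `horiz`.) -/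
def IsBPD (g : Grid) : Prop :=
  1 ≤ g.n ∧
  (∀ i j, ¬ InGrid g i j → g.tile i j = Tile.horiz) ∧
  (∀ i j, InGrid g i j → g.tile i j ≠ Tile.bump) ∧
  (∀ i j, 1 ≤ i → i < g.n → 1 ≤ j → j ≤ g.n → hasS (g.tile i j) = hasN (g.tile (i + 1) j)) ∧
  (∀ i j, 1 ≤ i → i ≤ g.n → 1 ≤ j → j < g.n → hasE (g.tile i j) = hasW (g.tile i (j + 1))) ∧
  (∀ j, 1 ≤ j → j ≤ g.n → hasN (g.tile 1 j) = false) ∧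
  (∀ j, 1 ≤ j → j ≤ g.n → hasS (g.tile g.n j) = true) ∧
  (∀ i, 1 ≤ i → i ≤ g.n → hasW (g.tile i 1) = false) ∧
  (∀ i, 1 ≤ i → i ≤ g.n → hasE (g.tile i g.n) = true) ∧
  (∀ c c', 1 ≤ c → c ≤ g.n → 1 ≤ c' → c' ≤ g.n → c ≠ c' →
    Set.Subsingleton {z : ℕ × ℕ | g.tile z.1 z.2 = Tile.cross ∧ passes g c z ∧ passes g c' z})

/-- `g ∈ BPD(w)`: `g` is a bumpless pipe dream whose permutation is `w`, i.e. the pipe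
entering at the bottom of column `c` exits to the right in row `w⁻¹(c)`. -/
def MemBPD (w : Perm') (g : Grid) : Prop :=
  IsBPD g ∧ w 0 = 0 ∧ (∀ k, g.n < k → w k = k) ∧
  (∀ c, 1 ≤ c → c ≤ g.n → exitRow g c = some (w.symm c))

/-! ### Weigandt's map γ -/

/-- The blank tiles on the diagonal `{(i,j) : j - i = d}`, from northwest to southeast. -/
def blanksOnDiag (g : Grid) (d : ℤ) : List (ℕ × ℕ) :=
  (List.range' 1 g.n).filterMap (fun (i : ℕ) =>
    let jz : ℤ := (i : ℤ) + d
    if 1 ≤ jz ∧ jz ≤ (g.n : ℤ) then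
      (if g.tile i jz.toNat = Tile.blank then some (i, jz.toNat) else none)
    else none)

/-- The number of pipes passing above position `(i,j)`: tiles above it in column `j`
in which a pipe travels eastward. -/
def pipesAbove (g : Grid) (i j : ℕ) : ℕ :=
  ((List.range' 1 g.n).filter (fun x => decide (x < i) && hasE (g.tile x j))).length

/-- Weigandt's map `γ` (for vexillary permutations): fill each blank tile with the number
of pipes above it, slide the filled tiles northwest along their diagonals into the Young
diagram of `lam`, and add `i` to every entry in row `i`. -/
def weigandt (g : Grid) (lam : List ℕ) : List (List ℕ) :=
  (List.range lam.length).map (fun (r0 : ℕ) =>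
    (List.range (lam.getD r0 0)).map (fun (c0 : ℕ) =>
      let r : ℕ := r0 + 1
      let c : ℕ := c0 + 1
      let p := (blanksOnDiag g ((c : ℤ) - (r : ℤ))).getD (min r c - 1) (0, 0)
      pipesAbove g p.1 p.2 + r))

/-! ### The Gao–Huang operator ∇, pop, and the bijection φ -/

/-- Backward tracing: enter tile `(x,y)` through its north edge (`viaN = true`) or its
east edge (`viaN = false`) and follow the pipe backwards; returns the bottom column
at which the pipe enters the grid. -/
def backAux (g : Grid) : ℕ → ℕ → ℕ → Bool → Option ℕ
  | 0, _, _, _ => none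
  | fuel + 1, x, y, viaN =>
    if g.n < x then none
    else if viaN then
      match g.tile x y with
      | .vert | .cross => if x = g.n then some y else backAux g fuel (x + 1) y true
      | .nw | .bump => backAux g fuel x (y - 1) false
      | _ => none
    else
      match g.tile x y with
      | .horiz | .cross => backAux g fuel x (y - 1) false
      | .se | .bump => if x = g.n then some y else backAux g fuel (x + 1) y true
      | _ => none

/-- The label of the pipe passing through `(x,y)` entering from the south. -/
def pipeFromS (g : Grid) (x y : ℕ) : Option ℕ :=
  if x = g.n then some y else backAux g (2 * g.n + 2) (x + 1) y true

/-- Move the mark east to the rightmost blank tile in its contiguous block of blanks. -/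
def slideEast (g : Grid) (i j : ℕ) : ℕ :=
  ((List.range' j (g.n + 1)).takeWhile (fun y => g.tile i y == Tile.blank)).getLastD j

/-- Tile rewrite for the undroop of the pipe `p` (from `(i', j+1)` into `(i, j)`)
performed in one iteration of the Gao–Huang procedure; the `(i', j+1)` case `cross → se`
is the final uncrossing step. -/
def nablaUndroop (T : ℕ → ℕ → Tile) (i i' j : ℕ) : ℕ → ℕ → Tile := fun x y =>
  let t := T x y
  if x = i ∧ y = j then (match t with | Tile.blank => Tile.se | _ => t)
  else if x = i' ∧ y = j then
    (match t with | Tile.se => Tile.vert | Tile.horiz => Tile.nw | _ => t)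
  else if x = i ∧ y = j + 1 then
    (match t with | Tile.se => Tile.horiz | Tile.vert => Tile.nw | _ => t)
  else if x = i' ∧ y = j + 1 then
    (match t with | Tile.nw => Tile.blank | Tile.cross => Tile.se | _ => t)
  else if y = j ∧ i < x ∧ x < i' then
    (match t with | Tile.blank => Tile.vert | Tile.horiz => Tile.cross | _ => t)
  else if y = j + 1 ∧ i < x ∧ x < i' then
    (match t with | Tile.vert => Tile.blank | Tile.cross => Tile.horiz | _ => t)
  else t

/-- Tile rewrite for the droop (from `(k, j)` into `(k', j+1)`) of a pipe `q` having both
a ⌐-turn and a ⌟-turn in column `j`, performed after the undroop of `p`. -/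
def nablaQDroop (T : ℕ → ℕ → Tile) (k k' j : ℕ) : ℕ → ℕ → Tile := fun x y =>
  let t := T x y
  if x = k ∧ y = j then (match t with | Tile.se => Tile.vert | _ => t)
  else if x = k' ∧ y = j then (match t with | Tile.nw => Tile.cross | _ => t)
  else if x = k ∧ y = j + 1 then (match t with | Tile.horiz => Tile.se | _ => t)
  else if x = k' ∧ y = j + 1 then (match t with | Tile.blank => Tile.nw | _ => t)
  else if y = j + 1 ∧ k < x ∧ x < k' then
    (match t with | Tile.blank => Tile.vert | Tile.horiz => Tile.cross | _ => t)
  else t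

/-- The ⌐/⌟ elbow pairs `(k, k')` of pipes in column `j` strictly between rows `i` and `i'`. -/
def qPairs (g : Grid) (i i' j : ℕ) : List (ℕ × ℕ) :=
  (List.range' 1 g.n).filterMap (fun k =>
    if i < k ∧ k < i' ∧ g.tile k j = Tile.se then
      match (List.range' 1 g.n).find?
          (fun k' => decide (k < k' ∧ k' < i' ∧ g.tile k' j = Tile.nw)) with
      | some k' => some (k, k')
      | none => none
    else none)

/-- One iteration of the marked-tile procedure on the rectangle with corners
`(i, j)` and `(i', j+1)`: undroop `p`, then droop the intersecting pipes. -/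
def nablaIter (g : Grid) (i i' j : ℕ) : Grid :=
  ⟨g.n, (qPairs g i i' j).foldl (fun T kk => nablaQDroop T kk.1 kk.2 j)
    (nablaUndroop g.tile i i' j)⟩

/-- The marked-tile loop of the Gao–Huang procedure; returns `(∇B, a)`. -/
def nablaLoop (g : Grid) : ℕ → ℕ × ℕ → Grid × ℕ
  | 0, _ => (g, 0)
  | fuel + 1, (i, j0) =>
    let j := slideEast g i j0
    match pipeFromS g i (j + 1) with
    | none => (g, 0)
    | some p =>
      if p = j + 1 then
        match (List.range' 1 g.n).find? (fun x =>
            decide (i < x) && (g.tile x (j + 1) == Tile.cross) &&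
            (backAux g (2 * g.n + 2) x (j + 1) false == some j)) with
        | some i' => (nablaIter g i i' j, j)
        | none => (g, 0)
      else
        match (List.range' 1 g.n).find? (fun x =>
            decide (i < x) && (g.tile x (j + 1) == Tile.nw)) with
        | some i' => nablaLoop (nablaIter g i i' j) fuel (i', j + 1)
        | none => (g, 0)

/-- The Gao–Huang procedure: returns `(∇B, (r, a))` where `pop(B) = (r, a)`. -/
def nablaPop (g : Grid) : Grid × ℕ × ℕ :=
  match (List.range' 1 g.n).find?
      (fun i => (List.range' 1 g.n).any (fun j => g.tile i j == Tile.blank)) with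
  | none => (g, 0, 0)
  | some r =>
    let j0 := ((List.range' 1 g.n).filter (fun j => g.tile r j == Tile.blank)).getLastD 0
    let res := nablaLoop g (g.n + 1) (r, j0)
    (res.1, r, res.2)

/-- The Gao–Huang operator `∇`. -/
def nabla (g : Grid) : Grid := (nablaPop g).1

/-- `pop(B) = (r, a)`. -/
def pop (g : Grid) : ℕ × ℕ := (nablaPop g).2

/-- The number of crossing tiles of `g` (which equals `ℓ(w)` for `g ∈ BPD(w)`). -/
def crossCount (g : Grid) : ℕ :=
  ((List.range' 1 g.n).map (fun i =>
    ((List.range' 1 g.n).filter (fun j => g.tile i j == Tile.cross)).length)).sum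

def phiAux : ℕ → Grid → List (ℕ × ℕ)
  | 0, _ => []
  | l + 1, g => pop g :: phiAux l (nabla g)

/-- The Gao–Huang bijection `φ : BPD(w) → PD(w)`,
`φ(B) = (r_1,…,r_l ; a_1,…,a_l)` with `(r_i, a_i) = pop(∇^{i-1} B)`. -/
def phi (g : Grid) : Biword :=
  ⟨(phiAux (crossCount g) g).map Prod.fst, (phiAux (crossCount g) g).map Prod.snd⟩

/-! ### Little bumps (relational) -/

/-- The reflection labelling the crossing at position `m` (0-indexed) of the word `a`:
deleting the letter at position `m` from `a` yields a word for `wordProd a * crossingRefl a m`.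
The wires `i` and `j` cross at position `m` iff `crossingRefl a m = t_{ij}`. -/
def crossingRefl (a : List ℕ) (m : ℕ) : Perm' :=
  (wordProd (a.drop (m + 1)))⁻¹ * sT (a.getD m 0) * wordProd (a.drop (m + 1))

/-- `a` is a reduced word (for its own product). -/
def IsReducedSelf (a : List ℕ) : Prop := IsReducedWord (wordProd a) a

/-- Increment the entry of `a` at position `m`. -/
def incrAt (a : List ℕ) (m : ℕ) : List ℕ := a.set m (a.getD m 0 + 1)

/-- The (upward) Little bump `L_{ij}` as a relation on biwords: starting at the position
`m_1` where wires `i` and `j` cross, repeatedly increment the current entry; stop when the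
bottom word becomes reduced, and otherwise move to the unique other position whose crossing
involves the same pair of wires. -/
def LittleBumpRel (i j : ℕ) (P P' : Biword) : Prop :=
  P'.top = P.top ∧
  ∃ ms : List ℕ, ∃ ws : List (List ℕ),
    ms ≠ [] ∧
    ws.length = ms.length + 1 ∧
    ws.getD 0 [] = P.bot ∧
    ws.getLastD [] = P'.bot ∧
    (∀ t : ℕ, t < ms.length → ws.getD (t + 1) [] = incrAt (ws.getD t []) (ms.getD t 0)) ∧
    crossingRefl P.bot (ms.getD 0 0) = tT i j ∧
    (∀ t : ℕ, t + 1 < ms.length →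
      ¬ IsReducedSelf (ws.getD (t + 1) []) ∧
      ms.getD (t + 1) 0 ≠ ms.getD t 0 ∧
      crossingRefl (ws.getD (t + 1) []) (ms.getD t 0)
        = crossingRefl (ws.getD (t + 1) []) (ms.getD (t + 1) 0)) ∧
    IsReducedSelf P'.bot

/-! ### Huang bumps -/

/-- Least offset `t ≥ 1` satisfying `p` (searched up to `bound + 1`). -/
def leastOff (p : ℕ → Bool) (bound : ℕ) : ℕ :=
  ((List.range' 1 (bound + 1)).filter p).headD 1

/-- The southeast corner `(x + k, y + l)` of the min-droop at `(x, y)`: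
`k, l ≥ 1` minimal with `(x+k, y)` and `(x, y+l)` not crossing tiles. -/
def minDroopCorner (g : Grid) (x y : ℕ) : ℕ × ℕ :=
  (x + leastOff (fun k => !(g.tile (x + k) y == Tile.cross)) g.n,
   y + leastOff (fun l => !(g.tile x (y + l) == Tile.cross)) g.n)

/-- The min-droop at `(x, y)`: droop the ⌐-turn at `(x, y)` into `(x+k, y+l)`. -/
def minDroopT (g : Grid) (x y : ℕ) : Grid :=
  let k := leastOff (fun k => !(g.tile (x + k) y == Tile.cross)) g.n
  let l := leastOff (fun l => !(g.tile x (y + l) == Tile.cross)) g.n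
  ⟨g.n, fun a b =>
    let t := g.tile a b
    if a = x ∧ b = y then
      (match t with | Tile.se => Tile.blank | Tile.bump => Tile.nw | _ => t)
    else if a = x + k ∧ b = y then (match t with | Tile.vert => Tile.se | _ => t)
    else if a = x ∧ b = y + l then
      (match t with | Tile.horiz => Tile.se | Tile.nw => Tile.vert | _ => t)
    else if a = x + k ∧ b = y + l then
      (match t with | Tile.blank => Tile.nw | Tile.se => Tile.bump | _ => t)
    else if b = y ∧ x < a ∧ a < x + k then
      (match t with | Tile.cross => Tile.horiz | Tile.vert => Tile.blank | _ => t)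
    else if a = x ∧ y < b ∧ b < y + l then
      (match t with | Tile.cross => Tile.vert | Tile.horiz => Tile.blank | _ => t)
    else if a = x + k ∧ y < b ∧ b < y + l then
      (match t with | Tile.blank => Tile.horiz | Tile.vert => Tile.cross | _ => t)
    else if b = y + l ∧ x < a ∧ a < x + k then
      (match t with | Tile.blank => Tile.vert | Tile.horiz => Tile.cross | _ => t)
    else t⟩

/-- Replace a single tile. -/
def setTile (g : Grid) (x y : ℕ) (t : Tile) : Grid :=
  ⟨g.n, fun a b => if a = x ∧ b = y then t else g.tile a b⟩

/-- Pipe `c` passes through `(x, y)` (Boolean). -/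
def onPath (g : Grid) (c : ℕ) (x y : ℕ) : Bool :=
  decide ((x, y, Dir.north) ∈ pipePath g c) || decide ((x, y, Dir.east) ∈ pipePath g c)

/-- The position of the crossing tile where pipes `c` and `c'` cross, if any. -/
def findCrossing (g : Grid) (c c' : ℕ) : Option (ℕ × ℕ) :=
  (pipePath g c).findSome? (fun s =>
    if (g.tile s.1 s.2.1 == Tile.cross) && onPath g c' s.1 s.2.1 then some (s.1, s.2.1)
    else none)

/-- The column of the ⌐-turn of pipe `c` in row `row`, if any. -/
def seTurnCol (g : Grid) (c row : ℕ) : Option ℕ :=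
  (pipePath g c).findSome? (fun s =>
    if s.1 = row ∧ s.2.2 = Dir.north ∧
        (g.tile s.1 s.2.1 = Tile.se ∨ g.tile s.1 s.2.1 = Tile.bump) then some s.2.1
    else none)

/-- The iteration of the Huang bump: min-droops and cross-bump-swaps until a bump tile
is turned into a crossing tile. -/
def huangLoop (iPipe : ℕ) : ℕ → Grid → ℕ × ℕ → Grid
  | 0, g, _ => g
  | fuel + 1, g, (x, y) =>
    let c := minDroopCorner g x y
    let g1 := minDroopT g x y
    match g1.tile c.1 c.2 with
    | Tile.nw =>
      match seTurnCol g1 iPipe c.1 with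
      | some col => huangLoop iPipe fuel g1 (c.1, col)
      | none => g1
    | Tile.bump =>
      match backAux g1 (2 * g1.n + 2) c.1 c.2 false with
      | some q =>
        match findCrossing g1 iPipe q with
        | some z =>
          huangLoop iPipe fuel (setTile (setTile g1 c.1 c.2 Tile.cross) z.1 z.2 Tile.bump) z
        | none => setTile g1 c.1 c.2 Tile.cross
      | none => g1
    | _ => g1

/-- Fuel exceeding the number of states of the procedure. -/
def huangFuel (g : Grid) : ℕ := 7 ^ (g.n * g.n) * (g.n * g.n) + 2

/-- The Huang bump `H_{ij}`: replace the crossing of pipes `i` and `j` by a bump tile,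
then repeatedly min-droop and cross-bump-swap until a new crossing tile is created. -/
def huang (i j : ℕ) (g : Grid) : Grid :=
  match findCrossing g i j with
  | some z => huangLoop i (huangFuel g) (setTile g z.1 z.2 Tile.bump) z
  | none => g


section

/-! ### Partitions as functions, slides of lattice lists -/

def addB (μ : ℕ → ℕ) (r : ℕ) : ℕ → ℕ := fun p => if p = r then μ p + 1 else μ p
def subB (μ : ℕ → ℕ) (r : ℕ) : ℕ → ℕ := fun p => if p = r then μ p - 1 else μ p
def IsPart (μ : ℕ → ℕ) : Prop := ∀ p, μ (p + 1) ≤ μ p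

theorem IsPart.anti {μ : ℕ → ℕ} (h : IsPart μ) {x y : ℕ} (hxy : x ≤ y) : μ y ≤ μ x :=
  antitone_nat_of_succ_le h hxy

def stepR (μ : ℕ → ℕ) (h r : ℕ) : ℕ × ℕ := if r = h + 1 ∧ μ r + 1 = μ h then (h, r) else (r, h)

def slide : (ℕ → ℕ) → ℕ → List (ℕ × ℕ) → List (ℕ × ℕ) × ℕ
  | _, h, [] => ([], h)
  | μ, h, (v, r) :: L =>
    ((v, (stepR μ h r).1) :: (slide (addB μ r) (stepR μ h r).2 L).1,
      (slide (addB μ r) (stepR μ h r).2 L).2)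

def shapeL : (ℕ → ℕ) → List (ℕ × ℕ) → (ℕ → ℕ)
  | μ, [] => μ
  | μ, (_, r) :: L => shapeL (addB μ r) L

def addO (μ : ℕ → ℕ) : Option ℕ → (ℕ → ℕ)
  | none => μ
  | some r => addB μ r
def subO (μ : ℕ → ℕ) : Option ℕ → (ℕ → ℕ)
  | none => μ
  | some r => subB μ r
def stepO (μ : ℕ → ℕ) : Option ℕ → Option ℕ → Option ℕ × Option ℕ
  | none, o => (o, none)
  | some h, none => (none, some h)
  | some h, some r => (some (stepR μ h r).1, some (stepR μ h r).2)

def Diff (μ ν : ℕ → ℕ) : Prop := IsPart μ ∧ IsPart ν ∧ ∀ p, μ p = ν p ∨ μ p = ν p + 1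

def AddOK (μ ν : ℕ → ℕ) (r : ℕ) (o : Option ℕ) : Prop :=
  IsPart (addB μ r) ∧ IsPart (addO ν o) ∧
  (o = some r ∨
   (∃ p, o = some p ∧ r < p ∧ μ p = μ r ∧ (∀ x, r ≤ x → x < p → μ x = ν x) ∧ μ p = ν p + 1) ∨
   (o = none ∧ μ r = 0))

def HoleOK (μ ν : ℕ → ℕ) (h : ℕ) (ho : Option ℕ) : Prop :=
  μ (h + 1) < μ h ∧
  ((ho = none ∧ ∀ x, x ≤ h → μ x = ν x + 1) ∨
   (∃ g, ho = some g ∧ g ≤ h ∧ μ g = ν g ∧ ∀ x, g < x → x ≤ h → μ x = ν x + 1))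

theorem addB_isPart {μ : ℕ → ℕ} {r : ℕ} (hm : IsPart μ) :
    IsPart (addB μ r) ↔ ∀ x, x + 1 = r → μ r < μ x := by
  constructor
  · intro h x hx
    have := h x
    subst hx
    simp [addB] at this
    omega
  · intro h p
    have := hm p
    have := h p
    simp only [addB]
    split_ifs with h1 h2 h2
    · omega
    · subst h1; have := this rfl; omega
    · omega
    · omega

theorem subB_isPart {μ : ℕ → ℕ} {r : ℕ} (hm : IsPart μ) (h : μ (r + 1) < μ r) :
    IsPart (subB μ r) := by
  intro p
  have := hm p
  simp only [subB]
  split_ifs with h1 h2 h2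
  · omega
  · omega
  · subst h2; omega
  · omega

theorem Diff.add {μ ν : ℕ → ℕ} (hd : Diff μ ν) {r : ℕ} {o : Option ℕ} (ha : AddOK μ ν r o) :
    Diff (addB μ r) (addO ν o) := by
  obtain ⟨h1, h2, h3⟩ := ha
  refine ⟨h1, h2, ?_⟩
  intro x
  have hx := hd.2.2 x
  rcases h3 with rfl | ⟨p, rfl, hp, hpr, hb, hd1⟩ | ⟨rfl, h0⟩
  · simp only [addO, addB]; split_ifs <;> omega
  · have := hb x
    have := hb r le_rfl hp
    simp only [addO, addB]
    split_ifs with h4 h5 h5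
    · omega
    · subst h4; omega
    · subst h5; omega
    · omega
  · simp only [addO, addB]; split_ifs with h4
    · subst h4; omega
    · omega

theorem hole_hat {μ ν : ℕ → ℕ} (hd : Diff μ ν) {h g : ℕ} (hh : HoleOK μ ν h (some g)) :
    g ≤ h ∧ μ g = ν g ∧ (∀ x, g < x → x ≤ h → μ x = ν x + 1) ∧ ν (g + 1) < ν g := by
  obtain ⟨h1, h2⟩ := hh
  simp at h2
  obtain ⟨a, b, c⟩ := h2
  refine ⟨a, b, c, ?_⟩
  have := c (g + 1)
  have := hd.1 g
  have := hd.2.2 (g + 1)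
  rcases Nat.lt_or_ge g h with h3 | h3
  · omega
  · obtain rfl : g = h := by omega
    omega

theorem Diff.sub {μ ν : ℕ → ℕ} (hd : Diff μ ν) {h : ℕ} {ho : Option ℕ} (hh : HoleOK μ ν h ho) :
    Diff (subB μ h) (subO ν ho) := by
  refine ⟨subB_isPart hd.1 hh.1, ?_, ?_⟩
  · cases ho with
    | none => exact hd.2.1
    | some g => exact subB_isPart hd.2.1 (hole_hat hd hh).2.2.2
  · intro x
    have hx := hd.2.2 x
    have h1 := hh.1
    cases ho with
    | none =>
      have := hh.2
      simp at this
      have := this x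
      simp only [subO, subB]
      split_ifs <;> omega
    | some g =>
      obtain ⟨a, b, c, d⟩ := hole_hat hd hh
      have := c x
      have := c h
      simp only [subO, subB]
      split_ifs with h4 h5 h5
      · subst h4; omega
      · subst h4; omega
      · subst h5; omega
      · omega

theorem step_comm {μ : ℕ → ℕ} (hm : IsPart μ) {h r : ℕ} (h1 : μ (h + 1) < μ h) (h2 : IsPart (addB μ r)) :
    addB (subB μ h) (stepR μ h r).1 = subB (addB μ r) (stepR μ h r).2 := by
  funext x
  unfold stepR
  split_ifs with hc
  · simp only [addB, subB]
    split_ifs with h3 h4 h5 <;> first | omega | (subst h3; omega)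
  · simp only [addB, subB]
    split_ifs with h3 h4 h5 <;> first | omega | (subst h3; omega) | (subst h4; omega)

end

section

theorem cube_hole {μ ν : ℕ → ℕ} (hd : Diff μ ν) {h r : ℕ} {ho o : Option ℕ}
    (hh : HoleOK μ ν h ho) (ha : AddOK μ ν r o) :
    HoleOK (addB μ r) (addO ν o) (stepR μ h r).2 (stepO ν ho o).2 := by
  obtain ⟨hm, hn, hd⟩ := hd
  obtain ⟨a1, a2, a3⟩ := ha
  rw [addB_isPart hm] at a1
  have a2' : ∀ q, o = some q → ∀ x, x + 1 = q → ν q < ν x := by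
    rintro q rfl; exact (addB_isPart hn).1 a2
  clear a2
  obtain ⟨h1, h2⟩ := hh
  have hmr := hm.anti (x := r) (y := h)
  have hmr2 := hm.anti (x := h) (y := r)
  have hmr3 := hm.anti (x := h+1) (y := r)
  rcases h2 with ⟨rfl, h2⟩ | ⟨g, rfl, hg, hg1, hg2⟩
  · simp only [stepO]
    unfold stepR HoleOK
    split_ifs with hc
    · rcases a3 with rfl | ⟨p, rfl, hp, hpr, hb, hd1⟩ | ⟨rfl, h0⟩
      · refine ⟨?_, Or.inl ⟨rfl, ?_⟩⟩
        · simp [addB]; grind [IsPart]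
        · intro x hx; simp only [addB, addO]; grind
      · refine ⟨?_, Or.inl ⟨rfl, ?_⟩⟩
        · simp [addB]; grind [IsPart]
        · intro x hx; simp only [addB, addO]; grind
      · refine ⟨?_, Or.inl ⟨rfl, ?_⟩⟩
        · simp [addB]; grind [IsPart]
        · intro x hx; simp only [addB, addO]; grind
    · rcases a3 with rfl | ⟨p, rfl, hp, hpr, hb, hd1⟩ | ⟨rfl, h0⟩
      · refine ⟨?_, Or.inl ⟨rfl, ?_⟩⟩
        · simp [addB]; grind [IsPart]
        · intro x hx; simp only [addB, addO]; grind
      · refine ⟨?_, Or.inl ⟨rfl, ?_⟩⟩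
        · simp [addB]; grind [IsPart]
        · intro x hx; simp only [addB, addO]; grind
      · refine ⟨?_, Or.inl ⟨rfl, ?_⟩⟩
        · simp [addB]; grind [IsPart]
        · intro x hx; simp only [addB, addO]; grind
  · have hng : ν (g+1) < ν g := (hole_hat ⟨hm, hn, hd⟩ ⟨h1, Or.inr ⟨g, rfl, hg, hg1, hg2⟩⟩).2.2.2
    have e1 := hm.anti (x := g) (y := r)
    have e2 := hm.anti (x := g) (y := h)
    have e3 := hn.anti (x := g) (y := h)
    rcases a3 with rfl | ⟨p, rfl, hp, hpr, hb, hd1⟩ | ⟨rfl, h0⟩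
    · simp only [stepO]
      unfold stepR HoleOK
      have := hm.anti (x := g+1) (y := r)
      have := hn.anti (x := g+1) (y := r)
      have := hg2 (g+1)
      have := hg2 r
      have := a1 h
      have := a2' r rfl h
      have := a2' r rfl g
      have := a1 g
      split_ifs with hc hc2 hc2
      · refine ⟨?_, Or.inr ⟨_, rfl, ?_, ?_, ?_⟩⟩ <;> simp only [addB, addO] <;> grind [IsPart]
      · refine ⟨?_, Or.inr ⟨_, rfl, ?_, ?_, ?_⟩⟩ <;> simp only [addB, addO] <;> grind [IsPart]
      · refine ⟨?_, Or.inr ⟨_, rfl, ?_, ?_, ?_⟩⟩ <;> simp only [addB, addO] <;> grind [IsPart]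
      · refine ⟨?_, Or.inr ⟨_, rfl, ?_, ?_, ?_⟩⟩ <;> simp only [addB, addO] <;> grind [IsPart]
    · simp only [stepO]
      unfold stepR HoleOK
      have := hm.anti (x := h+1) (y := p)
      have := hm.anti (x := g) (y := p)
      have := hm.anti (x := g+1) (y := p)
      have := hm.anti (x := r) (y := g)
      have := hb g
      have := hb h
      have := hb r
      have := hg2 (g+1)
      have := hg2 p
      have := hg2 r
      have := a1 h
      have := a2' p rfl h
      have := a2' p rfl g
      have := a1 g
      split_ifs with hc hc2 hc2
      · refine ⟨?_, Or.inr ⟨_, rfl, ?_, ?_, ?_⟩⟩ <;> simp only [addB, addO] <;> grind [IsPart]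
      · refine ⟨?_, Or.inr ⟨_, rfl, ?_, ?_, ?_⟩⟩ <;> simp only [addB, addO] <;> grind [IsPart]
      · refine ⟨?_, Or.inr ⟨_, rfl, ?_, ?_, ?_⟩⟩ <;> simp only [addB, addO] <;> grind [IsPart]
      · refine ⟨?_, Or.inr ⟨_, rfl, ?_, ?_, ?_⟩⟩ <;> simp only [addB, addO] <;> grind [IsPart]
    · simp only [stepO]
      unfold stepR HoleOK
      have := hg2 r
      have := a1 h
      have := a1 g
      have := hd r
      split_ifs with hc
      · refine ⟨?_, Or.inr ⟨_, rfl, ?_, ?_, ?_⟩⟩ <;> simp only [addB, addO] <;> grind [IsPart]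
      · refine ⟨?_, Or.inr ⟨_, rfl, ?_, ?_, ?_⟩⟩ <;> simp only [addB, addO] <;> grind [IsPart]

end

section

theorem stepO_comm {μ ν : ℕ → ℕ} (hd : Diff μ ν) {h r : ℕ} {ho o : Option ℕ}
    (hh : HoleOK μ ν h ho) (ha : AddOK μ ν r o) :
    addO (subO ν ho) (stepO ν ho o).1 = subO (addO ν o) (stepO ν ho o).2 := by
  cases ho with
  | none => rfl
  | some g =>
    cases o with
    | none => rfl
    | some q => exact step_comm hd.2.1 (hole_hat hd hh).2.2.2 ha.2.1

theorem cube_add {μ ν : ℕ → ℕ} (hd : Diff μ ν) {h r : ℕ} {ho o : Option ℕ}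
    (hh : HoleOK μ ν h ho) (ha : AddOK μ ν r o) :
    AddOK (subB μ h) (subO ν ho) (stepR μ h r).1 (stepO ν ho o).1 := by
  have hd' := (hd.add ha).sub (cube_hole hd hh ha)
  refine ⟨?_, ?_, ?_⟩
  · rw [step_comm hd.1 hh.1 ha.1]; exact hd'.1
  · rw [stepO_comm hd hh ha]; exact hd'.2.1
  clear hd'
  obtain ⟨hm, hn, hd⟩ := hd
  obtain ⟨a1, a2, a3⟩ := ha
  rw [addB_isPart hm] at a1
  have a2' : ∀ q, o = some q → ∀ x, x + 1 = q → ν q < ν x := by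
    rintro q rfl; exact (addB_isPart hn).1 a2
  clear a2
  obtain ⟨h1, h2⟩ := hh
  have hmr := hm.anti (x := r) (y := h)
  have hmr2 := hm.anti (x := h) (y := r)
  have hmr3 := hm.anti (x := h+1) (y := r)
  rcases h2 with ⟨rfl, h2⟩ | ⟨g, rfl, hg, hg1, hg2⟩
  · simp only [stepO, subO]
    unfold stepR
    have := a1 h
    have := h2 r
    have := h2 h
    split_ifs with hc
    · rcases a3 with rfl | ⟨p, rfl, hp, hpr, hb, hd1⟩ | ⟨rfl, h0⟩
      · right; left
        refine ⟨_, rfl, ?_, ?_, ?_, ?_⟩ <;> simp only [subB] <;> grind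
      · right; left
        refine ⟨_, rfl, ?_, ?_, ?_, ?_⟩ <;> simp only [subB] <;> grind
      · right; right
        refine ⟨by trivial, ?_⟩; simp only [subB]; grind
    · rcases a3 with rfl | ⟨p, rfl, hp, hpr, hb, hd1⟩ | ⟨rfl, h0⟩
      · left; rfl
      · have := hm.anti (x := h+1) (y := p)
        right; left
        refine ⟨_, rfl, ?_, ?_, ?_, ?_⟩ <;> simp only [subB] <;> grind
      · right; right
        refine ⟨by trivial, ?_⟩; simp only [subB]; grind
  · have hng : ν (g+1) < ν g := (hole_hat ⟨hm, hn, hd⟩ ⟨h1, Or.inr ⟨g, rfl, hg, hg1, hg2⟩⟩).2.2.2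
    have e1 := hm.anti (x := g) (y := r)
    have e2 := hm.anti (x := g) (y := h)
    have e3 := hn.anti (x := g) (y := h)
    rcases a3 with rfl | ⟨p, rfl, hp, hpr, hb, hd1⟩ | ⟨rfl, h0⟩
    · simp only [stepO, subO]
      unfold stepR
      have := hm.anti (x := g+1) (y := r)
      have := hn.anti (x := g+1) (y := r)
      have := hm.anti (x := g+1) (y := h)
      have := hn.anti (x := g+1) (y := h)
      have := hg2 (g+1)
      have := hg2 r
      have := hg2 h
      have := a1 h
      have := a2' r rfl h
      have := a2' r rfl g
      have := a1 g
      have := hd r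
      have := hd h
      split_ifs with hc hc2 hc2
      · left; simp; omega
      · exfalso; omega
      · right; left
        refine ⟨_, rfl, ?_, ?_, ?_, ?_⟩ <;> simp only [subB] <;> grind
      · left; rfl
    · simp only [stepO, subO]
      unfold stepR
      have := hm.anti (x := h+1) (y := p)
      have := hm.anti (x := g) (y := p)
      have := hm.anti (x := g+1) (y := p)
      have := hm.anti (x := r) (y := g)
      have := hb g
      have := hb h
      have := hb r
      have := hg2 (g+1)
      have := hg2 p
      have := hg2 r
      have := hg2 h
      have := a1 h
      have := a2' p rfl h
      have := a2' p rfl g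
      have := a1 g
      have := hd p
      have := hd h
      have := hd r
      split_ifs with hc hc2 hc2
      · right; left
        refine ⟨_, rfl, ?_, ?_, ?_, ?_⟩ <;> simp only [subB] <;> grind
      · by_cases hgr : g = r
        · left; simp; omega
        · right; left
          refine ⟨_, rfl, ?_, ?_, ?_, ?_⟩ <;> simp only [subB] <;> grind
      · right; left
        refine ⟨_, rfl, ?_, ?_, ?_, ?_⟩ <;> simp only [subB] <;> grind
      · right; left
        refine ⟨_, rfl, ?_, ?_, ?_, ?_⟩ <;> simp only [subB] <;> grind
    · simp only [stepO, subO]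
      unfold stepR
      right; right
      have := hg2 r
      have := hg2 h
      have := a1 h
      have := a1 g
      have := hd r
      have := hn.anti (x := g+1) (y := r)
      have := hd (g+1)
      have := hg2 (g+1)
      have := hm.anti (x := g+1) (y := h)
      split_ifs with hc
      · refine ⟨by trivial, ?_⟩; simp only [subB]; grind
      · refine ⟨by trivial, ?_⟩; simp only [subB]; grind

end

section

def VM : (ℕ → ℕ) → (ℕ → ℕ) → List (ℕ × ℕ × Option ℕ) → Prop
  | _, _, [] => True
  | μ, ν, (_, r, o) :: M => AddOK μ ν r o ∧ VM (addB μ r) (addO ν o) M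

def topL (M : List (ℕ × ℕ × Option ℕ)) : List (ℕ × ℕ) := M.map (fun x => (x.1, x.2.1))

def hatL : List (ℕ × ℕ × Option ℕ) → List (ℕ × ℕ)
  | [] => []
  | (_, _, none) :: M => hatL M
  | (v, _, some p) :: M => (v, p) :: hatL M

def noneL : List (ℕ × ℕ × Option ℕ) → List ℕ
  | [] => []
  | (v, _, none) :: M => v :: noneL M
  | (_, _, some _) :: M => noneL M

def HatRel (ν : ℕ → ℕ) (L L' : List (ℕ × ℕ)) : Option ℕ → Option ℕ → Prop
  | none, ho' => L' = L ∧ ho' = none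
  | some g, ho' => L' = (slide ν g L).1 ∧ ho' = some (slide ν g L).2

theorem slide_VM : ∀ (M : List (ℕ × ℕ × Option ℕ)) (μ ν : ℕ → ℕ) (h : ℕ) (ho : Option ℕ),
    Diff μ ν → HoleOK μ ν h ho → VM μ ν M → ∃ M' ho',
      VM (subB μ h) (subO ν ho) M' ∧ topL M' = (slide μ h (topL M)).1 ∧
      HoleOK (shapeL μ (topL M)) (shapeL ν (hatL M)) (slide μ h (topL M)).2 ho' ∧
      HatRel ν (hatL M) (hatL M') ho ho' ∧ noneL M' = noneL M := by
  intro M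
  induction M with
  | nil =>
    intro μ ν h ho hd hh _
    refine ⟨[], ho, trivial, rfl, hh, ?_, rfl⟩
    cases ho <;> simp [HatRel, hatL, slide]
  | cons x M ih =>
    obtain ⟨v, r, o⟩ := x
    intro μ ν h ho hd hh ⟨ha, hM⟩
    obtain ⟨M', ho', h1, h2, h3, h4, h5⟩ :=
      ih (addB μ r) (addO ν o) _ _ (hd.add ha) (cube_hole hd hh ha) hM
    refine ⟨(v, (stepR μ h r).1, (stepO ν ho o).1) :: M', ho', ⟨cube_add hd hh ha, ?_⟩, ?_, ?_, ?_, ?_⟩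
    · rw [step_comm hd.1 hh.1 ha.1, stepO_comm hd hh ha]; exact h1
    · simp only [topL, List.map_cons, slide]; rw [← topL, h2]; rfl
    · cases o <;> exact h3
    · cases ho with
      | none =>
        cases o with
        | none => exact h4
        | some q => exact ⟨by simp [stepO, hatL]; exact h4.1, h4.2⟩
      | some g =>
        cases o with
        | none => exact h4
        | some q => exact ⟨by simp [stepO, hatL, slide]; exact h4.1, h4.2⟩
    · cases ho <;> cases o <;> simp [stepO, noneL, h5]

theorem VM_diff : ∀ (M : List (ℕ × ℕ × Option ℕ)) (μ ν : ℕ → ℕ), Diff μ ν → VM μ ν M →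
    Diff (shapeL μ (topL M)) (shapeL ν (hatL M)) := by
  intro M
  induction M with
  | nil => intro μ ν hd _; exact hd
  | cons x M ih =>
    obtain ⟨v, r, o⟩ := x
    intro μ ν hd ⟨ha, hM⟩
    have := ih _ _ (hd.add ha) hM
    cases o <;> exact this

/-- lattice lists -/
def LatL : (ℕ → ℕ) → List (ℕ × ℕ) → Prop
  | _, [] => True
  | μ, (_, r) :: L => IsPart (addB μ r) ∧ LatL (addB μ r) L

theorem VM_top : ∀ (M : List (ℕ × ℕ × Option ℕ)) (μ ν : ℕ → ℕ), VM μ ν M → LatL μ (topL M) := by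
  intro M
  induction M with
  | nil => intro μ ν _; trivial
  | cons x M ih =>
    obtain ⟨v, r, o⟩ := x
    intro μ ν ⟨ha, hM⟩
    exact ⟨ha.1, ih _ _ hM⟩

theorem VM_hat : ∀ (M : List (ℕ × ℕ × Option ℕ)) (μ ν : ℕ → ℕ), VM μ ν M → LatL ν (hatL M) := by
  intro M
  induction M with
  | nil => intro μ ν _; trivial
  | cons x M ih =>
    obtain ⟨v, r, o⟩ := x
    intro μ ν ⟨ha, hM⟩
    have := ih _ _ hM
    cases o with
    | none => exact this
    | some q => exact ⟨ha.2.1, this⟩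

theorem slide_shape : ∀ (L : List (ℕ × ℕ)) (μ : ℕ → ℕ) (h : ℕ), IsPart μ → μ (h + 1) < μ h → LatL μ L →
    shapeL (subB μ h) (slide μ h L).1 = subB (shapeL μ L) (slide μ h L).2 ∧
    shapeL μ L ((slide μ h L).2 + 1) < shapeL μ L (slide μ h L).2 := by
  intro L
  induction L with
  | nil => intro μ h hm h1 _; exact ⟨rfl, h1⟩
  | cons x L ih =>
    obtain ⟨v, r⟩ := x
    intro μ h hm h1 ⟨h2, h3⟩
    simp only [slide, shapeL]
    rw [step_comm hm h1 h2]
    apply ih _ _ h2 _ h3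
    rw [addB_isPart hm] at h2
    have := h2 h
    have := hm r
    unfold stepR
    split_ifs <;> simp only [addB] <;> grind

theorem slide_length : ∀ (L : List (ℕ × ℕ)) (μ : ℕ → ℕ) (h : ℕ), (slide μ h L).1.length = L.length := by
  intro L
  induction L with
  | nil => intros; rfl
  | cons x L ih => intros; simp [slide, ih]

def zeroP : ℕ → ℕ := fun _ => 0

inductive IsWordOf : ℕ → List (ℕ × ℕ) → List (ℕ × ℕ) → Prop
  | nil (k : ℕ) : IsWordOf k [] []
  | cons (k v a : ℕ) (L ps : List (ℕ × ℕ))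
      (ha : a + ((slide (addB zeroP 0) 0 L).2 + 1) =
        k + shapeL zeroP ((v, 0) :: L) (slide (addB zeroP 0) 0 L).2)
      (h : IsWordOf k (slide (addB zeroP 0) 0 L).1 ps) : IsWordOf k ((v, 0) :: L) ((v, a) :: ps)

def IsCol (C : List ℕ) (μ ν : ℕ → ℕ) (k N : ℕ) : Prop :=
  C.Pairwise (· < ·) ∧ ∀ y, y ∈ C ↔ ∃ i, i < N ∧ μ i = ν i ∧ y + i = k + μ i

theorem col_none {C : List ℕ} {μ ν : ℕ → ℕ} {k N h a : ℕ} (hC : IsCol C μ ν k N)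
    (hd : Diff μ ν) (hh : HoleOK μ ν h none) (hN : h < N) (ha : a + (h + 1) = k + μ h) :
    colIns a C = (C ++ [a], none) ∧ IsCol (C ++ [a]) (subB μ h) ν k N := by
  obtain ⟨h1, h2⟩ := hh
  simp at h2
  have hlt : ∀ c ∈ C, c < a := by
    intro c hc
    obtain ⟨i, hi, hi2, hi3⟩ := (hC.2 c).1 hc
    have := h2 i
    have := hd.1.anti (x := h+1) (y := i)
    omega
  refine ⟨?_, ?_, ?_⟩
  · unfold colIns
    rw [if_pos]
    simpa using hlt
  · rw [List.pairwise_append]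
    exact ⟨hC.1, by simp, by simpa using hlt⟩
  · intro y
    simp only [List.mem_append, List.mem_singleton, hC.2]
    constructor
    · rintro (⟨i, hi, hi2, hi3⟩ | rfl)
      · have := h2 i
        refine ⟨i, hi, ?_, ?_⟩ <;> simp only [subB] <;> split_ifs <;> omega
      · have := h2 h le_rfl
        refine ⟨h, hN, ?_, ?_⟩ <;> simp only [subB] <;> split_ifs <;> omega
    · rintro ⟨i, hi, hi2, hi3⟩
      simp only [subB] at hi2 hi3
      split_ifs at hi2 hi3 with hih
      · subst hih; right; omega
      · left; exact ⟨i, hi, hi2, hi3⟩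

theorem col_some {C : List ℕ} {μ ν : ℕ → ℕ} {k N h a g : ℕ} (hC : IsCol C μ ν k N)
    (hd : Diff μ ν) (hh : HoleOK μ ν h (some g)) (hN : h < N) (ha : a + (h + 1) = k + μ h) :
    ∃ C' c, colIns a C = (C', some c) ∧ c + (g + 1) = k + 1 + ν g ∧
      IsCol C' (subB μ h) (subB ν g) k N := by
  obtain ⟨hg, hg1, hg2, hg3⟩ := hole_hat hd hh
  have h1 := hh.1
  have hgh := hd.1.anti hg
  obtain ⟨c, hc⟩ : ∃ c, c + g = k + μ g := ⟨k + μ g - g, by omega⟩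
  have hcC : c ∈ C := (hC.2 c).2 ⟨g, by omega, hg1, hc⟩
  have hac : a < c := by omega
  have key : ∀ y ∈ C, y < c → y < a := by
    intro y hy hyc
    obtain ⟨i, hi, hi2, hi3⟩ := (hC.2 y).1 hy
    have h4 := hg2 i
    have h5 := hd.1.anti (x := h+1) (y := i)
    have h6 := hd.1.anti (x := i) (y := g)
    by_cases h7 : i ≤ g
    · omega
    · by_cases h8 : i ≤ h
      · omega
      · omega
  have hfind : C.find? (fun c => decide (a < c)) = some c := by
    cases hf : C.find? (fun c => decide (a < c)) with
    | none =>
      rw [List.find?_eq_none] at hf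
      have := hf c hcC
      simp at this; omega
    | some b =>
      rw [List.find?_eq_some_iff_append] at hf
      obtain ⟨hb, as, bs, hab, has⟩ := hf
      simp at hb has
      have hbC : b ∈ C := by rw [hab]; simp
      have hb2 : ¬ b < c := fun hbc => by have := key b hbC hbc; omega
      rw [hab] at hcC
      simp at hcC
      rcases hcC with h8 | rfl | h8
      · have := has c h8; omega
      · rfl
      · have := hC.1
        rw [hab, List.pairwise_append] at this
        have := (List.pairwise_cons.1 this.2.1).1 c h8
        omega
  refine ⟨C.map (fun x => if x = c then a else x), c, ?_, by omega, ?_, ?_⟩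
  · unfold colIns
    rw [if_neg, if_neg, hfind]
    · rintro ⟨haC, -⟩
      exact absurd (key a haC hac) (by omega)
    · simp; exact ⟨c, hcC, by omega⟩
  · rw [List.pairwise_map]
    refine hC.1.imp_of_mem ?_
    intro x y hx hy hxy
    have := key x hx
    split_ifs <;> omega
  · intro y
    have h2 := hg2 h
    simp only [List.mem_map, subB]
    constructor
    · rintro ⟨x, hx, rfl⟩
      split_ifs with hxc
      · refine ⟨h, hN, ?_⟩
        rw [if_pos rfl]
        rcases Nat.lt_or_ge g h with h3 | h3
        · rw [if_neg (by omega)]; omega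
        · have : g = h := by omega
          subst this
          rw [if_pos rfl]; omega
      · obtain ⟨i, hi, hi2, hi3⟩ := (hC.2 x).1 hx
        have := hg2 i
        have h4 : i ≠ g := by rintro rfl; omega
        have h5 : i ≠ h := by rintro rfl; omega
        exact ⟨i, hi, by simp [h4, h5]; omega, by simp [h5]; omega⟩
    · rintro ⟨i, hi, hi2, hi3⟩
      by_cases hih : i = h
      · subst hih
        refine ⟨c, hcC, ?_⟩
        simp at hi3 ⊢; omega
      · by_cases hig : i = g
        · subst hig; simp [hih] at hi2 hi3; omega
        · simp [hih, hig] at hi2 hi3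
          have hy : y ∈ C := (hC.2 y).2 ⟨i, hi, hi2, hi3⟩
          refine ⟨y, hy, ?_⟩
          rw [if_neg]
          rintro rfl
          have h4 := hd.1.anti (x := i) (y := g)
          have h5 := hd.1.anti (x := g) (y := i)
          omega

theorem transduce {k : ℕ} {L ps : List (ℕ × ℕ)} (hw : IsWordOf k L ps) :
    ∀ (M : List (ℕ × ℕ × Option ℕ)) (C : List ℕ) (N : ℕ), topL M = L → VM zeroP zeroP M →
    (∀ i, 0 < shapeL zeroP L i → i < N) →
    IsCol C (shapeL zeroP (topL M)) (shapeL zeroP (hatL M)) k N →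
    ∃ out C', IsWordOf (k + 1) (hatL M) out ∧ ∀ P Q D,
      ps.foldl egStep (C :: P, D :: Q) =
        (C' :: (out.foldl egStep (P, Q)).1, (D ++ noneL M) :: (out.foldl egStep (P, Q)).2) := by
  induction hw with
  | nil =>
    intro M C N hM _ _ _
    have : M = [] := by simpa [topL] using hM
    subst this
    exact ⟨[], C, IsWordOf.nil _, by intros; simp [noneL]⟩
  | cons v a L ps ha hw ih =>
    intro M C N hM hV hN hC
    cases M with
    | nil => simp [topL] at hM
    | cons x M =>
      obtain ⟨v', r, o⟩ := x
      have hM' : (v', r) = (v, 0) ∧ topL M = L := by simpa [topL] using hM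
      obtain ⟨hM1, rfl⟩ := hM'
      simp only [Prod.mk.injEq] at hM1
      obtain ⟨rfl, rfl⟩ := hM1
      obtain ⟨hA, hV⟩ := hV
      have hz : IsPart zeroP := fun p => le_rfl
      have hd0 : Diff zeroP zeroP := ⟨hz, hz, fun p => Or.inl rfl⟩
      have hd1 := hd0.add hA
      have hho : ∃ ho, HoleOK (addB zeroP 0) (addO zeroP o) 0 ho ∧ subO (addO zeroP o) ho = zeroP ∧
          ho = o := by
        rcases hA.2.2 with rfl | ⟨p, rfl, hp, hpr, hb, hd1⟩ | ⟨rfl, h0⟩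
        · refine ⟨some 0, ⟨by simp [addB, zeroP], Or.inr ⟨0, rfl, le_rfl, rfl, by omega⟩⟩, ?_, rfl⟩
          funext x; simp [subO, addO, subB, addB, zeroP]; split_ifs <;> rfl
        · simp [zeroP] at hd1
        · refine ⟨none, ⟨by simp [addB, zeroP], Or.inl ⟨rfl, ?_⟩⟩, rfl, rfl⟩
          intro x hx; obtain rfl : x = 0 := by omega
          rfl
      obtain ⟨ho, hH, hs, rfl⟩ := hho
      have hsub : subB (addB zeroP 0) 0 = zeroP := by
        funext x; simp [subB, addB, zeroP]; split_ifs <;> rfl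
      obtain ⟨M', ho', h1, h2, h3, h4, h5⟩ := slide_VM M _ _ _ _ hd1 hH hV
      rw [hsub, hs] at h1
      have hdM := VM_diff M _ _ hd1 hV
      have hLat := VM_top _ _ _ hV
      have hsh := (slide_shape (topL M) (addB zeroP 0) 0 hd1.1 hH.1 hLat)
      rw [hsub, ← h2] at hsh
      have hshN : ∀ i, 0 < shapeL zeroP (slide (addB zeroP 0) 0 (topL M)).1 i → i < N := by
        intro i hi
        apply hN
        rw [← h2, hsh.1] at hi
        simp only [subB] at hi
        simp only [shapeL]
        split_ifs at hi <;> omega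
      have hlt : (slide (addB zeroP 0) 0 (topL M)).2 < N := by
        apply hN
        have := h3.1
        simp only [shapeL]
        omega
      cases ho with
      | none =>
        obtain ⟨h4a, rfl⟩ := h4
        have hcol := col_none hC hdM h3 hlt ha
        have hsh1 := hsh.1
        obtain ⟨out, C', e1, e2⟩ := ih M' _ N h2 h1 hshN (by
          rw [hsh1, h4a]; exact hcol.2)
        refine ⟨out, C', ?_, ?_⟩
        · rw [h4a] at e1; exact e1
        · intro P Q D
          rw [List.foldl_cons]
          have : egStep (C :: P, D :: Q) (v', a) = ((C ++ [a]) :: P, (D ++ [v']) :: Q) := by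
            simp [egStep, egInsert, hcol.1]
          rw [this, e2, h5]
          simp [noneL]
      | some g0 =>
        obtain ⟨h4a, rfl⟩ := h4
        obtain ⟨C1, c, f1, f2, f3⟩ := col_some hC hdM h3 hlt ha
        have hg0 : g0 = 0 := by
          have := (hole_hat hd1 hH).1; omega
        subst hg0
        have hLat2 := VM_hat _ _ _ hV
        have hsh2 := (slide_shape (hatL M) (addB zeroP 0) 0 hd1.1 hH.1 hLat2)
        rw [hsub] at hsh2
        have hsh1 := hsh.1
        obtain ⟨out, C', e1, e2⟩ := ih M' C1 N h2 h1 hshN (by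
          rw [hsh1, h4a]; simp only [addO]; rw [hsh2.1]; exact f3)
        refine ⟨(v', c) :: out, C', ?_, ?_⟩
        · simp only [hatL]
          refine IsWordOf.cons _ _ _ _ _ f2 ?_
          rw [h4a] at e1; exact e1
        · intro P Q D
          rw [List.foldl_cons]
          have : egStep (C :: P, D :: Q) (v', a) =
              (C1 :: (egStep (P, Q) (v', c)).1, D :: (egStep (P, Q) (v', c)).2) := by
            simp only [egStep, egInsert, f1, List.length_cons, Nat.add_lt_add_iff_right]
            split_ifs <;> simp
          rw [this, e2, h5]
          simp [noneL]

end

section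

def flagM : (ℕ → ℕ) → List (ℕ × ℕ) → List (ℕ × ℕ × Option ℕ)
  | _, [] => []
  | μ, (v, r) :: L => (v, r, if μ r = 0 then none else some r) :: flagM (addB μ r) L

def prd (μ : ℕ → ℕ) : ℕ → ℕ := fun p => μ p - 1

def colL (c : ℕ) : (ℕ → ℕ) → List (ℕ × ℕ) → List ℕ
  | _, [] => []
  | μ, (v, r) :: L => if μ r = c then v :: colL c (addB μ r) L else colL c (addB μ r) L

theorem prd_part {μ : ℕ → ℕ} (h : IsPart μ) : IsPart (prd μ) := by
  intro p; have := h p; simp only [prd]; omega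

theorem addO_prd (μ : ℕ → ℕ) (r : ℕ) :
    addO (prd μ) (if μ r = 0 then none else some r) = prd (addB μ r) := by
  split_ifs with h
  · funext x; simp only [addO, prd, addB]; split_ifs with h1
    · subst h1; omega
    · rfl
  · funext x; simp only [addO, prd, addB]; split_ifs with h1
    · subst h1; omega
    · rfl

theorem flagM_VM : ∀ (L : List (ℕ × ℕ)) (μ : ℕ → ℕ), LatL μ L → VM μ (prd μ) (flagM μ L) := by
  intro L
  induction L with
  | nil => intros; trivial
  | cons x L ih =>
    obtain ⟨v, r⟩ := x
    intro μ ⟨h1, h2⟩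
    refine ⟨⟨h1, ?_, ?_⟩, ?_⟩
    · rw [addO_prd]; exact prd_part h1
    · split_ifs with h
      · right; right; exact ⟨rfl, h⟩
      · left; rfl
    · rw [addO_prd]; exact ih _ h2

theorem flagM_top : ∀ (L : List (ℕ × ℕ)) (μ : ℕ → ℕ), topL (flagM μ L) = L := by
  intro L
  induction L with
  | nil => intros; rfl
  | cons x L ih => intro μ; simp only [flagM, topL, List.map_cons]; rw [← topL, ih]

theorem flagM_shape : ∀ (L : List (ℕ × ℕ)) (μ : ℕ → ℕ),
    shapeL (prd μ) (hatL (flagM μ L)) = prd (shapeL μ L) := by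
  intro L
  induction L with
  | nil => intros; rfl
  | cons x L ih =>
    obtain ⟨v, r⟩ := x
    intro μ
    have h1 := ih (addB μ r)
    rw [← addO_prd] at h1
    simp only [flagM, shapeL]
    split_ifs with h
    · simp only [if_pos h] at h1; exact h1
    · simp only [if_neg h] at h1; exact h1

theorem flagM_none : ∀ (L : List (ℕ × ℕ)) (μ : ℕ → ℕ), noneL (flagM μ L) = colL 0 μ L := by
  intro L
  induction L with
  | nil => intros; rfl
  | cons x L ih =>
    obtain ⟨v, r⟩ := x
    intro μ
    simp only [flagM, colL]
    split_ifs with h <;> simp [noneL, ih]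

theorem flagM_col (c : ℕ) : ∀ (L : List (ℕ × ℕ)) (μ : ℕ → ℕ),
    colL c (prd μ) (hatL (flagM μ L)) = colL (c + 1) μ L := by
  intro L
  induction L with
  | nil => intros; rfl
  | cons x L ih =>
    obtain ⟨v, r⟩ := x
    intro μ
    have h1 := ih (addB μ r)
    rw [← addO_prd] at h1
    simp only [flagM, colL]
    split_ifs with h h2 h2
    · omega
    · simp only [if_pos h] at h1; exact h1
    · simp only [if_neg h] at h1; simp only [hatL, colL]
      rw [if_pos (by simp only [prd]; omega)]
      exact congrArg _ h1
    · simp only [if_neg h] at h1; simp only [hatL, colL]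
      rw [if_neg (by simp only [prd]; omega)]
      exact h1

theorem shapeL_bound : ∀ (L : List (ℕ × ℕ)) (μ : ℕ → ℕ), (∃ N, ∀ i, 0 < μ i → i < N) →
    ∃ N, ∀ i, 0 < shapeL μ L i → i < N := by
  intro L
  induction L with
  | nil => intro μ h; exact h
  | cons x L ih =>
    obtain ⟨v, r⟩ := x
    intro μ ⟨N, h⟩
    apply ih
    refine ⟨max N (r + 1), ?_⟩
    intro i hi
    simp only [addB] at hi
    have := h i
    split_ifs at hi <;> omega

theorem shapeL_part : ∀ (L : List (ℕ × ℕ)) (μ : ℕ → ℕ), IsPart μ → LatL μ L → IsPart (shapeL μ L) := by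
  intro L
  induction L with
  | nil => intro μ h _; exact h
  | cons x L ih =>
    obtain ⟨v, r⟩ := x
    intro μ h ⟨h1, h2⟩
    exact ih _ h1 h2

theorem prd_zero : prd zeroP = zeroP := rfl

theorem shapeL_mono : ∀ (L : List (ℕ × ℕ)) (μ : ℕ → ℕ) (i : ℕ), μ i ≤ shapeL μ L i := by
  intro L
  induction L with
  | nil => intro μ i; exact le_rfl
  | cons x L ih =>
    obtain ⟨v, r⟩ := x
    intro μ i
    refine le_trans ?_ (ih (addB μ r) i)
    simp only [addB]; split_ifs <;> omega

theorem hatL_le : ∀ M : List (ℕ × ℕ × Option ℕ), (hatL M).length ≤ M.length := by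
  intro M
  induction M with
  | nil => exact le_rfl
  | cons x M ih =>
    obtain ⟨v, r, o⟩ := x
    cases o <;> simp [hatL] <;> omega

theorem egQ_cols (n : ℕ) : ∀ (k : ℕ) (L ps : List (ℕ × ℕ)), L.length ≤ n → LatL zeroP L →
    IsWordOf k L ps →
    (ps.foldl egStep ([], [])).2 = (List.range (shapeL zeroP L 0)).map (fun c => colL c zeroP L) := by
  induction n with
  | zero =>
    intro k L ps hL _ hw
    cases hw with
    | nil => simp [shapeL, zeroP]
    | cons => simp at hL
  | succ n ih =>
    intro k L ps hL hlat hw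
    cases hL0 : L with
    | nil => subst hL0; cases hw; simp [shapeL, zeroP]
    | cons x L0 =>
      rw [← hL0]
      have hne : ps.foldl egStep ([], []) = ps.foldl egStep ([[]], [[]]) := by
        subst hL0
        cases hw
        simp [egStep, egInsert, colIns]
      rw [hne]
      obtain ⟨N, hN⟩ := shapeL_bound L zeroP ⟨0, by simp [zeroP]⟩
      have hz : IsPart zeroP := fun p => le_rfl
      have hVM := flagM_VM L zeroP hlat
      rw [prd_zero] at hVM
      have hsh := flagM_shape L zeroP
      rw [prd_zero] at hsh
      have hpart := shapeL_part L _ hz hlat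
      -- bound by the first column
      obtain ⟨N, hN1, hN2⟩ : ∃ N, (∀ i, 0 < shapeL zeroP L i → i < N) ∧
          (∀ i, i < N → 0 < shapeL zeroP L i) := by
        have hex : ∃ N, shapeL zeroP L N = 0 := ⟨N, by
          by_contra h; exact absurd (hN N (by omega)) (by omega)⟩
        refine ⟨Nat.find hex, ?_, ?_⟩
        · intro i hi
          by_contra h
          have := hpart.anti (x := Nat.find hex) (y := i) (by omega)
          have := Nat.find_spec hex
          omega
        · intro i hi
          have := Nat.find_min hex hi
          omega
      obtain ⟨out, C', h1, h2⟩ := transduce hw (flagM zeroP L) [] N (flagM_top _ _) hVM hN1 (by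
        rw [flagM_top, hsh]
        refine ⟨by simp, ?_⟩
        intro y
        simp only [List.not_mem_nil, false_iff, not_exists, not_and]
        intro i hi hi2
        have := hN2 i hi
        simp only [prd] at hi2; omega)
      rw [h2]
      have hlen : (hatL (flagM zeroP L)).length ≤ n := by
        subst hL0
        cases hw
        have h5 : ∀ v, hatL (flagM zeroP ((v, 0) :: L0)) = hatL (flagM (addB zeroP 0) L0) := by
          intro v; rfl
        rw [h5]
        refine (hatL_le _).trans ?_
        have := congrArg List.length (flagM_top L0 (addB zeroP 0))
        simp [topL] at this hL
        omega
      rw [ih (k + 1) _ out hlen (VM_hat _ _ _ hVM) h1, hsh]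
      have hpos : shapeL zeroP L 0 = prd (shapeL zeroP L) 0 + 1 := by
        have : 0 < shapeL zeroP L 0 := by
          subst hL0
          cases hw
          simp only [shapeL]
          have h5 := shapeL_mono L0 (addB zeroP 0) 0
          have h6 : addB zeroP 0 0 = 1 := by simp [addB, zeroP]
          omega
        simp only [prd]; omega
      rw [hpos, List.range_succ_eq_map]
      simp only [List.map_cons, List.map_map, flagM_none, List.nil_append, List.cons.injEq, true_and]
      apply List.map_congr_left
      intro c _
      simp only [Function.comp]
      have := flagM_col c L zeroP
      rw [prd_zero] at this
      exact this

def FitL (T : ℕ → ℕ → ℕ) : (ℕ → ℕ) → List (ℕ × ℕ) → Prop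
  | _, [] => True
  | μ, (v, r) :: L => T r (μ r) = v ∧ FitL T (addB μ r) L

theorem colL_get (T : ℕ → ℕ → ℕ) (c : ℕ) : ∀ (L : List (ℕ × ℕ)) (μ : ℕ → ℕ) (m : ℕ), IsPart μ →
    LatL μ L → FitL T μ L → (∀ p, p < m ↔ c < μ p) →
    ∀ p, (colL c μ L)[p]? = if c < shapeL μ L (m + p) then some (T (m + p) c) else none := by
  intro L
  induction L with
  | nil =>
    intro μ m _ _ _ hm p
    have := hm (m + p)
    simp only [colL, List.getElem?_nil]
    change none = if c < μ (m + p) then some (T (m + p) c) else none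
    rw [if_neg]; omega
  | cons x L ih =>
    obtain ⟨v, r⟩ := x
    intro μ m hμ ⟨h1, h2⟩ ⟨h3, h4⟩ hm p
    change _ = if c < shapeL (addB μ r) L (m + p) then some (T (m + p) c) else none
    simp only [colL]
    have ha := (addB_isPart hμ).1 h1
    by_cases hr : μ r = c
    · have hrm : r = m := by
        have e1 := hm r
        by_contra hne
        have e2 := ha (r - 1) (by omega)
        have e3 := hm (r - 1)
        omega
      subst hrm
      have hm' : ∀ p, p < r + 1 ↔ c < addB μ r p := by
        intro q
        have := hm q
        simp only [addB]
        split_ifs with hq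
        · subst hq; omega
        · omega
      rw [if_pos hr]
      cases p with
      | zero =>
        have h5 := shapeL_mono L (addB μ r) r
        have h6 : addB μ r r = μ r + 1 := by simp [addB]
        simp only [List.getElem?_cons_zero]
        rw [if_pos]
        · rw [← h3, hr]; rfl
        · change c < shapeL (addB μ r) L r
          omega
      | succ p =>
        have := ih (addB μ r) (r + 1) h1 h2 h4 hm' p
        simp only [List.getElem?_cons_succ]
        rw [this, show r + 1 + p = r + (p + 1) by omega]
    · rw [if_neg hr]
      apply ih (addB μ r) m h1 h2 h4
      intro q
      have := hm q
      simp only [addB]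
      split_ifs with hq
      · subst hq; omega
      · omega

theorem filterMap_if (n m : ℕ) (h : m ≤ n) (f : ℕ → ℕ) :
    (List.range n).filterMap (fun c => if c < m then some (f c) else none) = (List.range m).map f := by
  induction n with
  | zero => obtain rfl : m = 0 := by omega
            rfl
  | succ n ih =>
    rw [List.range_succ, List.filterMap_append]
    rcases Nat.lt_or_ge n m with h1 | h1
    · obtain rfl : m = n + 1 := by omega
      rw [List.range_succ, List.map_append]
      congr 1
      · rw [← List.filterMap_eq_map]
        apply List.filterMap_congr
        intro c hc
        simp at hc
        simp; omega
      · simp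
    · rw [ih h1]
      simp; omega

theorem Q_main (k : ℕ) (L ps : List (ℕ × ℕ)) (T : ℕ → ℕ → ℕ) (R : ℕ) (hlat : LatL zeroP L)
    (hw : IsWordOf k L ps) (hT : FitL T zeroP L) (hR : ∀ p, p < R ↔ 0 < shapeL zeroP L p) :
    colsToRows (ps.foldl egStep ([], [])).2 =
      (List.range R).map (fun p => (List.range (shapeL zeroP L p)).map (T p)) := by
  have hz : IsPart zeroP := fun p => le_rfl
  have hpart := shapeL_part L _ hz hlat
  have hget : ∀ c p, (colL c zeroP L)[p]? = if c < shapeL zeroP L p then some (T p c) else none := by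
    intro c p
    have := colL_get T c L zeroP 0 hz hlat hT (by simp [zeroP]) p
    simpa using this
  rw [egQ_cols L.length k L ps le_rfl hlat hw]
  have hmax : (((List.range (shapeL zeroP L 0)).map (fun c => colL c zeroP L)).map List.length).foldr max 0
      = R := by
    have hlen : ∀ c, (colL c zeroP L).length ≤ R := by
      intro c
      by_contra h
      have h1 := hget c R
      rw [List.getElem?_eq_getElem (by omega)] at h1
      have h2 := hR R
      rw [if_neg (by omega)] at h1
      simp at h1
    apply le_antisymm
    · have : ∀ l : List ℕ, (∀ x ∈ l, x ≤ R) → l.foldr max 0 ≤ R := by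
        intro l hl
        induction l with
        | nil => simp
        | cons a l ih => simp at hl ⊢; exact ⟨hl.1, ih hl.2⟩
      apply this
      simp only [List.map_map, List.mem_map]
      rintro x ⟨c, _, rfl⟩
      exact hlen c
    · rcases Nat.eq_zero_or_pos R with rfl | hR0
      · omega
      · have h0 : 0 < shapeL zeroP L 0 := (hR 0).1 hR0
        obtain ⟨s, hs⟩ : ∃ s, shapeL zeroP L 0 = s + 1 := ⟨_, (Nat.succ_pred_eq_of_pos h0).symm⟩
        rw [hs, List.range_succ_eq_map]
        simp only [List.map_cons, List.foldr_cons]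
        apply le_trans _ (le_max_left _ _)
        by_contra h
        have h1 := hget 0 (R - 1)
        rw [List.getElem?_eq_none (by omega), if_pos ((hR _).1 (by omega))] at h1
        simp at h1
  unfold colsToRows
  rw [hmax]
  apply List.map_congr_left
  intro p _
  rw [List.filterMap_map]
  simp only [Function.comp_def, hget]
  exact filterMap_if _ _ (hpart.anti (Nat.zero_le p)) _

end

section

def stripL (v : ℕ) : ℕ → (ℕ → ℕ) → (ℕ → ℕ) → List (ℕ × ℕ)
  | 0, _, _ => []
  | N + 1, μ, ν => List.replicate (ν N - μ N) (v, N) ++ stripL v N μ ν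

def Lof (lam : ℕ → ℕ → ℕ) : ℕ → List (ℕ × ℕ)
  | 0 => []
  | i + 1 => Lof lam i ++ stripL (i + 1) (i + 1) (lam i) (lam (i + 1))

/-- Gelfand–Tsetlin patterns -/
def GT (lam : ℕ → ℕ → ℕ) : Prop :=
  (∀ p, lam 0 p = 0) ∧ ∀ i p, lam i p ≤ lam (i + 1) p ∧ lam (i + 1) (p + 1) ≤ lam i p

theorem GT.part {lam} (h : GT lam) (i : ℕ) : IsPart (lam i) := by
  intro p
  exact (h.2 i (p + 1)).1.trans (h.2 i p).2

theorem GT.mono {lam} (h : GT lam) {i j : ℕ} (hij : i ≤ j) (p : ℕ) : lam i p ≤ lam j p := by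
  induction j, hij using Nat.le_induction with
  | base => exact le_rfl
  | succ j _ ih => exact ih.trans (h.2 j p).1

theorem GT.zero {lam} (h : GT lam) : ∀ (i p : ℕ), i ≤ p → lam i p = 0 := by
  intro i
  induction i with
  | zero => intro p _; exact h.1 p
  | succ i ih =>
    intro p hp
    obtain ⟨p, rfl⟩ : ∃ p', p = p' + 1 := ⟨p - 1, by omega⟩
    have := ih p (by omega)
    have := (h.2 i p).2
    omega

theorem shapeL_append : ∀ (L1 L2 : List (ℕ × ℕ)) (μ : ℕ → ℕ),
    shapeL μ (L1 ++ L2) = shapeL (shapeL μ L1) L2 := by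
  intro L1
  induction L1 with
  | nil => intros; rfl
  | cons x L ih => intro L2 μ; exact ih L2 (addB μ x.2)

theorem LatL_append : ∀ (L1 L2 : List (ℕ × ℕ)) (μ : ℕ → ℕ),
    LatL μ (L1 ++ L2) ↔ LatL μ L1 ∧ LatL (shapeL μ L1) L2 := by
  intro L1
  induction L1 with
  | nil => intros; simp [LatL, shapeL]
  | cons x L ih => intro L2 μ; simp only [List.cons_append, LatL, shapeL, ih, and_assoc]

theorem FitL_append (T : ℕ → ℕ → ℕ) : ∀ (L1 L2 : List (ℕ × ℕ)) (μ : ℕ → ℕ),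
    FitL T μ (L1 ++ L2) ↔ FitL T μ L1 ∧ FitL T (shapeL μ L1) L2 := by
  intro L1
  induction L1 with
  | nil => intros; simp [FitL, shapeL]
  | cons x L ih => intro L2 μ; simp only [List.cons_append, FitL, shapeL, ih, and_assoc]

theorem slide_append : ∀ (L1 L2 : List (ℕ × ℕ)) (μ : ℕ → ℕ) (h : ℕ),
    slide μ h (L1 ++ L2) = ((slide μ h L1).1 ++ (slide (shapeL μ L1) (slide μ h L1).2 L2).1,
      (slide (shapeL μ L1) (slide μ h L1).2 L2).2) := by
  intro L1
  induction L1 with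
  | nil => intros; rfl
  | cons x L ih => intro L2 μ h; simp [slide, shapeL, ih]

theorem shapeL_replicate (v p : ℕ) : ∀ (d : ℕ) (μ : ℕ → ℕ),
    shapeL μ (List.replicate d (v, p)) = fun x => if x = p then μ x + d else μ x := by
  intro d
  induction d with
  | zero => intro μ; funext x; simp [shapeL]
  | succ d ih =>
    intro μ
    rw [List.replicate_succ]
    simp only [shapeL, ih]
    funext x
    simp only [addB]
    split_ifs <;> omega

theorem strip_all (v : ℕ) (T : ℕ → ℕ → ℕ) (μ ν : ℕ → ℕ) (hν : IsPart ν) (h1 : ∀ p, μ p ≤ ν p) (h2 : ∀ p, ν (p + 1) ≤ μ p)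
    (hT : ∀ p c, μ p ≤ c → c < ν p → T p c = v) :
    ∀ (N : ℕ) (κ : ℕ → ℕ), (∀ p, κ p = if p < N then μ p else ν p) →
      shapeL κ (stripL v N μ ν) = ν ∧ LatL κ (stripL v N μ ν) ∧ FitL T κ (stripL v N μ ν) := by
  intro N
  induction N with
  | zero => intro κ hκ; exact ⟨by funext p; simp [stripL, shapeL, hκ], trivial, trivial⟩
  | succ N ih =>
    intro κ hκ
    simp only [stripL, shapeL_append, LatL_append, FitL_append]
    have e : ∀ p, shapeL κ (List.replicate (ν N - μ N) (v, N)) p = if p < N then μ p else ν p := by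
      intro p
      rw [shapeL_replicate]
      have := hκ p
      have := h1 p
      split_ifs at * <;> grind
    obtain ⟨a, b, c⟩ := ih _ e
    refine ⟨a, ⟨?_, b⟩, ?_, c⟩
    · have : ∀ (d : ℕ) (κ : ℕ → ℕ), IsPart κ → (∀ p, p + 1 = N → κ N + d ≤ κ p) →
          LatL κ (List.replicate d (v, N)) := by
        intro d
        induction d with
        | zero => intros; trivial
        | succ d ihd =>
          intro κ hk hp
          rw [List.replicate_succ]
          have : IsPart (addB κ N) := by
            intro p
            have := hp p
            have := hk p
            simp only [addB]
            split_ifs <;> grind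
          refine ⟨this, ihd _ this ?_⟩
          intro p hpN
          have := hp p hpN
          simp only [addB]
          split_ifs <;> omega
      apply this
      · intro p
        have := hκ p
        have := hκ (p + 1)
        have := h1 p
        have := h1 (p + 1)
        have := h2 p
        have := hν p
        split_ifs at * <;> omega
      · intro p hp
        have := hκ p
        have := hκ N
        have := h1 N
        have := h2 p
        subst hp
        split_ifs at * <;> omega
    · have : ∀ (d : ℕ) (κ : ℕ → ℕ), μ N ≤ κ N → κ N + d ≤ ν N →
          FitL T κ (List.replicate d (v, N)) := by
        intro d
        induction d with
        | zero => intros; trivial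
        | succ d ihd =>
          intro κ hk hp
          rw [List.replicate_succ]
          refine ⟨hT _ _ hk (by omega), ihd _ ?_ ?_⟩ <;> simp [addB] <;> omega
      have e2 := hκ N
      have e3 := h1 N
      rw [if_pos (by omega)] at e2
      apply this <;> omega

theorem slide_far (h : ℕ) : ∀ (L : List (ℕ × ℕ)) (κ : ℕ → ℕ), (∀ x ∈ L, x.2 ≠ h + 1) → slide κ h L = (L, h) := by
  intro L
  induction L with
  | nil => intros; rfl
  | cons x L ih =>
    intro κ hL
    have h1 := hL x (by simp)
    have : stepR κ h x.2 = (x.2, h) := by simp [stepR, h1]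
    simp only [slide]
    rw [this, ih _ (fun y hy => hL y (by simp [hy]))]

theorem slide_near (v h : ℕ) : ∀ (d : ℕ) (κ : ℕ → ℕ), κ (h + 1) + d ≤ κ h → κ (h + 1) < κ h →
    slide κ h (List.replicate d (v, h + 1)) =
      if κ (h + 1) + d = κ h then (List.replicate (d - 1) (v, h + 1) ++ [(v, h)], h + 1)
      else (List.replicate d (v, h + 1), h) := by
  intro d
  induction d with
  | zero =>
    intro κ h1 h2
    rw [if_neg (by omega)]; rfl
  | succ d ih =>
    intro κ h1 h2
    rw [List.replicate_succ]
    simp only [slide]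
    have a1 : addB κ (h + 1) (h + 1) = κ (h + 1) + 1 := by simp [addB]
    have a2 : addB κ (h + 1) h = κ h := by simp [addB]
    by_cases hd : κ (h + 1) + 1 = κ h
    · obtain rfl : d = 0 := by omega
      have : stepR κ h (h + 1) = (h, h + 1) := by simp [stepR, hd]
      rw [this]
      simp [slide, hd]
    · have : stepR κ h (h + 1) = (h + 1, h) := by simp [stepR, hd]
      rw [this]
      simp only
      rw [ih _ (by omega) (by omega), a1, a2]
      by_cases h3 : κ (h + 1) + (d + 1) = κ h
      · rw [if_pos (by omega), if_pos h3]
        obtain ⟨e, rfl⟩ : ∃ e, d = e + 1 := ⟨d - 1, by omega⟩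
        simp [List.replicate_succ]
      · rw [if_neg (by omega), if_neg h3]

theorem mem_strip (v : ℕ) (μ ν : ℕ → ℕ) : ∀ (N : ℕ) (x), x ∈ stripL v N μ ν → x.2 < N := by
  intro N
  induction N with
  | zero => intro x hx; simp [stripL] at hx
  | succ N ih =>
    intro x hx
    simp only [stripL, List.mem_append, List.mem_replicate] at hx
    rcases hx with ⟨_, rfl⟩ | hx
    · simp
    · have := ih x hx; omega

theorem strip_congr (v : ℕ) (μ ν μ' ν' : ℕ → ℕ) : ∀ N : ℕ, (∀ p, p < N → ν p - μ p = ν' p - μ' p) →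
    stripL v N μ ν = stripL v N μ' ν' := by
  intro N
  induction N with
  | zero => intros; rfl
  | succ N ih =>
    intro h
    simp only [stripL]
    rw [h N (by omega), ih (fun p hp => h p (by omega))]

theorem strip_slide (v : ℕ) (μ ν : ℕ → ℕ) (h : ℕ) (h1 : ∀ p, μ p ≤ ν p) (h2 : ∀ p, ν (p + 1) ≤ μ p)
    (h3 : μ (h + 1) < μ h) (h' : ℕ) (hh' : h' = if ν (h + 1) = μ h then h + 1 else h) :
    ∀ (N : ℕ) (κ : ℕ → ℕ), (∀ p, κ p = if p < N then μ p else ν p) → h + 2 ≤ N →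
      slide κ h (stripL v N μ ν) = (stripL v N (subB μ h) (subB ν h'), h') := by
  intro N κ hκ hN
  induction N, hN using Nat.le_induction generalizing κ with
  | base =>
    simp only [stripL]
    rw [slide_append, slide_near]
    · have e1 := hκ (h + 1)
      have e2 := hκ h
      have e3 := h1 (h + 1)
      have e4 := h2 h
      have e5 := h1 h
      rw [if_pos (by omega)] at e1 e2
      by_cases hc : ν (h + 1) = μ h
      · rw [if_pos hc] at hh'
        rw [if_pos (by omega)]
        subst hh'
        simp only
        rw [slide_append, slide_far (h+1) _ _ (by simp; omega), slide_far (h+1) _ _ (by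
          intro x hx; have := mem_strip _ _ _ _ _ hx; omega)]
        simp only [Prod.mk.injEq, and_true]
        have f1 : subB ν (h + 1) (h + 1) - subB μ h (h + 1) = ν (h + 1) - μ (h + 1) - 1 := by
          simp [subB]; omega
        have f2 : subB ν (h + 1) h - subB μ h h = (ν h - μ h) + 1 := by
          simp [subB]; omega
        rw [f1, f2, List.replicate_succ, List.append_assoc]
        rw [strip_congr v (subB μ h) (subB ν (h+1)) μ ν h]
        · simp
        · intro p hp; simp [subB]; split_ifs <;> omega
      · rw [if_neg hc] at hh'
        rw [if_neg (by omega)]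
        obtain rfl := hh'.symm
        simp only
        rw [slide_append, slide_far h _ _ (by simp), slide_far h _ _ (by
          intro x hx; have := mem_strip _ _ _ _ _ hx; omega)]
        simp only [Prod.mk.injEq, and_true]
        have f1 : subB ν h (h + 1) - subB μ h (h + 1) = ν (h + 1) - μ (h + 1) := by
          simp [subB]
        have f2 : subB ν h h - subB μ h h = (ν h - μ h) := by
          simp [subB]; omega
        rw [f1, f2]
        rw [strip_congr v (subB μ h) (subB ν h) μ ν h]
        intro p hp; simp [subB]; split_ifs <;> omega
    · have e1 := hκ (h + 1)
      have e2 := hκ h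
      have e3 := h1 (h + 1)
      have e4 := h2 h
      rw [if_pos (by omega)] at e1 e2
      omega
    · have e1 := hκ (h + 1)
      have e2 := hκ h
      rw [if_pos (by omega)] at e1 e2
      omega
  | succ N hN ih =>
    have e : ∀ p, shapeL κ (List.replicate (ν N - μ N) (v, N)) p = if p < N then μ p else ν p := by
      intro p
      rw [shapeL_replicate]
      have := hκ p
      have := h1 p
      split_ifs at * <;> grind
    simp only [stripL]
    rw [slide_append, slide_far h _ κ (by simp; omega), ih _ e]
    simp only [Prod.mk.injEq, and_true, List.append_cancel_right_eq]
    have : h' = h ∨ h' = h + 1 := by split_ifs at hh' <;> omega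
    congr 1
    simp [subB]; split_ifs <;> omega

def holeP (lam : ℕ → ℕ → ℕ) (r : ℕ) : ℕ → ℕ
  | 0 => 0
  | x + 1 => if x < r then 0 else
      if lam (x + 1) (holeP lam r x + 1) = lam x (holeP lam r x) then holeP lam r x + 1 else holeP lam r x

def lamP (lam : ℕ → ℕ → ℕ) (r : ℕ) : ℕ → ℕ → ℕ := fun x p =>
  if r ≤ x ∧ p = holeP lam r x then lam x p - 1 else lam x p

theorem holeP_le (lam r) : ∀ x, x ≤ r → holeP lam r x = 0 := by
  intro x hx
  cases x with
  | zero => rfl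
  | succ x => simp only [holeP]; rw [if_pos (by omega)]

theorem holeP_step (lam r x) (hx : r ≤ x) : holeP lam r (x + 1) =
    if lam (x + 1) (holeP lam r x + 1) = lam x (holeP lam r x) then holeP lam r x + 1 else holeP lam r x := by
  simp only [holeP]; rw [if_neg (by omega)]

theorem holeP_bound (lam r) : ∀ x, r ≤ x → holeP lam r x + r ≤ x := by
  intro x hx
  induction x, hx using Nat.le_induction with
  | base => rw [holeP_le _ _ _ le_rfl]; omega
  | succ x hx ih => rw [holeP_step _ _ _ hx]; split_ifs <;> omega

/-- `r` is the first nonzero level -/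
def FirstLev (lam : ℕ → ℕ → ℕ) (r : ℕ) : Prop := 1 ≤ r ∧ 0 < lam r 0 ∧ ∀ x p, x < r → lam x p = 0

theorem holeP_corner {lam r} (h : GT lam) (hr : FirstLev lam r) : ∀ x, r ≤ x →
    lam x (holeP lam r x + 1) < lam x (holeP lam r x) := by
  intro x hx
  induction x, hx using Nat.le_induction with
  | base =>
    rw [holeP_le _ _ _ le_rfl]
    obtain ⟨r, rfl⟩ : ∃ r', r = r' + 1 := ⟨r - 1, by have := hr.1; omega⟩
    have := (h.2 r 0).2
    have := hr.2.2 r 0 (by omega)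
    have := hr.2.1
    omega
  | succ x hx ih =>
    rw [holeP_step _ _ _ hx]
    have a := h.2 x (holeP lam r x)
    have b := h.2 x (holeP lam r x + 1)
    split_ifs <;> omega

theorem GT_lamP {lam r} (h : GT lam) (hr : FirstLev lam r) : GT (lamP lam r) := by
  refine ⟨fun p => ?_, fun i p => ?_⟩
  · simp only [lamP]; rw [if_neg (by have := hr.1; omega)]; exact h.1 p
  · have a := h.2 i p
    rcases Nat.lt_or_ge i r with hi | hi
    · have e := hr.2.2 i p hi
      have e2 := hr.2.2 i (p+1) hi
      simp only [lamP]
      rw [if_neg (by omega)]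
      refine ⟨by omega, ?_⟩
      split_ifs <;> omega
    · have e := holeP_step lam r i hi
      have c1 := holeP_corner h hr i hi
      have c2 := holeP_corner h hr (i + 1) (by omega)
      have hp := h.part i
      have hp' := h.part (i+1)
      simp only [lamP]
      set P := holeP lam r i with hP
      have d := h.2 i P
      have d' := h.2 i (P+1)
      by_cases hc : lam (i + 1) (P + 1) = lam i P
      · rw [if_pos hc] at e
        rw [e] at *
        constructor
        · split_ifs <;> grind
        · split_ifs with q1 q2 <;> (try omega)
          all_goals (obtain ⟨_, q⟩ := ‹r ≤ i ∧ p = P›; subst q; omega)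
      · rw [if_neg hc] at e
        rw [e] at *
        constructor
        · split_ifs <;> omega
        · split_ifs with q1 q2 q2 <;> (try omega)
          all_goals (obtain ⟨_, q⟩ := q2; subst q; omega)

theorem lamP_row {lam r} (x : ℕ) (hx : r ≤ x) : lamP lam r x = subB (lam x) (holeP lam r x) := by
  funext p
  simp only [lamP, subB]
  split_ifs <;> grind

noncomputable def Tof (lam : ℕ → ℕ → ℕ) (p c : ℕ) : ℕ := sInf {i | c < lam i p}

theorem Tof_spec {lam} (h : GT lam) : ∀ i p c, lam i p ≤ c → c < lam (i + 1) p → Tof lam p c = i + 1 := by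
  intro i p c h1 h2
  have hm : i + 1 ∈ {i | c < lam i p} := h2
  apply le_antisymm
  · exact Nat.sInf_le hm
  · apply le_csInf ⟨_, hm⟩
    intro j hj
    by_contra hlt
    have := h.mono (show j ≤ i by omega) p
    simp at hj
    omega

theorem Lof_all {lam} (h : GT lam) (T : ℕ → ℕ → ℕ) (hT : ∀ i p c, lam i p ≤ c → c < lam (i + 1) p → T p c = i + 1) :
    ∀ x, shapeL zeroP (Lof lam x) = lam x ∧ LatL zeroP (Lof lam x) ∧ FitL T zeroP (Lof lam x) := by
  intro x
  induction x with
  | zero => exact ⟨by funext p; simp [Lof, shapeL, zeroP, h.1], trivial, trivial⟩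
  | succ x ih =>
    obtain ⟨a, b, c⟩ := ih
    simp only [Lof, shapeL_append, LatL_append, FitL_append, a]
    obtain ⟨a', b', c'⟩ := strip_all (x + 1) T (lam x) (lam (x + 1)) (h.part _) (fun p => (h.2 x p).1)
      (fun p => (h.2 x p).2) (hT x) (x + 1) (lam x) (by
        intro p
        split_ifs with hp
        · rfl
        · rw [h.zero x p (by omega), h.zero (x+1) p (by omega)])
    exact ⟨a', ⟨b, b'⟩, c, c'⟩

theorem Lof_nil {lam} (x : ℕ) (hz : ∀ y p, y ≤ x → lam y p = 0) : Lof lam x = [] := by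
  induction x with
  | zero => rfl
  | succ x ih =>
    simp only [Lof]
    rw [ih (fun y p hy => hz y p (by omega)), strip_congr (x+1) (lam x) (lam (x+1)) zeroP zeroP (x+1)
      (by intro p _; rw [hz _ p le_rfl]; simp)]
    simp only [List.nil_append]
    have : ∀ N, stripL (x+1) N zeroP zeroP = [] := by
      intro N
      induction N with
      | zero => rfl
      | succ N ih => simp [stripL, ih]
    exact this _

theorem strip_one (v : ℕ) (μ ν : ℕ → ℕ) (N : ℕ) (h : ∀ p, 0 < p → ν p = 0) :
    stripL v (N + 1) μ ν = List.replicate (ν 0 - μ 0) (v, 0) := by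
  induction N with
  | zero => simp [stripL]
  | succ N ih => rw [stripL, ih, h (N+1) (by omega)]; simp

theorem Lof_slide {lam r} (h : GT lam) (hr : FirstLev lam r) : ∀ x, r ≤ x →
    ∃ tl, Lof lam x = (r, 0) :: tl ∧ slide (addB zeroP 0) 0 tl = (Lof (lamP lam r) x, holeP lam r x) := by
  intro x hx
  have h' := GT_lamP h hr
  induction x, hx using Nat.le_induction with
  | base =>
    obtain ⟨r, rfl⟩ : ∃ r', r = r' + 1 := ⟨r - 1, by have := hr.1; omega⟩
    have hz : ∀ p, 0 < p → lam (r + 1) p = 0 := by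
      intro p hp
      obtain ⟨p, rfl⟩ : ∃ r', p = r' + 1 := ⟨p - 1, by omega⟩
      have := (h.2 r p).2
      have := hr.2.2 r p (by omega)
      omega
    have hP := holeP_le lam (r+1) (r+1) le_rfl
    have hz' : ∀ p, 0 < p → lamP lam (r+1) (r + 1) p = 0 := by
      intro p hp
      simp only [lamP]
      rw [if_neg (by omega)]; exact hz p hp
    simp only [Lof]
    rw [Lof_nil r (fun y p hy => hr.2.2 y p (by omega)), strip_one _ _ _ _ hz,
      Lof_nil r (fun y p hy => by
        simp only [lamP]; rw [if_neg (by omega)]; exact hr.2.2 y p (by omega)), strip_one _ _ _ _ hz', hP]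
    have e1 := hr.2.2 r 0 (by omega)
    have e2 : lamP lam (r+1) r 0 = 0 := by
      simp only [lamP]; rw [if_neg (by omega)]; exact hr.2.2 r 0 (by omega)
    have e3 : lamP lam (r+1) (r + 1) 0 = lam (r+1) 0 - 1 := by
      simp only [lamP]; rw [if_pos (by simp [hP])]
    have e4 := hr.2.1
    refine ⟨List.replicate (lam (r + 1) 0 - 1) (r + 1, 0), ?_, ?_⟩
    · rw [List.nil_append, ← List.replicate_succ]; congr 1; omega
    · rw [slide_far 0 _ _ (by simp), e2, e3]; simp
  | succ x hx ih =>
    obtain ⟨tl, a, b⟩ := ih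
    refine ⟨tl ++ stripL (x + 1) (x + 1) (lam x) (lam (x + 1)), ?_, ?_⟩
    · simp only [Lof]; rw [a]; rfl
    · have hsh : shapeL (addB zeroP 0) tl = lam x := by
        have := (Lof_all h (Tof lam) (Tof_spec h) x).1
        rw [a] at this
        exact this
      rw [slide_append, b, hsh]
      simp only
      have hb := holeP_bound lam r x hx
      have := hr.1
      rw [strip_slide (x + 1) (lam x) (lam (x + 1)) (holeP lam r x) (fun p => (h.2 x p).1)
        (fun p => (h.2 x p).2) (holeP_corner h hr x hx) (holeP lam r (x + 1)) (holeP_step _ _ _ hx) (x + 1)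
        (lam x) (by
        intro p
        split_ifs with hp
        · rfl
        · rw [h.zero x p (by omega), h.zero (x+1) p (by omega)]) (by omega)]
      simp only [Lof, lamP_row x hx, lamP_row (x + 1) (show r ≤ x + 1 by omega)]

end

section

inductive NW (k : ℕ) : (ℕ → ℕ → ℕ) → List (ℕ × ℕ) → Prop
  | nil (lam : ℕ → ℕ → ℕ) (h : ∀ p, lam k p = 0) : NW k lam []
  | cons (lam : ℕ → ℕ → ℕ) (r a : ℕ) (ps : List (ℕ × ℕ)) (hr : FirstLev lam r) (hrk : r ≤ k)
      (ha : a + holeP lam r k + 1 = k + lam k (holeP lam r k)) (h : NW k (lamP lam r) ps) :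
      NW k lam ((r, a) :: ps)

theorem NW.isWordOf {k lam ps} (h : NW k lam ps) (hg : GT lam) : IsWordOf k (Lof lam k) ps := by
  induction h with
  | nil lam h =>
    rw [Lof_nil]
    · exact IsWordOf.nil k
    · intro y p hy
      have := hg.mono hy p
      have := h p
      omega
  | cons lam r a ps hr hrk ha h ih =>
    obtain ⟨tl, h1, h2⟩ := Lof_slide hg hr k hrk
    rw [h1]
    have h3 := (Lof_all hg (Tof lam) (Tof_spec hg) k).1
    rw [h1] at h3
    constructor
    · rw [h2, h3]; simp only; omega
    · rw [h2]; exact ih (GT_lamP hg hr)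

theorem NW.le {k lam ps} (h : NW k lam ps) (hg : GT lam) : ∀ x ∈ ps, 1 ≤ x.1 ∧ x.1 ≤ x.2 := by
  induction h with
  | nil => simp
  | cons lam r a ps hr hrk ha h ih =>
    intro x hx
    simp only [List.mem_cons] at hx
    rcases hx with rfl | hx
    · refine ⟨hr.1, ?_⟩
      have := holeP_bound lam r k hrk
      have := holeP_corner hg hr k hrk
      simp only; omega
    · exact ih (GT_lamP hg hr) x hx

theorem holeP_mono_step (lam r x) (hx : r ≤ x) :
    holeP lam r (x + 1) = holeP lam r x ∨ holeP lam r (x + 1) = holeP lam r x + 1 := by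
  rw [holeP_step _ _ _ hx]; split_ifs <;> simp

theorem holeP_second {lam r} (hg : GT lam) (hr : FirstLev lam r) : ∀ x, r ≤ x →
    holeP lam r x ≤ holeP (lamP lam r) r x := by
  intro x hx
  induction x, hx using Nat.le_induction with
  | base => rw [holeP_le _ _ _ le_rfl]; omega
  | succ x hx ih =>
    rcases ih.lt_or_eq with h | h
    · have := holeP_mono_step lam r x hx
      have := holeP_mono_step (lamP lam r) r x hx
      omega
    · have e1 := holeP_step lam r x hx
      have e2 := holeP_step (lamP lam r) r x hx
      rw [← h] at e2
      by_cases hc : lam (x + 1) (holeP lam r x + 1) = lam x (holeP lam r x)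
      · rw [if_pos hc] at e1
        rw [if_pos] at e2
        · omega
        · simp only [lamP]
          rw [if_pos ⟨by omega, e1.symm⟩, if_pos (by simp [hx])]
          omega
      · rw [if_neg hc] at e1
        have := holeP_mono_step (lamP lam r) r x hx
        omega

def BRel (x y : ℕ × ℕ) : Prop := x.1 ≤ y.1 ∧ (x.2 < y.2 → x.1 < y.1)

theorem NW.chain {k lam ps} (h : NW k lam ps) (hg : GT lam) : List.IsChain BRel ps := by
  induction h with
  | nil => simp
  | cons lam r a ps hr hrk ha h ih =>
    have hg' := GT_lamP hg hr
    have ih := ih hg'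
    cases h with
    | nil => simp
    | cons _ r' a' ps hr' hrk' ha' h' =>
      refine List.IsChain.cons_cons ?_ ih
      have hle : r ≤ r' := by
        by_contra hlt
        have h1 := hr'.2.1
        simp only [lamP] at h1
        rw [if_neg (by omega), hr.2.2 r' 0 (by omega)] at h1
        omega
      refine ⟨hle, ?_⟩
      simp only
      intro haa
      by_contra hlt
      obtain rfl : r = r' := by omega
      have h1 := holeP_second hg hr k hrk
      have h2 := holeP_corner hg hr k hrk
      simp only [lamP] at ha'
      simp only [← lamP.eq_def] at ha'
      change a' + holeP (lamP lam r) r k + 1 = k + lamP lam r k (holeP (lamP lam r) r k) at ha'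
      rw [lamP_row k hrk] at ha'
      rcases h1.lt_or_eq with h3 | h3
      · have := (hg.part k).anti (show holeP lam r k + 1 ≤ holeP (lamP lam r) r k by omega)
        simp only [subB] at ha'
        rw [if_neg (by omega)] at ha'
        omega
      · rw [← h3] at ha'
        simp only [subB, if_pos] at ha'
        omega

def GrP (k : ℕ) (μ : ℕ → ℕ) (w : Perm') : Prop :=
  w 0 = 0 ∧ (∀ q, 1 ≤ q → q ≤ k → w q = μ (k - q) + q) ∧ ∀ x y, k < x → x < y → w x < w y

theorem GrP.pos {k μ w} (h : GrP k μ w) {x : ℕ} (hx : 1 ≤ x) : 1 ≤ w x := by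
  by_contra hc
  have : w x = w 0 := by rw [h.1]; omega
  have := w.injective this
  omega

theorem GrP.mono {k μ w} (h : GrP k μ w) (hμ : IsPart μ) {q q' : ℕ} (h1 : 1 ≤ q) (h2 : q < q') (h3 : q' ≤ k) :
    w q < w q' := by
  rw [h.2.1 q h1 (by omega), h.2.1 q' (by omega) h3]
  have := hμ.anti (show k - q' ≤ k - q by omega)
  omega

/-- basic facts around the letter `a` -/
theorem GrP.letter {k μ w} (h : GrP k μ w) (hμ : IsPart μ) {P a : ℕ} (hP : P < k) (hc : μ (P + 1) < μ P)
    (ha : a + P + 1 = k + μ P) : w (k - P) = a + 1 ∧ k < w.symm a ∧ 1 ≤ a := by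
  have h1 := h.2.1 (k - P) (by omega) (by omega)
  rw [show k - (k - P) = P by omega] at h1
  refine ⟨by omega, ?_, by omega⟩
  by_contra hle
  have h2 : w (w.symm a) = a := by simp
  have h3 : 1 ≤ w.symm a := by
    by_contra h0
    have : w.symm a = 0 := by omega
    rw [this, h.1] at h2
    omega
  have h4 := h.2.1 _ h3 (by omega)
  rcases Nat.lt_trichotomy (w.symm a) (k - P) with h5 | h5 | h5
  · have := hμ.anti (show P + 1 ≤ k - w.symm a by omega)
    omega
  · rw [h5] at h2; omega
  · have := hμ.anti (show k - w.symm a ≤ P by omega)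
    omega

theorem sT_apply (a x : ℕ) : sT a x = if x = a then a + 1 else if x = a + 1 then a else x := by
  simp only [sT, Equiv.swap_apply_def]

theorem GrP.step {k μ w} (h : GrP k μ w) (hμ : IsPart μ) {P a : ℕ} (hP : P < k) (hc : μ (P + 1) < μ P)
    (ha : a + P + 1 = k + μ P) : GrP k (subB μ P) (sT a * w) := by
  obtain ⟨h1, h2, h3⟩ := h.letter hμ hP hc ha
  have hinj : ∀ x, w x = a → k < x := by
    intro x hx
    rw [← hx] at h2
    simpa using h2
  have hinj2 : ∀ x, w x = a + 1 → x = k - P := by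
    intro x hx
    rw [← h1] at hx
    exact w.injective hx
  refine ⟨?_, ?_, ?_⟩
  · simp only [Equiv.Perm.mul_apply, h.1, sT_apply]
    rw [if_neg (by omega), if_neg (by omega)]
  · intro q hq1 hq2
    simp only [Equiv.Perm.mul_apply, sT_apply]
    have e := h.2.1 q hq1 hq2
    have e1 := hinj q
    have e2 := hinj2 q
    rw [if_neg (by intro hh; have := e1 hh; omega)]
    split_ifs with h5
    · have := e2 h5
      subst this
      rw [show k - (k - P) = P by omega] at *
      simp [subB]; omega
    · simp only [subB]
      rw [if_neg]
      · exact e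
      · intro hh
        apply h5
        rw [← h1]; congr 1; omega
  · intro x y hx hxy
    have e := h.2.2 x y hx hxy
    have e1 := hinj2 x
    have e2 := hinj2 y
    simp only [Equiv.Perm.mul_apply, sT_apply]
    split_ifs <;> omega

theorem GrP.one {k w} {μ : ℕ → ℕ} (hμ : ∀ p, μ p = 0) (h : GrP k μ w) : w = 1 := by
  have h1 : ∀ x, x ≤ k → w x = x := by
    intro x hx
    rcases Nat.eq_zero_or_pos x with rfl | h0
    · exact h.1
    · rw [h.2.1 x h0 hx, hμ]; omega
  have hlt : ∀ x, k < x → k < w x := by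
    intro x hx
    by_contra hc
    have := h1 (w x) (by omega)
    have := w.injective this
    omega
  have hge : ∀ x, x ≤ w x := by
    intro x
    induction x with
    | zero => omega
    | succ x ih =>
      rcases Nat.lt_or_ge k (x + 1) with h3 | h3
      · rcases Nat.lt_or_ge k x with h4 | h4
        · have := h.2.2 x (x + 1) h4 (by omega); omega
        · have := hlt (x+1) h3; omega
      · rw [h1 _ h3]
  ext x
  simp only [Equiv.Perm.coe_one, id]
  -- by strong induction
  induction x using Nat.strong_induction_on with
  | _ x ih =>
    by_contra hne
    have h5 := hge x
    -- x = w z, z ≥ x since smaller are fixed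
    obtain ⟨z, hz⟩ := w.surjective x
    rcases Nat.lt_trichotomy z x with h6 | h6 | h6
    · have := ih z h6; omega
    · subst h6; omega
    · have h7 : k < x := by
        by_contra h8
        exact hne (h1 x (by omega))
      have := h.2.2 x z h7 h6
      omega

theorem NW.wordProd {k lam ps} (h : NW k lam ps) (hg : GT lam) : ∀ w, GrP k (lam k) w →
    wordProd (ps.map Prod.snd) = w := by
  induction h with
  | nil lam h =>
    intro w hw
    simp [BPDPaper.wordProd, hw.one h]
  | cons lam r a ps hr hrk ha h ih =>
    intro w hw
    have hb := holeP_bound lam r k hrk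
    have := hr.1
    have h1 := hw.step (hg.part k) (P := holeP lam r k) (a := a) (by omega) (holeP_corner hg hr k hrk) (by omega)
    rw [← lamP_row k hrk] at h1
    have h2 := ih (GT_lamP hg hr) _ h1
    simp only [BPDPaper.wordProd, List.map_cons, List.prod_cons] at h2 ⊢
    rw [h2, ← mul_assoc]
    simp [sT]

theorem NW.length {k lam ps} (h : NW k lam ps) (hg : GT lam) :
    ps.length = ∑ p ∈ Finset.range k, lam k p := by
  induction h with
  | nil lam h => simp [h]
  | cons lam r a ps hr hrk ha h ih =>
    have ih := ih (GT_lamP hg hr)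
    have hb := holeP_bound lam r k hrk
    have := hr.1
    have hc := holeP_corner hg hr k hrk
    rw [List.length_cons, ih, lamP_row k hrk]
    have hm : holeP lam r k ∈ Finset.range k := by simp; omega
    rw [← Finset.add_sum_erase _ _ hm, ← Finset.add_sum_erase _ (lam k) hm]
    have : ∑ x ∈ (Finset.range k).erase (holeP lam r k), subB (lam k) (holeP lam r k) x
      = ∑ x ∈ (Finset.range k).erase (holeP lam r k), lam k x := by
      apply Finset.sum_congr rfl
      intro x hx
      simp only [Finset.mem_erase] at hx
      simp [subB, hx.1]
    rw [this]
    simp [subB]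
    omega

theorem pot_le (k : ℕ) (l : List ℕ) :
    ∑ q ∈ Finset.Icc 1 k, wordProd l q ≤ ∑ q ∈ Finset.Icc 1 k, q + l.length := by
  induction l with
  | nil => simp [wordProd]
  | cons a l ih =>
    have h1 : ∑ q ∈ Finset.Icc 1 k, wordProd (a :: l) q ≤ ∑ q ∈ Finset.Icc 1 k, wordProd l q + 1 := by
      have h2 : ∀ q, wordProd (a :: l) q ≤ wordProd l q + if q = (wordProd l).symm a then 1 else 0 := by
        intro q
        have : wordProd (a :: l) q = sT a (wordProd l q) := by simp [wordProd]
        rw [this, sT_apply]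
        split_ifs with e1 e2 e2 e3 e4 <;> try omega
        exact absurd (by rw [← e1]; simp) e2
      refine (Finset.sum_le_sum (fun q _ => h2 q)).trans ?_
      rw [Finset.sum_add_distrib, Finset.sum_ite_eq']
      split_ifs <;> omega
    simp only [List.length_cons]
    omega

theorem NW.compat {k lam ps} (h : NW k lam ps) (hg : GT lam) {w} (hw : GrP k (lam k) w) :
    IsCompatible w ⟨ps.map Prod.fst, ps.map Prod.snd⟩ := by
  have hword : IsWord w (ps.map Prod.snd) := by
    refine ⟨?_, h.wordProd hg w hw⟩
    intro x hx
    simp only [List.mem_map] at hx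
    obtain ⟨y, hy, rfl⟩ := hx
    have := h.le hg y hy
    omega
  refine ⟨⟨hword, ?_⟩, ?_, ?_, ?_⟩
  · apply le_antisymm
    · have hne : (ps.map Prod.snd).length ∈ {m | ∃ l : List ℕ, IsWord w l ∧ l.length = m} := ⟨_, hword, rfl⟩
      apply le_csInf ⟨_, hne⟩
      rintro m ⟨l, hl, rfl⟩
      have h1 := pot_le k l
      rw [hl.2] at h1
      have h2 : ∑ q ∈ Finset.Icc 1 k, w q = ∑ q ∈ Finset.Icc 1 k, q + ∑ p ∈ Finset.range k, lam k p := by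
        have h3 : ∑ q ∈ Finset.Icc 1 k, w q = ∑ q ∈ Finset.Icc 1 k, (q + lam k (k - q)) := by
          apply Finset.sum_congr rfl
          intro q hq
          simp only [Finset.mem_Icc] at hq
          rw [hw.2.1 q hq.1 hq.2]; omega
        rw [h3, Finset.sum_add_distrib]
        congr 1
        apply Finset.sum_nbij' (fun q => k - q) (fun p => k - p)
        all_goals (intro x hx; simp at hx ⊢; try omega)
      have h4 := h.length hg
      simp only [List.length_map]
      omega
    · exact Nat.sInf_le ⟨_, hword, rfl⟩
  · have := h.chain hg
    show List.IsChain _ _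
    rw [List.isChain_map]
    exact this.imp (fun a b hab => hab.1)
  · simp only
    rw [List.forall₂_map_left_iff, List.forall₂_map_right_iff, List.forall₂_same]
    exact fun x hx => (h.le hg x hx).2
  · intro m hm
    simp only [List.length_map] at hm
    have := List.isChain_iff_getElem.1 (h.chain hg) m (by omega)
    rw [List.getD_eq_getElem _ _ (by simp; omega), List.getD_eq_getElem _ _ (by simp; omega),
      List.getD_eq_getElem _ _ (by simp; omega), List.getD_eq_getElem _ _ (by simp; omega)]
    simp only [List.getElem_map]
    exact this.2

end

section

def sC (lam : ℕ → ℕ → ℕ) (x q : ℕ) : ℕ := lam x (x - q) + q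

def VD (k : ℕ) (w : Perm') (lam : ℕ → ℕ → ℕ) (x y : ℕ) : Prop :=
  (x ≤ k ∧ ∃ q, 1 ≤ q ∧ q ≤ x ∧ sC lam x q = y) ∨ (k < x ∧ w.symm y ≤ x)

def HD (k : ℕ) (w : Perm') (lam : ℕ → ℕ → ℕ) (x y : ℕ) : Prop :=
  (x ≤ k ∧ ∃ q, 1 ≤ q ∧ q ≤ x ∧ sC lam x q ≤ y ∧ (q = x ∨ y < sC lam (x - 1) q)) ∨ (k < x ∧ w x ≤ y)

def Real (n : ℕ) (T : ℕ → ℕ → Tile) (V H : ℕ → ℕ → Prop) : Prop :=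
  ∀ x y, 1 ≤ x → x ≤ n → 1 ≤ y → y ≤ n →
    (hasN (T x y) = true ↔ V (x - 1) y) ∧ (hasS (T x y) = true ↔ V x y) ∧
    (hasW (T x y) = true ↔ H x (y - 1)) ∧ (hasE (T x y) = true ↔ H x y) ∧ T x y ≠ Tile.bump

structure Desc (g : Grid) (k : ℕ) (w : Perm') (lam : ℕ → ℕ → ℕ) : Prop where
  kn : k < g.n
  fix : ∀ x, g.n < x → w x = x
  gt : GT lam
  gr : GrP k (lam k) w
  real : Real g.n g.tile (VD k w lam) (HD k w lam)

theorem sC_mono {lam} (h : GT lam) {x q q' : ℕ} (hq : q < q') : sC lam x q < sC lam x q' := by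
  have := (h.part x).anti (show x - q' ≤ x - q by omega)
  simp only [sC]; omega

theorem sC_inj {lam} (h : GT lam) {x q q' : ℕ} (hq : sC lam x q = sC lam x q') : q = q' := by
  rcases Nat.lt_trichotomy q q' with h1 | h1 | h1
  · have := sC_mono h (x := x) h1; omega
  · exact h1
  · have := sC_mono h (x := x) h1; omega

theorem sC_lt {lam} (h : GT lam) {x q q' : ℕ} : sC lam x q < sC lam x q' ↔ q < q' := by
  constructor
  · intro h1
    by_contra h2
    rcases Nat.lt_or_ge q' q with h3 | h3
    · have := sC_mono h (x := x) h3; omega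
    · obtain rfl : q = q' := by omega
      omega
  · exact sC_mono h

theorem sC_down {lam} (h : GT lam) {x q : ℕ} (hq : q ≤ x) : sC lam (x + 1) q ≤ sC lam x q := by
  have := (h.2 x (x - q)).2
  simp only [sC]
  rw [show x + 1 - q = x - q + 1 by omega]; omega

theorem sC_up {lam} (h : GT lam) {x q : ℕ} : sC lam x q < sC lam (x + 1) (q + 1) := by
  have := (h.2 x (x - q)).1
  simp only [sC]
  rw [show x + 1 - (q + 1) = x - q by omega]; omega

theorem sC_anti {lam} (h : GT lam) {x y q : ℕ} (hq : q ≤ x) (hxy : x ≤ y) : sC lam y q ≤ sC lam x q := by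
  induction y, hxy using Nat.le_induction with
  | base => exact le_rfl
  | succ y hy ih => exact (sC_down h (by omega)).trans ih

/-- no crossing rows: between consecutive pipes -/
theorem sC_up' {lam} (h : GT lam) {x q q' : ℕ} (hq : q < q') (hx : 1 ≤ x) : sC lam (x - 1) q < sC lam x q' := by
  obtain ⟨x, rfl⟩ : ∃ x', x = x' + 1 := ⟨x - 1, by omega⟩
  have h1 := sC_up h (x := x) (q := q)
  rcases Nat.lt_or_ge (q + 1) q' with h2 | h2
  · have := sC_mono h (x := x + 1) h2
    simp; omega
  · obtain rfl : q' = q + 1 := by omega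
    exact h1

namespace Desc
variable {g : Grid} {k : ℕ} {w : Perm'} {lam : ℕ → ℕ → ℕ}

theorem wle (h : Desc g k w lam) {x : ℕ} (hx : x ≤ g.n) : w x ≤ g.n := by
  by_contra hc
  have := h.fix (w x) (by omega)
  have := w.injective this
  omega

theorem wsle (h : Desc g k w lam) {x : ℕ} (hx : x ≤ g.n) : w.symm x ≤ g.n := by
  by_contra hc
  have := h.fix (w.symm x) (by omega)
  simp at this
  omega

theorem wk (h : Desc g k w lam) {q : ℕ} (h1 : 1 ≤ q) (h2 : q ≤ k) : w q = sC lam k q := h.gr.2.1 q h1 h2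

theorem sCle (h : Desc g k w lam) {x q : ℕ} (hx : x ≤ k) (h1 : 1 ≤ q) (h2 : q ≤ x) : sC lam x q ≤ g.n := by
  have a := h.wle (x := k - x + q) (by have := h.kn; omega)
  rw [h.wk (by omega) (by omega)] at a
  have b := h.gt.mono hx (x - q)
  simp only [sC] at *
  rw [show k - (k - x + q) = x - q by omega] at a
  omega

theorem VDk (h : Desc g k w lam) {y : ℕ} (hy : 1 ≤ y) : VD k w lam k y ↔ w.symm y ≤ k := by
  simp only [VD]
  constructor
  · rintro (⟨_, q, h1, h2, h3⟩ | h1)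
    · rw [← h3, ← h.wk h1 h2]; simpa using h2
    · omega
  · intro h1
    left
    refine ⟨le_rfl, w.symm y, ?_, h1, ?_⟩
    · by_contra h2
      have h3 : w (w.symm y) = y := by simp
      rw [show w.symm y = 0 by omega, h.gr.1] at h3
      omega
    · rw [← h.wk]
      · simp
      · by_contra h2
        have h3 : w (w.symm y) = y := by simp
        rw [show w.symm y = 0 by omega, h.gr.1] at h3
        omega
      · exact h1

theorem VDge (h : Desc g k w lam) {x y : ℕ} (hx : k ≤ x) (hy : 1 ≤ y) : VD k w lam x y ↔ w.symm y ≤ x := by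
  rcases Nat.eq_or_lt_of_le hx with rfl | h1
  · exact h.VDk hy
  · simp [VD]; omega

theorem VDle {x y : ℕ} (hx : x ≤ k) : VD k w lam x y ↔ ∃ q, 1 ≤ q ∧ q ≤ x ∧ sC lam x q = y := by
  simp only [VD, hx, true_and, Nat.not_lt.2 hx, false_and, or_false]

theorem HDge {x y : ℕ} (hx : k < x) : HD k w lam x y ↔ w x ≤ y := by
  simp [HD]; omega

theorem HDle {x y : ℕ} (hx : x ≤ k) : HD k w lam x y ↔
    ∃ q, 1 ≤ q ∧ q ≤ x ∧ sC lam x q ≤ y ∧ (q = x ∨ y < sC lam (x - 1) q) := by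
  simp only [HD, hx, true_and, Nat.not_lt.2 hx, false_and, or_false]

/-- rows ≤ k: between pipe positions -/
theorem HDpipe (h : Desc g k w lam) {x y q : ℕ} (hx : x ≤ k) (h1 : 1 ≤ q) (h2 : q ≤ x)
    (h3 : sC lam x q ≤ y) (h4 : q = x ∨ y < sC lam x (q + 1)) :
    HD k w lam x y ↔ (q = x ∨ y < sC lam (x - 1) q) := by
  rw [HDle hx]
  constructor
  · rintro ⟨q', a, b, c, d⟩
    rcases Nat.lt_trichotomy q q' with e | e | e
    · exfalso
      have : sC lam x (q + 1) ≤ sC lam x q' := by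
        rcases Nat.eq_or_lt_of_le (show q + 1 ≤ q' by omega) with e1 | e1
        · rw [e1]
        · exact (sC_mono h.gt e1).le
      omega
    · subst e; exact d
    · have := sC_up' h.gt e (x := x) (by omega)
      omega
  · intro h5
    exact ⟨q, h1, h2, h3, h5⟩

theorem HDleft (h : Desc g k w lam) {x y : ℕ} (hx : x ≤ k) (h3 : y < sC lam x 1) :
    ¬ HD k w lam x y := by
  rw [HDle hx]
  rintro ⟨q', a, b, c, d⟩
  have : sC lam x 1 ≤ sC lam x q' := by
    rcases Nat.eq_or_lt_of_le a with e1 | e1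
    · rw [e1]
    · exact (sC_mono h.gt e1).le
  omega

end Desc

theorem tile_blank {n T V H} (h : Real n T V H) {x y : ℕ} (h1 : 1 ≤ x) (h2 : x ≤ n) (h3 : 1 ≤ y) (h4 : y ≤ n) :
    T x y = Tile.blank ↔ ¬ V (x - 1) y ∧ ¬ V x y ∧ ¬ H x y := by
  obtain ⟨a, b, c, d, e⟩ := h x y h1 h2 h3 h4
  rw [← a, ← b, ← d]
  cases hT : T x y <;> simp [hT, hasN, hasS, hasE] at *

theorem tile_cross {n T V H} (h : Real n T V H) {x y : ℕ} (h1 : 1 ≤ x) (h2 : x ≤ n) (h3 : 1 ≤ y) (h4 : y ≤ n) :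
    T x y = Tile.cross ↔ V x y ∧ H x (y - 1) := by
  obtain ⟨a, b, c, d, e⟩ := h x y h1 h2 h3 h4
  rw [← b, ← c]
  cases hT : T x y <;> simp [hT, hasS, hasW] at *

theorem tile_cross' {n T V H} (h : Real n T V H) {x y : ℕ} (h1 : 1 ≤ x) (h2 : x ≤ n) (h3 : 1 ≤ y) (h4 : y ≤ n) :
    T x y = Tile.cross ↔ V (x - 1) y ∧ H x y := by
  obtain ⟨a, b, c, d, e⟩ := h x y h1 h2 h3 h4
  rw [← a, ← d]
  cases hT : T x y <;> simp [hT, hasN, hasE] at *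

theorem tile_nw {n T V H} (h : Real n T V H) {x y : ℕ} (h1 : 1 ≤ x) (h2 : x ≤ n) (h3 : 1 ≤ y) (h4 : y ≤ n) :
    T x y = Tile.nw ↔ V (x - 1) y ∧ ¬ V x y := by
  obtain ⟨a, b, c, d, e⟩ := h x y h1 h2 h3 h4
  rw [← a, ← b]
  cases hT : T x y <;> simp [hT, hasN, hasS] at *

theorem tile_se {n T V H} (h : Real n T V H) {x y : ℕ} (h1 : 1 ≤ x) (h2 : x ≤ n) (h3 : 1 ≤ y) (h4 : y ≤ n) :
    T x y = Tile.se ↔ V x y ∧ ¬ V (x - 1) y := by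
  obtain ⟨a, b, c, d, e⟩ := h x y h1 h2 h3 h4
  rw [← a, ← b]
  cases hT : T x y <;> simp [hT, hasN, hasS] at *

theorem tile_se' {n T V H} (h : Real n T V H) {x y : ℕ} (h1 : 1 ≤ x) (h2 : x ≤ n) (h3 : 1 ≤ y) (h4 : y ≤ n) :
    T x y = Tile.se ↔ H x y ∧ ¬ H x (y - 1) := by
  obtain ⟨a, b, c, d, e⟩ := h x y h1 h2 h3 h4
  rw [← c, ← d]
  cases hT : T x y <;> simp [hT, hasW, hasE] at *

theorem tile_vc {n T V H} (h : Real n T V H) {x y : ℕ} (h1 : 1 ≤ x) (h2 : x ≤ n) (h3 : 1 ≤ y) (h4 : y ≤ n) :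
    (T x y = Tile.vert ∨ T x y = Tile.cross) ↔ V (x - 1) y ∧ V x y := by
  obtain ⟨a, b, c, d, e⟩ := h x y h1 h2 h3 h4
  rw [← a, ← b]
  cases hT : T x y <;> simp [hT, hasN, hasS] at *

theorem tile_hc {n T V H} (h : Real n T V H) {x y : ℕ} (h1 : 1 ≤ x) (h2 : x ≤ n) (h3 : 1 ≤ y) (h4 : y ≤ n) :
    (T x y = Tile.horiz ∨ T x y = Tile.cross) ↔ H x (y - 1) ∧ H x y := by
  obtain ⟨a, b, c, d, e⟩ := h x y h1 h2 h3 h4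
  rw [← c, ← d]
  cases hT : T x y <;> simp [hT, hasW, hasE] at *

/-! ### undroop -/

theorem undroop_real {n T V H} (h : Real n T V H) {i i' j : ℕ} (hi : 1 ≤ i) (hii : i < i') (hi' : i' ≤ n)
    (hj : 1 ≤ j) (hjn : j + 1 ≤ n)
    (hV : ∀ x, i ≤ x → x < i' → ¬ V x j ∧ V x (j + 1))
    (hb : ¬ V (i - 1) j ∧ ¬ H i (j - 1) ∧ ¬ H i j) (hH : H i' j) :
    Real n (nablaUndroop T i i' j)
      (fun x y => if i ≤ x ∧ x < i' ∧ y = j then True else if i ≤ x ∧ x < i' ∧ y = j + 1 then False else V x y)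
      (fun x y => if x = i ∧ y = j then True else if x = i' ∧ y = j then False else H x y) := by
  intro x y h1 h2 h3 h4
  obtain ⟨a, b, c, d, e⟩ := h x y h1 h2 h3 h4
  by_cases p1 : x = i ∧ y = j
  · obtain ⟨rfl, rfl⟩ := p1
    have v := hV x le_rfl hii
    simp only [nablaUndroop]
    cases hT : T x y <;> simp [hT, hasN, hasS, hasW, hasE] at * <;> grind
  by_cases p2 : x = i' ∧ y = j
  · obtain ⟨rfl, rfl⟩ := p2
    have v := hV (x - 1) (by omega) (by omega)
    have p3 : ¬ (x = i) := by omega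
    simp only [nablaUndroop]
    cases hT : T x y <;> simp [hT, hasN, hasS, hasW, hasE, p3] at * <;> grind
  by_cases p3 : x = i ∧ y = j + 1
  · obtain ⟨rfl, rfl⟩ := p3
    have v := hV x le_rfl hii
    have q1 : ¬ (x = i') := by omega
    simp only [nablaUndroop]
    cases hT : T x (j + 1) <;> simp [hT, hasN, hasS, hasW, hasE, q1] at * <;> grind
  by_cases p4 : x = i' ∧ y = j + 1
  · obtain ⟨rfl, rfl⟩ := p4
    have v := hV (x - 1) (by omega) (by omega)
    have q1 : ¬ (x = i) := by omega
    simp only [nablaUndroop]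
    cases hT : T x (j + 1) <;> simp [hT, hasN, hasS, hasW, hasE, q1] at * <;> grind
  by_cases p5 : y = j ∧ i < x ∧ x < i'
  · obtain ⟨rfl, p5, p6⟩ := p5
    have v := hV (x - 1) (by omega) (by omega)
    have v' := hV x (by omega) (by omega)
    have q1 : ¬ (x = i) := by omega
    have q2 : ¬ (x = i') := by omega
    have q3 : i ≤ x - 1 := by omega
    have q4 : x - 1 < i' := by omega
    have q5 : i ≤ x := by omega
    simp only [nablaUndroop]
    cases hT : T x y <;> simp [hT, hasN, hasS, hasW, hasE, q1, q2, q3, q4, q5, p5, p6] at * <;> grind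
  by_cases p6 : y = j + 1 ∧ i < x ∧ x < i'
  · obtain ⟨rfl, p5, p6⟩ := p6
    have v := hV (x - 1) (by omega) (by omega)
    have v' := hV x (by omega) (by omega)
    have q1 : ¬ (x = i) := by omega
    have q2 : ¬ (x = i') := by omega
    have q3 : i ≤ x - 1 := by omega
    have q4 : x - 1 < i' := by omega
    have q5 : i ≤ x := by omega
    simp only [nablaUndroop]
    cases hT : T x (j + 1) <;> simp [hT, hasN, hasS, hasW, hasE, q1, q2, q3, q4, q5, p5, p6] at * <;> grind
  · simp only [nablaUndroop]
    rw [if_neg p1, if_neg p2, if_neg p3, if_neg p4, if_neg p5, if_neg p6]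
    have r1 : ¬ (i ≤ x - 1 ∧ x - 1 < i' ∧ y = j) := by omega
    have r2 : ¬ (i ≤ x - 1 ∧ x - 1 < i' ∧ y = j + 1) := by omega
    have r3 : ¬ (i ≤ x ∧ x < i' ∧ y = j) := by omega
    have r4 : ¬ (i ≤ x ∧ x < i' ∧ y = j + 1) := by omega
    have r5 : ¬ (x = i ∧ y - 1 = j) := by omega
    have r6 : ¬ (x = i' ∧ y - 1 = j) := by omega
    simp only [if_neg r1, if_neg r2, if_neg r3, if_neg r4, if_neg r5, if_neg r6, if_neg p1, if_neg p2]
    exact ⟨a, b, c, d, e⟩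

theorem qPairs_nil {g : Grid} {V H} (h : Real g.n g.tile V H) {i i' j : ℕ} (hj : 1 ≤ j) (hjn : j ≤ g.n)
    (hV : ∀ x, i ≤ x → x < i' → ¬ V x j) : qPairs g i i' j = [] := by
  unfold qPairs
  rw [List.filterMap_eq_nil_iff]
  intro x hx
  simp only [List.mem_range'_1] at hx
  rw [if_neg]
  rintro ⟨h1, h2, h3⟩
  rw [tile_se h (by omega) (by omega) hj hjn] at h3
  exact hV x (by omega) h2 h3.1

theorem nablaIter_real {g : Grid} {V H} (h : Real g.n g.tile V H) {i i' j : ℕ} (hi : 1 ≤ i) (hii : i < i') (hi' : i' ≤ g.n)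
    (hj : 1 ≤ j) (hjn : j + 1 ≤ g.n)
    (hV : ∀ x, i ≤ x → x < i' → ¬ V x j ∧ V x (j + 1))
    (hb : ¬ V (i - 1) j ∧ ¬ H i (j - 1) ∧ ¬ H i j) (hH : H i' j) :
    (nablaIter g i i' j).n = g.n ∧ Real g.n (nablaIter g i i' j).tile
      (fun x y => if i ≤ x ∧ x < i' ∧ y = j then True else if i ≤ x ∧ x < i' ∧ y = j + 1 then False else V x y)
      (fun x y => if x = i ∧ y = j then True else if x = i' ∧ y = j then False else H x y) := by
  refine ⟨rfl, ?_⟩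
  unfold nablaIter
  rw [qPairs_nil h hj (by omega) (fun x a b => (hV x a b).1)]
  exact undroop_real h hi hii hi' hj hjn hV hb hH

end

section

namespace Desc
variable {g : Grid} {k : ℕ} {w : Perm'} {lam : ℕ → ℕ → ℕ}

theorem wsymm_pos (h : Desc g k w lam) {y : ℕ} (hy : 1 ≤ y) : 1 ≤ w.symm y := by
  by_contra h2
  have h3 : w (w.symm y) = y := by simp
  rw [show w.symm y = 0 by omega, h.gr.1] at h3
  omega

theorem back_down (h : Desc g k w lam) : ∀ (fuel x y : ℕ), k ≤ x → x < g.n → 1 ≤ y → y ≤ g.n → w.symm y ≤ x →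
    g.n - x ≤ fuel → backAux g fuel (x + 1) y true = some y := by
  intro fuel
  induction fuel with
  | zero => intro x y _ _ _ _ _ _; omega
  | succ f ih =>
    intro x y h1 h2 h3 h4 h5 h6
    have ht : g.tile (x + 1) y = Tile.vert ∨ g.tile (x + 1) y = Tile.cross := by
      rw [tile_vc h.real (by omega) (by omega) h3 h4]
      rw [show x + 1 - 1 = x by omega, h.VDge h1 h3, h.VDge (by omega) h3]
      omega
    have key : backAux g (f + 1) (x + 1) y true = if x + 1 = g.n then some y else backAux g f (x + 1 + 1) y true := by
      rw [backAux, if_neg (by omega)]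
      rcases ht with ht | ht <;> simp [ht]
    rw [key]
    split_ifs with hn
    · rfl
    · exact ih (x + 1) y (by omega) (by omega) h3 h4 (by omega) (by omega)

theorem back_left_ge (h : Desc g k w lam) : ∀ (fuel x y : ℕ), k < x → x ≤ g.n → y ≤ g.n → w x ≤ y →
    (y - w x) + (g.n - x) + 1 ≤ fuel → backAux g fuel x y false = some (w x) := by
  intro fuel
  induction fuel with
  | zero => intros; omega
  | succ f ih =>
    intro x y h1 h2 h3 h4 h5
    have hp := h.gr.pos (x := x) (by omega)
    rcases Nat.eq_or_lt_of_le h4 with h6 | h6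
    · have ht : g.tile x y = Tile.se := by
        rw [tile_se' h.real (by omega) h2 (by omega) h3, HDge h1, HDge h1]; omega
      rw [backAux, if_neg (by omega)]
      simp only [ht]
      subst h6
      simp only [Bool.false_eq_true, if_false]
      split_ifs with hn
      · rfl
      · exact h.back_down f x (w x) (by omega) (by omega) hp h3 (by simp) (by omega)
    · have ht : g.tile x y = Tile.horiz ∨ g.tile x y = Tile.cross := by
        rw [tile_hc h.real (by omega) h2 (by omega) h3, HDge h1, HDge h1]; omega
      have key : backAux g (f + 1) x y false = backAux g f x (y - 1) false := by
        rw [backAux, if_neg (by omega)]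
        rcases ht with ht | ht <;> simp [ht]
      rw [key]
      exact ih x (y - 1) h1 h2 (by omega) (by omega) (by omega)

theorem VDno (h : Desc g k w lam) {x y q : ℕ} (hx : x ≤ k) (h1 : 1 ≤ q) (h3 : sC lam x (q - 1) < y ∨ q = 1)
    (h2 : y < sC lam x q) : ¬ VD k w lam x y := by
  rw [VDle hx]
  rintro ⟨q', a, b, rfl⟩
  rw [sC_lt h.gt] at h2
  rw [sC_lt h.gt] at h3
  omega

theorem back_left_le (h : Desc g k w lam) : ∀ (d fuel x q : ℕ), x + 1 ≤ k → 1 ≤ q → q ≤ x →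
    sC lam (x + 1) q + d < sC lam x q →
    backAux g (fuel + d + 1) (x + 1) (sC lam (x + 1) q + d) false = backAux g fuel (x + 2) (sC lam (x + 1) q) true := by
  intro d
  have hkn := h.kn
  induction d with
  | zero =>
    intro fuel x q h1 h2 h3 h4
    have hle := h.sCle (x := x) (by omega) h2 h3
    have hp : 1 ≤ sC lam (x + 1) q := by simp [sC]; omega
    have ht : g.tile (x + 1) (sC lam (x + 1) q) = Tile.se := by
      rw [tile_se h.real (by omega) (by omega) hp (by omega)]
      constructor
      · rw [VDle h1]; exact ⟨q, h2, by omega, rfl⟩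
      · apply h.VDno (by omega) h2 _ h4
        have := sC_up' h.gt (x := x + 1) (q := q - 1) (q' := q) (by omega) (by omega)
        left; exact this
    simp only [Nat.add_zero]
    rw [backAux, if_neg (by omega)]
    simp only [ht, Bool.false_eq_true, if_false]
    rw [if_neg (by omega)]
  | succ d ih =>
    intro fuel x q h1 h2 h3 h4
    have hle := h.sCle (x := x) (by omega) h2 h3
    have hup := sC_up h.gt (x := x) (q := q)
    have ht : g.tile (x + 1) (sC lam (x + 1) q + (d + 1)) = Tile.horiz ∨
        g.tile (x + 1) (sC lam (x + 1) q + (d + 1)) = Tile.cross := by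
      rw [tile_hc h.real (by omega) (by omega) (by omega) (by omega)]
      rw [h.HDpipe h1 h2 (by omega) (by omega) (by omega), h.HDpipe h1 h2 (by omega) (by omega) (by omega)]
      simp only [Nat.add_sub_cancel]
      omega
    have key : backAux g (fuel + (d + 1) + 1) (x + 1) (sC lam (x + 1) q + (d + 1)) false
        = backAux g (fuel + d + 1) (x + 1) (sC lam (x + 1) q + d) false := by
      rw [backAux, if_neg (by omega)]
      rcases ht with ht | ht <;> simp only [ht] <;> rfl
    rw [key]
    exact ih fuel x q h1 h2 h3 (by omega)

theorem back_main (h : Desc g k w lam) {q : ℕ} (hq : 1 ≤ q) : ∀ (d x fuel : ℕ), x + d = k → q ≤ x →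
    (g.n - x) + sC lam x q ≤ fuel → backAux g fuel (x + 1) (sC lam x q) true = some (w q) := by
  intro d
  have hkn := h.kn
  induction d with
  | zero =>
    intro x fuel hx h1 h2
    obtain rfl : x = k := by omega
    rw [← h.wk hq h1]
    apply h.back_down _ _ _ le_rfl (by omega) (h.gr.pos hq) (h.wle (by omega)) (by simpa using h1) (by omega)
  | succ d ih =>
    intro x fuel hx h1 h2
    have hle := h.sCle (x := x) (by omega) hq h1
    have hp : 1 ≤ sC lam x q := by simp [sC]; omega
    have hp' : 1 ≤ sC lam (x + 1) q := by simp [sC]; omega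
    have hd := sC_down h.gt h1
    obtain ⟨f, rfl⟩ : ∃ f, fuel = f + 1 := ⟨fuel - 1, by omega⟩
    have hV : VD k w lam x (sC lam x q) := by rw [VDle (by omega)]; exact ⟨q, hq, h1, rfl⟩
    rcases Nat.eq_or_lt_of_le hd with he | he
    · have ht : g.tile (x + 1) (sC lam x q) = Tile.vert ∨ g.tile (x + 1) (sC lam x q) = Tile.cross := by
        rw [tile_vc h.real (by omega) (by omega) hp hle]
        refine ⟨hV, ?_⟩
        rw [VDle (by omega)]; exact ⟨q, hq, by omega, he⟩
      have key : backAux g (f + 1) (x + 1) (sC lam x q) true = backAux g f (x + 1 + 1) (sC lam x q) true := by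
        rw [backAux, if_neg (by omega)]
        rcases ht with ht | ht <;> simp [ht] <;> omega
      rw [key, ← he]
      exact ih (x + 1) f (by omega) (by omega) (by omega)
    · have ht : g.tile (x + 1) (sC lam x q) = Tile.nw := by
        rw [tile_nw h.real (by omega) (by omega) hp hle]
        refine ⟨hV, ?_⟩
        apply h.VDno (q := q + 1) (by omega) (by omega) (Or.inl (by simpa using he))
        exact sC_up h.gt
      have key : backAux g (f + 1) (x + 1) (sC lam x q) true = backAux g f (x + 1) (sC lam x q - 1) false := by
        rw [backAux, if_neg (by omega)]
        simp [ht]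
      rw [key]
      have e1 : sC lam x q - 1 = sC lam (x + 1) q + (sC lam x q - 1 - sC lam (x + 1) q) := by omega
      obtain ⟨f', hf'⟩ : ∃ f', f = f' + (sC lam x q - 1 - sC lam (x + 1) q) + 1 :=
        ⟨f - (sC lam x q - 1 - sC lam (x + 1) q) - 1, by omega⟩
      rw [e1, hf', h.back_left_le _ _ _ _ (by omega) hq h1 (by omega)]
      exact ih (x + 1) f' (by omega) (by omega) (by omega)

theorem pipeFromS_eq (h : Desc g k w lam) {q x : ℕ} (hq : 1 ≤ q) (hqx : q ≤ x) (hx : x ≤ k) :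
    pipeFromS g x (sC lam x q) = some (w q) := by
  have hkn := h.kn
  have hle := h.sCle hx hq hqx
  unfold pipeFromS
  rw [if_neg (by omega)]
  exact h.back_main hq (k - x) x _ (by omega) hqx (by omega)

end Desc

theorem find_range' (n t : ℕ) (p : ℕ → Bool) (h1 : 1 ≤ t) (h2 : t ≤ n) (h3 : p t = true)
    (h4 : ∀ x, 1 ≤ x → x < t → p x = false) : (List.range' 1 n).find? p = some t := by
  rw [List.find?_range'_eq_some]
  refine ⟨h3, by simp; omega, ?_⟩
  intro j hj hjt
  simp [h4 j hj hjt]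

theorem slideEast_eq {g : Grid} {i j0 j : ℕ} (h0 : j0 ≤ j) (hj : j ≤ g.n) 
    (h1 : ∀ y, j0 ≤ y → y ≤ j → g.tile i y = Tile.blank) (h2 : g.tile i (j + 1) ≠ Tile.blank) :
    slideEast g i j0 = j := by
  unfold slideEast
  have e : List.range' j0 (g.n + 1) = List.range' j0 (j - j0 + 1) ++ List.range' (j + 1) (g.n - (j - j0)) := by
    rw [show j + 1 = j0 + (j - j0 + 1) by omega, List.range'_append_1]
    congr 1; omega
  rw [e, List.takeWhile_append_of_pos]
  · have : List.takeWhile (fun y => g.tile i y == Tile.blank) (List.range' (j + 1) (g.n - (j - j0))) = [] := by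
      cases hm : g.n - (j - j0) with
      | zero => rfl
      | succ m => simp [List.range'_succ, h2]
    rw [this, List.append_nil, List.range'_1_concat, List.getLastD_concat]
    omega
  · intro y hy
    simp only [List.mem_range'_1] at hy
    simp [h1 y (by omega) (by omega)]

theorem filter_last (n m : ℕ) (p : ℕ → Bool) (h1 : 1 ≤ m) (h2 : m ≤ n) (h3 : p m = true)
    (h4 : ∀ x, m < x → x ≤ n → p x = false) : ((List.range' 1 n).filter p).getLastD 0 = m := by
  have e : List.range' 1 n = List.range' 1 (m - 1) ++ ([m] ++ List.range' (m + 1) (n - m)) := by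
    have : [m] ++ List.range' (m + 1) (n - m) = List.range' m (n - m + 1) := by
      rw [List.range'_succ]; rfl
    rw [this]
    conv_rhs => rw [show List.range' m (n - m + 1) = List.range' (1 + (m - 1)) (n - m + 1) by congr 1; omega]
    rw [List.range'_append_1]
    congr 1; omega
  rw [e, List.filter_append, List.filter_append]
  have : List.filter p (List.range' (m + 1) (n - m)) = [] := by
    rw [List.filter_eq_nil_iff]
    intro x hx
    simp only [List.mem_range'_1] at hx
    simp [h4 x (by omega) (by omega)]
  rw [this]
  simp [h3, List.getLastD_concat]

end

section

structure SD (lam lam' : ℕ → ℕ → ℕ) (k i e q j : ℕ) : Prop where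
  hq : 1 ≤ q
  hqi : q ≤ i
  hie : i < e
  hek : e ≤ k + 1
  gt : GT lam
  gt' : GT lam'
  hs : ∀ x, i ≤ x → x < e → sC lam x q = j + 1
  hs' : ∀ x, i ≤ x → x < e → sC lam' x q = j
  hne : ∀ x q', x ≤ k → 1 ≤ q' → q' ≤ x → ¬ (q' = q ∧ i ≤ x ∧ x < e) → sC lam' x q' = sC lam x q'

namespace SD
variable {g : Grid} {w : Perm'} {lam lam' : ℕ → ℕ → ℕ} {k i e q j : ℕ}

theorem jpos (s : SD lam lam' k i e q j) : 1 ≤ j := by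
  have := s.hs' i le_rfl s.hie
  have := s.hq
  simp only [sC] at *
  omega

theorem hV (s : SD lam lam' k i e q j) {x : ℕ} (h1 : i ≤ x) (h2 : x < e) :
    ¬ VD k w lam x j ∧ VD k w lam x (j + 1) := by
  have hek := s.hek
  have hqi := s.hqi
  rw [Desc.VDle (by omega), Desc.VDle (by omega)]
  refine ⟨?_, q, s.hq, by omega, s.hs x h1 h2⟩
  rintro ⟨q', a, b, c⟩
  have h3 := s.hs x h1 h2
  have h4 := s.hs' x h1 h2
  have h5 : q' ≠ q := by rintro rfl; omega
  have h6 := s.hne x q' (by omega) a b (by omega)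
  exact h5 (sC_inj s.gt' (x := x) (by omega))

/-- pipes to the left of `q` -/
theorem left (s : SD lam lam' k i e q j) {q' : ℕ} (h1 : 1 ≤ q') (h2 : q' < q) : sC lam (i - 1) q' < j := by
  have hek := s.hek
  have hie := s.hie
  have hqi := s.hqi
  have h3 := s.hs' i le_rfl s.hie
  have h6 := s.hne (i - 1) q' (by omega) h1 (by omega) (by omega)
  have h7 := sC_up' s.gt' h2 (x := i) (by omega)
  omega

theorem right (s : SD lam lam' k i e q j) {q' : ℕ} (h1 : q ≤ q') (h2 : q' ≤ i - 1) : j + 1 ≤ sC lam (i - 1) q' := by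
  have h3 := s.hs i le_rfl s.hie
  have hq := s.hq
  have h4 := sC_down s.gt (x := i - 1) (q := q) (by omega)
  rw [show i - 1 + 1 = i by omega] at h4
  rcases Nat.eq_or_lt_of_le h1 with h5 | h5
  · subst h5; omega
  · have := sC_mono s.gt (x := i - 1) h5; omega

theorem hb (s : SD lam lam' k i e q j) :
    ¬ VD k w lam (i - 1) j ∧ ¬ HD k w lam i (j - 1) ∧ ¬ HD k w lam i j := by
  have hek := s.hek
  have hie := s.hie
  have hqi := s.hqi
  have h3 := s.hs i le_rfl s.hie
  have key : ∀ y, y ≤ j → j ≤ y + 1 → ¬ HD k w lam i y := by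
    intro y hy hy2
    rw [Desc.HDle (by omega)]
    rintro ⟨q', a, b, c, d⟩
    have h4 : q' < q := by rw [← sC_lt s.gt (x := i)]; omega
    have := s.left a h4
    omega
  refine ⟨?_, key _ (by omega) (by omega), key _ le_rfl (by omega)⟩
  rw [Desc.VDle (by omega)]
  rintro ⟨q', a, b, c⟩
  rcases Nat.lt_or_ge q' q with h4 | h4
  · have := s.left a h4; omega
  · have := s.right h4 b; omega

theorem jn (s : SD lam lam' k i e q j) (h : Desc g k w lam) : j + 1 ≤ g.n := by
  have hek := s.hek
  have hie := s.hie
  rw [← s.hs i le_rfl hie]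
  exact h.sCle (by omega) s.hq s.hqi

theorem slide (s : SD lam lam' k i e q j) (h : Desc g k w lam) {j0 : ℕ} (h0 : 1 ≤ j0) (h1 : j0 ≤ j)
    (h2 : q = 1 ∨ sC lam (i - 1) (q - 1) < j0) : slideEast g i j0 = j := by
  have hek := s.hek
  have hie := s.hie
  have hqi := s.hqi
  have hkn := h.kn
  have hq := s.hq
  have hjn := s.jn h
  have hs := s.hs i le_rfl hie
  apply slideEast_eq h1 (by omega)
  · intro y a b
    rw [tile_blank h.real (by omega) (by omega) (by omega) (by omega)]
    have lf : ∀ q', 1 ≤ q' → q' < q → sC lam (i - 1) q' < j0 := by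
      intro q' a b
      rcases Nat.eq_or_lt_of_le (show q' ≤ q - 1 by omega) with h3 | h3
      · subst h3; omega
      · have := sC_mono s.gt (x := i - 1) h3; omega
    have lf2 : ∀ q', 1 ≤ q' → q' < q → sC lam i q' < j0 := by
      intro q' a b
      have h4 := sC_down s.gt (x := i - 1) (q := q') (by omega)
      rw [show i - 1 + 1 = i by omega] at h4
      have := lf q' a b; omega
    refine ⟨?_, ?_, ?_⟩
    · rw [Desc.VDle (by omega)]
      rintro ⟨q', a, b, c⟩
      rcases Nat.lt_or_ge q' q with h4 | h4
      · have := lf q' a h4; omega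
      · have := s.right h4 b; omega
    · rw [Desc.VDle (by omega)]
      rintro ⟨q', a, b, c⟩
      have h4 : q' < q := by rw [← sC_lt s.gt (x := i)]; omega
      have := lf2 q' a h4; omega
    · rw [Desc.HDle (by omega)]
      rintro ⟨q', a, b, c, d⟩
      have h4 : q' < q := by rw [← sC_lt s.gt (x := i)]; omega
      have := lf q' a h4
      omega
  · intro hbl
    rw [tile_blank h.real (by omega) (by omega) (by omega) (by omega)] at hbl
    exact hbl.2.1 (s.hV le_rfl hie).2

theorem pipe (s : SD lam lam' k i e q j) (h : Desc g k w lam) : pipeFromS g i (j + 1) = some (w q) := by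
  have hek := s.hek
  have hie := s.hie
  rw [← s.hs i le_rfl hie]
  exact h.pipeFromS_eq s.hq s.hqi (by omega)

theorem VD_new (s : SD lam lam' k i e q j) {x y : ℕ} (hx : x ≤ k) :
    VD k w lam' x y ↔ (if i ≤ x ∧ x < e ∧ y = j then True else if i ≤ x ∧ x < e ∧ y = j + 1 then False else VD k w lam x y) := by
  have hqi := s.hqi
  by_cases hr : i ≤ x ∧ x < e
  · obtain ⟨h1, h2⟩ := hr
    have a1 := s.hs x h1 h2
    have a2 := s.hs' x h1 h2
    simp only [h1, h2, true_and]
    rw [Desc.VDle hx, Desc.VDle hx]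
    split_ifs with p1 p2
    · simp only [iff_true]
      exact ⟨q, s.hq, by omega, by omega⟩
    · simp only [iff_false]
      rintro ⟨q', a, b, c⟩
      have h5 : q' ≠ q := by rintro rfl; omega
      have h6 := s.hne x q' (by omega) a b (by omega)
      exact h5 (sC_inj s.gt (x := x) (by omega))
    · constructor
      · rintro ⟨q', a, b, c⟩
        have h5 : q' ≠ q := by rintro rfl; omega
        have h6 := s.hne x q' (by omega) a b (by omega)
        exact ⟨q', a, b, by omega⟩
      · rintro ⟨q', a, b, c⟩
        have h5 : q' ≠ q := by rintro rfl; omega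
        have h6 := s.hne x q' (by omega) a b (by omega)
        exact ⟨q', a, b, by omega⟩
  · rw [if_neg (by omega), if_neg (by omega), Desc.VDle hx, Desc.VDle hx]
    constructor
    · rintro ⟨q', a, b, c⟩
      have h6 := s.hne x q' (by omega) a b (by omega)
      exact ⟨q', a, b, by omega⟩
    · rintro ⟨q', a, b, c⟩
      have h6 := s.hne x q' (by omega) a b (by omega)
      exact ⟨q', a, b, by omega⟩

theorem HD_new (s : SD lam lam' k i e q j) {x y : ℕ} (hx : x ≤ k) :
    HD k w lam' x y ↔ (if x = i ∧ y = j then True else if x = e ∧ y = j then False else HD k w lam x y) := by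
  have hqi := s.hqi
  have hie := s.hie
  have hq := s.hq
  rw [Desc.HDle hx, Desc.HDle hx]
  split_ifs with p1 p2
  · obtain ⟨rfl, rfl⟩ := p1
    simp only [iff_true]
    refine ⟨q, hq, hqi, (s.hs' x le_rfl hie).le, ?_⟩
    rcases Nat.eq_or_lt_of_le hqi with h1 | h1
    · exact Or.inl h1
    · right
      have := s.right (q' := q) le_rfl (by omega)
      have h6 := s.hne (x - 1) q (by omega) hq (by omega) (by omega)
      omega
  · obtain ⟨rfl, rfl⟩ := p2
    simp only [iff_false]
    rintro ⟨q', a, b, c, d⟩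
    have a1 := s.hs (x - 1) (by omega) (by omega)
    have a2 := s.hs' (x - 1) (by omega) (by omega)
    rcases Nat.lt_trichotomy q' q with h1 | h1 | h1
    · have := sC_mono s.gt' (x := x - 1) h1
      omega
    · subst h1; omega
    · have h7 := sC_up' s.gt h1 (x := x) (by omega)
      have h6 := s.hne x q' (by omega) a b (by omega)
      omega
  · refine exists_congr fun q' => ?_
    refine and_congr_right fun a => and_congr_right fun b => ?_
    by_cases hqq : q' = q
    · subst hqq
      have n1 : i ≤ x ∧ x < e ∨ sC lam' x q' = sC lam x q' := by
        by_cases i ≤ x ∧ x < e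
        · left; assumption
        · right; exact s.hne x q' hx a b (by omega)
      have n2 : i ≤ x - 1 ∧ x - 1 < e ∨ q' = x ∨ sC lam' (x - 1) q' = sC lam (x - 1) q' := by
        by_cases i ≤ x - 1 ∧ x - 1 < e
        · left; assumption
        · by_cases q' = x
          · right; left; assumption
          · right; right; exact s.hne (x - 1) q' (by omega) a (by omega) (by omega)
      have m1 := s.hs x
      have m1' := s.hs' x
      have m2 := s.hs (x - 1)
      have m2' := s.hs' (x - 1)
      rcases Nat.eq_or_lt_of_le b with hb | hb <;> grind
    · rw [s.hne x q' hx a b (by omega)]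
      rcases Nat.eq_or_lt_of_le b with hb | hb
      · simp [hb]
      · rw [s.hne (x - 1) q' (by omega) a (by omega) (by omega)]

end SD

end

section

theorem Real.congr {n T V H V' H'} (h : Real n T V H) 
    (hV : ∀ x y, x ≤ n → 1 ≤ y → y ≤ n → (V x y ↔ V' x y))
    (hH : ∀ x y, 1 ≤ x → x ≤ n → y ≤ n → (H x y ↔ H' x y)) : Real n T V' H' := by
  intro x y h1 h2 h3 h4
  obtain ⟨a, b, c, d, e⟩ := h x y h1 h2 h3 h4
  rw [hV _ _ (by omega) h3 h4] at a
  rw [hV _ _ (by omega) h3 h4] at b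
  rw [hH _ _ (by omega) h2 (by omega)] at c
  rw [hH _ _ (by omega) h2 (by omega)] at d
  exact ⟨a, b, c, d, e⟩

namespace SD
variable {g : Grid} {w : Perm'} {lam lam' : ℕ → ℕ → ℕ} {k i e q j : ℕ}

theorem nonfinal (s : SD lam lam' k i e q j) (h : Desc g k w lam) (he : e ≤ k) (hlt : sC lam e q ≤ j)
    (hlk : lam' k = lam k) :
    Desc (nablaIter g i e j) k w lam' ∧ w q ≠ j + 1 ∧ 
    (List.range' 1 g.n).find? (fun x => decide (i < x) && (g.tile x (j + 1) == Tile.nw)) = some e := by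
  have hqi := s.hqi
  have hie := s.hie
  have hq := s.hq
  have hjn := s.jn h
  have hkn := h.kn
  have hjp := s.jpos
  have hse := s.hs (e - 1) (by omega) (by omega)
  have hVe : ¬ VD k w lam e (j + 1) := by
    rw [Desc.VDle he]
    rintro ⟨q', a, b, c⟩
    rcases Nat.lt_trichotomy q' q with h1 | h1 | h1
    · have := sC_mono s.gt (x := e) h1
      omega
    · subst h1; omega
    · have h7 := sC_up' s.gt h1 (x := e) (by omega)
      omega
  refine ⟨?_, ?_, ?_⟩
  · obtain ⟨h1, h2⟩ := nablaIter_real h.real (i := i) (i' := e) (j := j) (by omega) hie (by omega) hjp hjn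
      (fun x a b => s.hV a b) s.hb (by
        rw [Desc.HDle he]
        exact ⟨q, hq, by omega, hlt, Or.inr (by omega)⟩)
    refine ⟨by rw [h1]; exact hkn, by rw [h1]; exact h.fix, s.gt', by rw [hlk]; exact h.gr, ?_⟩
    rw [h1]
    apply h2.congr
    · intro x y a b c
      rcases Nat.lt_or_ge k x with hx | hx
      · rw [if_neg (by omega), if_neg (by omega)]
        simp only [VD]
        constructor <;> intro hh <;> right <;> omega
      · exact (s.VD_new hx).symm
    · intro x y a b c
      rcases Nat.lt_or_ge k x with hx | hx
      · rw [if_neg (by omega), if_neg (by omega)]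
        rw [Desc.HDge hx, Desc.HDge hx]
      · exact (s.HD_new hx).symm
  · rw [h.wk hq (by omega)]
    have := sC_anti s.gt (q := q) (x := e) (y := k) (by omega) he
    omega
  · apply find_range' _ _ _ (by omega) (by omega)
    · simp only [hie, decide_true, Bool.true_and, beq_iff_eq]
      rw [tile_nw h.real (by omega) (by omega) (by omega) hjn]
      exact ⟨(s.hV (by omega) (by omega)).2, hVe⟩
    · intro x a b
      by_cases hx : i < x
      · simp only [hx, decide_true, Bool.true_and, beq_eq_false_iff_ne]
        intro hn
        rw [tile_nw h.real (by omega) (by omega) (by omega) hjn] at hn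
        exact hn.2 (s.hV (by omega) (by omega)).2
      · simp [hx]

theorem final (s : SD lam lam' k i e q j) (h : Desc g k w lam) (he : e = k + 1)
    (hgr : GrP k (lam' k) (sT j * w)) :
    w q = j + 1 ∧ ∃ i', (List.range' 1 g.n).find? (fun x =>
            decide (i < x) && (g.tile x (j + 1) == Tile.cross) &&
            (backAux g (2 * g.n + 2) x (j + 1) false == some j)) = some i' ∧
      Desc (nablaIter g i i' j) k (sT j * w) lam' := by
  have hqi := s.hqi
  have hie := s.hie
  have hq := s.hq
  have hjn := s.jn h
  have hkn := h.kn
  have hjp := s.jpos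
  have hw : w q = j + 1 := by
    rw [h.wk hq (by omega)]; exact s.hs k (by omega) (by omega)
  have hws : w.symm (j + 1) = q := by rw [← hw]; simp
  refine ⟨hw, w.symm j, ?_⟩
  have hwi : w (w.symm j) = j := by simp
  generalize hi' : w.symm j = i' at *
  have hik : k < i' := by
    by_contra hc
    have := (s.hV (w := w) (x := k) (by omega) (by omega)).1
    rw [h.VDk hjp] at this
    omega
  have hin : i' ≤ g.n := by rw [← hi']; exact h.wsle (by omega)
  have wj : ∀ x, w x = j → x = i' := by intro x hx; rw [← hi', ← hx]; simp
  have wj1 : ∀ x, w x = j + 1 → x = q := by intro x hx; rw [← hws, ← hx]; simp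
  refine ⟨?_, ?_⟩
  · apply find_range' _ _ _ (by omega) (by omega)
    · simp only [show i < i' by omega, decide_true, Bool.true_and, Bool.and_eq_true, beq_iff_eq]
      refine ⟨?_, ?_⟩
      · rw [tile_cross h.real (by omega) (by omega) (by omega) hjn]
        rw [h.VDge (by omega) (by omega), Desc.HDge hik]
        omega
      · rw [h.back_left_ge _ _ _ hik hin hjn (by omega) (by omega), hwi]
    · intro x a b
      by_cases hx : i < x
      · simp only [hx, decide_true, Bool.true_and]
        rw [Bool.and_eq_false_iff]
        by_cases hc : g.tile x (j + 1) = Tile.cross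
        · right
          rw [tile_cross h.real (by omega) (by omega) (by omega) hjn] at hc
          rcases Nat.lt_or_ge k x with hxk | hxk
          · rw [Desc.HDge hxk] at hc
            rw [h.back_left_ge _ _ _ hxk (by omega) hjn (by omega) (by omega)]
            simp only [beq_eq_false_iff_ne]
            intro hh
            have := wj x (by simpa using hh)
            omega
          · exfalso
            have hc := hc.2
            rw [Desc.HDle hxk] at hc
            obtain ⟨q', a1, a2, a3, a4⟩ := hc
            have h3 := s.hs x (by omega) (by omega)
            have h3' := s.hs (x - 1) (by omega) (by omega)
            have h4 : q' < q := by rw [← sC_lt s.gt (x := x)]; omega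
            have h5 := sC_mono s.gt (x := x - 1) h4
            simp at a3
            omega
        · left; simpa using hc
      · simp [hx]
  · obtain ⟨h1, h2⟩ := nablaIter_real h.real (i := i) (i' := i') (j := j) (by omega) (by omega) (by omega) hjp hjn
      (fun x a b => by
        rcases Nat.lt_or_ge k x with hxk | hxk
        · rw [h.VDge (by omega) hjp, h.VDge (by omega) (by omega)]
          omega
        · exact s.hV a (by omega)) s.hb (by
        rw [Desc.HDge hik]
        omega)
    have sTn : ∀ y, y ≤ g.n → sT j y ≤ g.n := by
      intro y hy; rw [sT_apply]; split_ifs <;> omega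
    refine ⟨by rw [h1]; exact hkn, ?_, s.gt', hgr, ?_⟩
    · rw [h1]
      intro x hx
      simp only [Equiv.Perm.mul_apply]
      rw [h.fix x hx, sT_apply, if_neg (by omega), if_neg (by omega)]
    rw [h1]
    apply h2.congr
    · intro x y a b c
      rcases Nat.lt_or_ge k x with hx | hx
      · simp only [VD, show ¬ x ≤ k by omega, hx, false_and, true_and, false_or]
        have e1 : (sT j * w).symm y = w.symm (sT j y) := by
          rw [Equiv.symm_apply_eq]; simp [sT]
        rw [e1]
        have e2 : w.symm (sT j y) = if y = j then q else if y = j + 1 then i' else w.symm y := by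
          rw [sT_apply]
          split_ifs <;> first | assumption | rfl
        rw [e2]
        by_cases y1 : y = j
        · subst y1
          simp
          omega
        by_cases y2 : y = j + 1
        · subst y2
          simp [hws]
          omega
        · simp [y1, y2]
      · rw [show VD k (sT j * w) lam' x y ↔ VD k w lam' x y by rw [Desc.VDle hx, Desc.VDle hx], s.VD_new hx]
        have : x < i' ↔ x < e := by omega
        simp only [this]
    · intro x y a b c
      rcases Nat.lt_or_ge k x with hx | hx
      · rw [if_neg (by omega), Desc.HDge hx, Desc.HDge hx]
        simp only [Equiv.Perm.mul_apply, sT_apply]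
        have t2 : ¬ w x = j + 1 := fun hh => by have := wj1 x hh; omega
        rw [if_neg t2]
        by_cases hxi : x = i'
        · subst hxi
          rw [if_pos hwi, hwi]
          by_cases hy : y = j
          · simp [hy]
          · simp [hy]; omega
        · have t1 : ¬ w x = j := fun hh => hxi (wj x hh)
          simp [hxi, t1]
      · rw [show HD k (sT j * w) lam' x y ↔ HD k w lam' x y by rw [Desc.HDle hx, Desc.HDle hx], s.HD_new hx]
        rw [if_neg (show ¬ (x = i' ∧ y = j) by omega), if_neg (show ¬ (x = e ∧ y = j) by omega)]

end SD

end

section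

def lamC (lam : ℕ → ℕ → ℕ) (r i : ℕ) : ℕ → ℕ → ℕ := fun x p => if x < i then lamP lam r x p else lam x p

theorem lamC_self (lam r) : lamC lam r r = lam := by
  funext x p
  simp only [lamC, lamP]
  split_ifs <;> first | rfl | omega

theorem GT_lamC {lam r} (h : GT lam) (hr : FirstLev lam r) {e : ℕ} (he : r < e)
    (hP : holeP lam r e = holeP lam r (e - 1)) : GT (lamC lam r e) := by
  have hg := GT_lamP h hr
  obtain ⟨e, rfl⟩ : ∃ e', e = e' + 1 := ⟨e - 1, by omega⟩
  simp only [Nat.add_sub_cancel] at hP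
  have hst := holeP_step lam r e (by omega)
  refine ⟨?_, ?_⟩
  · intro p
    simp only [lamC]
    rw [if_pos (by omega)]
    exact hg.1 p
  · intro x p
    simp only [lamC]
    have a := hg.2 x p
    have b := h.2 x p
    rcases Nat.lt_trichotomy x e with h1 | h1 | h1
    · rw [if_pos (by omega), if_pos (by omega), if_pos (by omega)]
      exact a
    · subst h1
      rw [if_pos (by omega), if_neg (by omega), if_neg (by omega)]
      simp only [lamP]
      split_ifs with h2
      · refine ⟨by omega, ?_⟩
        have : lam (x + 1) (p + 1) ≠ lam x p := by
          intro hh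
          rw [h2.2] at hh
          rw [if_pos hh] at hst
          omega
        omega
      · exact b
    · rw [if_neg (by omega), if_neg (by omega), if_neg (by omega)]
      exact b

/-- end of the run of `holeP` steps starting at `i` -/
theorem run_exists (lam : ℕ → ℕ → ℕ) (r i k : ℕ) (hik : i ≤ k) : ∃ e, i < e ∧ e ≤ k + 1 ∧
    (∀ x, i < x → x < e → holeP lam r x ≠ holeP lam r (x - 1)) ∧
    (e ≤ k → holeP lam r e = holeP lam r (e - 1)) := by
  by_cases hex : ∃ e, i < e ∧ e ≤ k ∧ holeP lam r e = holeP lam r (e - 1)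
  · classical
    refine ⟨Nat.find hex, (Nat.find_spec hex).1, ?_, ?_, fun _ => (Nat.find_spec hex).2.2⟩
    · have := (Nat.find_spec hex).2.1; omega
    · intro x h1 h2 h3
      exact Nat.find_min hex h2 ⟨h1, by have := (Nat.find_spec hex).2.1; omega, h3⟩
  · push Not at hex
    refine ⟨k + 1, by omega, le_rfl, ?_, by omega⟩
    intro x h1 h2
    exact hex x h1 (by omega)

theorem run_const {r i e : ℕ} {lam : ℕ → ℕ → ℕ} (hri : r ≤ i)
    (h : ∀ x, i < x → x < e → holeP lam r x ≠ holeP lam r (x - 1)) : ∀ x, i ≤ x → x < e →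
    holeP lam r x = holeP lam r i + (x - i) ∧ lam x (holeP lam r x) = lam i (holeP lam r i) := by
  intro x hx
  induction x, hx using Nat.le_induction with
  | base => intro _; simp
  | succ x hx ih =>
    intro hxe
    obtain ⟨a, b⟩ := ih (by omega)
    have hst := holeP_step lam r x (by omega)
    have hn := h (x + 1) (by omega) hxe
    simp only [Nat.add_sub_cancel] at hn
    split_ifs at hst with hc
    · rw [hst, hc]
      exact ⟨by omega, b⟩
    · exact absurd hst hn

theorem loop_main {lam : ℕ → ℕ → ℕ} {r k : ℕ} {w : Perm'} (h : GT lam) (hr : FirstLev lam r) :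
    ∀ (m i : ℕ) (g : Grid) (j0 fuel : ℕ), k - i < m → r ≤ i → i ≤ k → 
    (i = r ∨ (r < i ∧ holeP lam r i = holeP lam r (i - 1))) → Desc g k w (lamC lam r i) → 1 ≤ j0 →
    j0 + 1 ≤ sC lam i (i - holeP lam r i) → 
    (i - holeP lam r i = 1 ∨ sC (lamC lam r i) (i - 1) (i - holeP lam r i - 1) < j0) →
    k - i + 1 ≤ fuel → 
    ∃ g' a, nablaLoop g fuel (i, j0) = (g', a) ∧ Desc g' k (sT a * w) (lamP lam r) ∧ g'.n = g.n ∧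
      a + holeP lam r k + 1 = k + lam k (holeP lam r k) := by
  intro m
  induction m with
  | zero => intros; omega
  | succ m ih =>
    intro i g j0 fuel hm hri hik hi hD hj0 hj1 hj2 hf
    have hr1 := hr.1
    obtain ⟨f, rfl⟩ : ∃ f, fuel = f + 1 := ⟨fuel - 1, by omega⟩
    obtain ⟨e, he1, he2, he3, he4⟩ := run_exists lam r i k hik
    have hrc := run_const hri he3
    have hPi := holeP_bound lam r i hri
    obtain ⟨q, hq⟩ : ∃ q, q = i - holeP lam r i := ⟨_, rfl⟩
    rw [← hq] at hj1 hj2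
    obtain ⟨j, hj⟩ : ∃ j, sC lam i q = j + 1 := ⟨sC lam i q - 1, by omega⟩
    have hPx : ∀ x, i ≤ x → x < e → x - q = holeP lam r x := by
      intro x a b
      have := (hrc x a b).1
      omega
    have hsx : ∀ x, i ≤ x → x < e → sC lam x q = j + 1 := by
      intro x a b
      rw [← hj]
      simp only [sC]
      rw [hPx x a b, hPx i le_rfl he1, (hrc x a b).2]
    have hsx' : ∀ x, i ≤ x → x < e → sC (lamP lam r) x q = j := by
      intro x a b
      have := hsx x a b
      have hc := holeP_corner h hr x (by omega)
      simp only [sC] at *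
      rw [hPx x a b] at *
      simp only [lamP]
      rw [if_pos ⟨by omega, trivial⟩]
      omega
    have hnx : ∀ x q', 1 ≤ q' → q' ≤ x → ¬ (q' = q ∧ i ≤ x) → i ≤ x → x < e →
        sC (lamP lam r) x q' = sC lam x q' := by
      intro x q' a b c d d2
      have := hPx x d d2
      have hb := holeP_bound lam r x (by omega)
      simp only [sC, lamP]
      rw [if_neg (by omega)]
    rcases Nat.lt_or_ge k e with hek | hek
    · -- final
      obtain rfl : e = k + 1 := by omega
      have s : SD (lamC lam r i) (lamP lam r) k i (k + 1) q j := by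
        refine ⟨by omega, by omega, he1, le_rfl, hD.gt, GT_lamP h hr, ?_, ?_, ?_⟩
        · intro x a b
          rw [← hsx x a b]
          simp only [sC, lamC]; rw [if_neg (by omega)]
        · intro x a b
          exact hsx' x a b
        · intro x q' a b c d
          by_cases hx : x < i
          · simp only [sC, lamC]; rw [if_pos hx]
          · rw [hnx x q' b c (by omega) (by omega) (by omega)]
            simp only [sC, lamC]; rw [if_neg hx]
      have hb := holeP_bound lam r k (by omega)
      have hPk := hPx k hik (by omega)
      have hkk := hsx k hik (by omega)
      have ha : j + holeP lam r k + 1 = k + lam k (holeP lam r k) := by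
        simp only [sC] at hkk
        rw [hPk] at hkk
        omega
      have hgr : GrP k (lamP lam r k) (sT j * w) := by
        rw [lamP_row k (by omega)]
        have hgr := hD.gr
        have : lamC lam r i k = lam k := by
          funext p; simp only [lamC]; rw [if_neg (by omega)]
        rw [this] at hgr
        exact hgr.step (h.part k) (by omega) (holeP_corner h hr k (by omega)) ha
      obtain ⟨hw, i', hfind, hD'⟩ := s.final hD rfl hgr
      refine ⟨nablaIter g i i' j, j, ?_, hD', rfl, ha⟩
      rw [nablaLoop]
      rw [s.slide hD hj0 (by omega) hj2, s.pipe hD]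
      simp only
      rw [if_pos hw, hfind]
    · -- nonfinal
      have s : SD (lamC lam r i) (lamC lam r e) k i e q j := by
        refine ⟨by omega, by omega, he1, by omega, hD.gt, GT_lamC h hr (by omega) (he4 hek), ?_, ?_, ?_⟩
        · intro x a b
          rw [← hsx x a b]
          simp only [sC, lamC]; rw [if_neg (by omega)]
        · intro x a b
          rw [← hsx' x a b]
          simp only [sC, lamC]; rw [if_pos (by omega)]
        · intro x q' a b c d
          by_cases hx : x < i
          · simp only [sC, lamC]; rw [if_pos hx, if_pos (by omega)]
          · by_cases hx2 : x < e
            · have := hnx x q' b c (by omega) (by omega) (by omega)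
              simp only [sC, lamC] at *; rw [if_neg hx, if_pos hx2]; exact this
            · simp only [sC, lamC]; rw [if_neg hx, if_neg hx2]
      have hPe := he4 hek
      have hPe' := hPx (e - 1) (by omega) (by omega)
      have hse := hsx (e - 1) (by omega) (by omega)
      have hup := sC_up h (x := e - 1) (q := q)
      rw [show e - 1 + 1 = e by omega] at hup
      have hlt : sC (lamC lam r i) e q ≤ j := by
        have hst := holeP_step lam r (e - 1) (by omega)
        rw [show e - 1 + 1 = e by omega] at hst
        have h2 := (h.2 (e - 1) (holeP lam r (e - 1))).2
        rw [show e - 1 + 1 = e by omega] at h2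
        split_ifs at hst with hc
        · omega
        · simp only [sC, lamC] at *
          rw [if_neg (by omega), show e - q = holeP lam r (e - 1) + 1 by omega]
          rw [hPe'] at hse
          omega
      have hlk : lamC lam r e k = lamC lam r i k := by
        funext p; simp only [lamC]; rw [if_neg (by omega), if_neg (by omega)]
      obtain ⟨hD', hw, hfind⟩ := s.nonfinal hD hek hlt hlk
      have hqe : e - holeP lam r e = q + 1 := by omega
      obtain ⟨g', a, h1, h2, h3, h4⟩ := ih e (nablaIter g i e j) (j + 1) f (by omega) (by omega) hek
        (Or.inr ⟨by omega, hPe⟩) hD' (by omega) (by rw [hqe]; omega) (by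
          right
          rw [hqe]
          simp only [Nat.add_sub_cancel]
          have := hsx' (e - 1) (by omega) (by omega)
          simp only [sC, lamC] at *
          rw [if_pos (by omega)]
          omega) (by omega)
      refine ⟨g', a, ?_, h2, h3, h4⟩
      rw [nablaLoop]
      rw [s.slide hD hj0 (by omega) hj2, s.pipe hD]
      simp only
      rw [if_neg hw, hfind]
      exact h1

theorem pop_main {lam : ℕ → ℕ → ℕ} {r k : ℕ} {w : Perm'} {g : Grid} (hD : Desc g k w lam) (hr : FirstLev lam r)
    (hrk : r ≤ k) : ∃ g' a, nablaPop g = (g', r, a) ∧ Desc g' k (sT a * w) (lamP lam r) ∧ 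
      a + holeP lam r k + 1 = k + lam k (holeP lam r k) := by
  have h := hD.gt
  obtain ⟨hr1, hr2, hr3⟩ := hr
  have hkn := hD.kn
  have hrow : ∀ x q, x < r → sC lam x q = q := by
    intro x q hx; simp [sC, hr3 x _ hx]
  have hrowr : ∀ q, q < r → sC lam r q = q := by
    intro q hq
    have := (h.2 (r - 1) (r - q - 1)).2
    rw [hr3 (r - 1) _ (by omega), show r - 1 + 1 = r by omega, show r - q - 1 + 1 = r - q by omega] at this
    simp only [sC]; omega
  have hrr : sC lam r r = lam r 0 + r := by simp [sC]
  have hle := hD.sCle hrk hr1 le_rfl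
  have hblank : g.tile r (lam r 0 + r - 1) = Tile.blank := by
    rw [tile_blank hD.real (by omega) (by omega) (by omega) (by omega)]
    rw [Desc.VDle (by omega), Desc.VDle (by omega), Desc.HDle (by omega)]
    refine ⟨?_, ?_, ?_⟩
    · rintro ⟨q, a, b, c⟩
      rw [hrow _ _ (by omega)] at c; omega
    · rintro ⟨q, a, b, c⟩
      rcases Nat.eq_or_lt_of_le b with b | b
      · subst b; omega
      · rw [hrowr _ b] at c; omega
    · rintro ⟨q, a, b, c, d⟩
      rcases Nat.eq_or_lt_of_le b with b | b
      · subst b; omega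
      · rw [hrow _ _ (by omega)] at d; omega
  have hfind : (List.range' 1 g.n).find?
      (fun i => (List.range' 1 g.n).any (fun j => g.tile i j == Tile.blank)) = some r := by
    apply find_range' _ _ _ hr1 (by omega)
    · rw [List.any_eq_true]
      refine ⟨lam r 0 + r - 1, by simp; omega, by simp [hblank]⟩
    · intro x h1 h2
      rw [List.any_eq_false]
      intro y hy
      simp only [List.mem_range'_1] at hy
      simp only [beq_iff_eq]
      rw [tile_blank hD.real (by omega) (by omega) (by omega) (by omega)]
      rw [Desc.VDle (by omega), Desc.VDle (by omega), Desc.HDle (by omega)]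
      rintro ⟨-, a, b⟩
      rcases Nat.lt_or_ge x y with hxy | hxy
      · exact b ⟨x, h1, le_rfl, by rw [hrow _ _ h2]; omega, Or.inl rfl⟩
      · exact a ⟨y, by omega, hxy, hrow _ _ h2⟩
  have hlast : ((List.range' 1 g.n).filter (fun j => g.tile r j == Tile.blank)).getLastD 0 = lam r 0 + r - 1 := by
    apply filter_last _ _ _ (by omega) (by omega) (by simp [hblank])
    intro y h1 h2
    simp only [beq_eq_false_iff_ne]
    intro hb
    rw [tile_blank hD.real (by omega) (by omega) (by omega) (by omega), Desc.HDle (by omega)] at hb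
    exact hb.2.2 ⟨r, hr1, le_rfl, by omega, Or.inl rfl⟩
  have h0 : holeP lam r r = 0 := holeP_le _ _ _ le_rfl
  obtain ⟨g', a, e1, e2, e3, e4⟩ := loop_main (w := w) h ⟨hr1, hr2, hr3⟩ (k - r + 1) r g (lam r 0 + r - 1) (g.n + 1) (by omega)
    le_rfl hrk (Or.inl rfl) (by rw [lamC_self]; exact hD) (by omega) (by
      rw [h0]; simp only [Nat.sub_zero]; omega) (by
      rw [h0, lamC_self, hrow _ _ (by omega)]
      omega) (by omega)
  refine ⟨g', a, ?_, e2, e4⟩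
  unfold nablaPop
  rw [hfind]
  simp only
  rw [hlast, e1]

theorem firstLev_exists {lam : ℕ → ℕ → ℕ} (h : GT lam) {k : ℕ} (hk : 0 < lam k 0) :
    ∃ r, FirstLev lam r ∧ r ≤ k := by
  classical
  have hex : ∃ x, 0 < lam x 0 := ⟨k, hk⟩
  refine ⟨Nat.find hex, ⟨?_, Nat.find_spec hex, ?_⟩, Nat.find_min' hex hk⟩
  · by_contra hc
    have := Nat.find_spec hex
    rw [show Nat.find hex = 0 by omega, h.1] at this
    omega
  · intro x p hx
    have := Nat.find_min hex hx
    have := (h.part x).anti (Nat.zero_le p)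
    omega

theorem sum_lamP {lam : ℕ → ℕ → ℕ} {r k : ℕ} (h : GT lam) (hr : FirstLev lam r) (hrk : r ≤ k) :
    ∑ p ∈ Finset.range k, lam k p = ∑ p ∈ Finset.range k, lamP lam r k p + 1 := by
  have hb := holeP_bound lam r k hrk
  have hr1 := hr.1
  have hc := holeP_corner h hr k hrk
  have hm : holeP lam r k ∈ Finset.range k := by simp; omega
  rw [← Finset.add_sum_erase _ _ hm, ← Finset.add_sum_erase _ (lamP lam r k) hm]
  have : ∑ x ∈ (Finset.range k).erase (holeP lam r k), lam k x
      = ∑ x ∈ (Finset.range k).erase (holeP lam r k), lamP lam r k x := by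
    apply Finset.sum_congr rfl
    intro x hx
    simp only [Finset.mem_erase] at hx
    simp [lamP, hx.1]
  rw [this]
  simp only [lamP]
  rw [if_pos ⟨hrk, trivial⟩]
  omega

theorem phiAux_NW {k : ℕ} : ∀ (N : ℕ) (g : Grid) (w : Perm') (lam : ℕ → ℕ → ℕ), Desc g k w lam →
    ∑ p ∈ Finset.range k, lam k p = N → NW k lam (phiAux N g) := by
  intro N
  induction N with
  | zero =>
    intro g w lam hD hs
    apply NW.nil
    intro p
    by_cases hp : p < k
    · exact (Finset.sum_eq_zero_iff.1 hs) p (by simpa using hp)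
    · exact hD.gt.zero k p (by omega)
  | succ N ih =>
    intro g w lam hD hs
    have hpos : 0 < lam k 0 := by
      by_contra hc
      have : ∑ p ∈ Finset.range k, lam k p = 0 := by
        apply Finset.sum_eq_zero
        intro p _
        have := (hD.gt.part k).anti (Nat.zero_le p)
        omega
      omega
    obtain ⟨r, hr, hrk⟩ := firstLev_exists hD.gt hpos
    obtain ⟨g', a, e1, e2, e3⟩ := pop_main hD hr hrk
    have hsum := sum_lamP hD.gt hr hrk
    rw [phiAux]
    have p1 : pop g = (r, a) := by simp [pop, e1]
    have p2 : nabla g = g' := by simp [nabla, e1]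
    rw [p1, p2]
    exact NW.cons lam r a _ hr hrk e3 (ih g' _ _ e2 (by omega))

end

section

theorem sum_range'_Icc (f : ℕ → ℕ) (n : ℕ) : ((List.range' 1 n).map f).sum = ∑ x ∈ Finset.Icc 1 n, f x := by
  induction n with
  | zero => simp
  | succ n ih =>
    rw [List.range'_1_concat, Finset.sum_Icc_succ_top (by omega)]
    simp [ih, Nat.add_comm]

theorem filter_range'_Icc (p : ℕ → Bool) (n : ℕ) :
    ((List.range' 1 n).filter p).length = ((Finset.Icc 1 n).filter (fun x => p x = true)).card := by
  rw [Finset.card_filter]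
  induction n with
  | zero => simp
  | succ n ih =>
    rw [List.range'_1_concat, Finset.sum_Icc_succ_top (by omega), List.filter_append, List.length_append, ih]
    congr 1
    rw [Nat.add_comm 1 n]
    by_cases h : p (n + 1) <;> simp [h]

namespace Desc
variable {g : Grid} {k : ℕ} {w : Perm'} {lam : ℕ → ℕ → ℕ}

theorem wmono (h : Desc g k w lam) {q q' : ℕ} (h1 : 1 ≤ q) (h2 : q < q') (h3 : q' ≤ k) : w q < w q' :=
  h.gr.mono (h.gt.part k) h1 h2 h3

theorem count_small (h : Desc g k w lam) {q : ℕ} (h1 : 1 ≤ q) (h2 : q ≤ k) :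
    ((Finset.Icc (k + 1) g.n).filter (fun x => w x < w q)).card + q = w q := by
  have hp := h.gr.pos h1
  have hkn := h.kn
  have e : (Finset.Icc 1 (w q - 1)).image w.symm
      = Finset.Icc 1 (q - 1) ∪ (Finset.Icc (k + 1) g.n).filter (fun x => w x < w q) := by
    ext x
    simp only [Finset.mem_image, Finset.mem_Icc, Finset.mem_union, Finset.mem_filter]
    constructor
    · rintro ⟨v, ⟨a, b⟩, rfl⟩
      have c := h.wsymm_pos a
      have hwq := h.wle (x := q) (by omega)
      have d := h.wsle (x := v) (by omega)
      by_cases hk : w.symm v ≤ k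
      · left
        refine ⟨c, ?_⟩
        by_contra hc
        rcases Nat.eq_or_lt_of_le (show q ≤ w.symm v by omega) with e | e
        · have : w q = v := by rw [e]; simp
          omega
        · have := h.wmono h1 e hk
          simp at this; omega
      · right
        refine ⟨by omega, by simp; omega⟩
    · rintro (⟨a, b⟩ | ⟨⟨a, b⟩, c⟩)
      · refine ⟨w x, ⟨h.gr.pos a, ?_⟩, by simp⟩
        have := h.wmono a (q' := q) (by omega) h2
        omega
      · exact ⟨w x, ⟨h.gr.pos (by omega), by omega⟩, by simp⟩
  have hc := congrArg Finset.card e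
  rw [Finset.card_image_of_injective _ w.symm.injective, Finset.card_union_of_disjoint] at hc
  · simp at hc; omega
  · rw [Finset.disjoint_left]
    intro x
    simp only [Finset.mem_Icc, Finset.mem_filter]
    omega

theorem cross_row_le (h : Desc g k w lam) {x y : ℕ} (h1 : 1 ≤ x) (h2 : x ≤ k) (h3 : 1 ≤ y) (h4 : y ≤ g.n) :
    g.tile x y ≠ Tile.cross := by
  have hkn := h.kn
  intro hc
  rw [tile_cross h.real h1 (by omega) h3 h4, VDle h2, HDle h2] at hc
  obtain ⟨⟨q, a, b, c⟩, q', a', b', c', d'⟩ := hc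
  have h4 : q' < q := by rw [← sC_lt h.gt (x := x)]; omega
  have := sC_up' h.gt h4 h1
  omega

theorem cross_row_gt (h : Desc g k w lam) {x y : ℕ} (h1 : k < x) (h2 : x ≤ g.n) (h3 : 1 ≤ y) (h4 : y ≤ g.n) :
    g.tile x y = Tile.cross ↔ w.symm y ≤ k ∧ w x < y := by
  rw [tile_cross h.real (by omega) (by omega) h3 h4, h.VDge (by omega) h3, HDge h1]
  have hyy : w (w.symm y) = y := by simp
  have hp := h.gr.pos (x := x) (by omega)
  constructor
  · rintro ⟨a, b⟩
    refine ⟨?_, by omega⟩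
    by_contra hc
    rcases Nat.eq_or_lt_of_le a with e | e
    · rw [e] at hyy; omega
    · have := h.gr.2.2 _ x (by omega) e
      omega
  · rintro ⟨a, b⟩
    omega

theorem cross_count (h : Desc g k w lam) : crossCount g = ∑ p ∈ Finset.range k, lam k p := by
  have hkn := h.kn
  unfold crossCount
  rw [sum_range'_Icc]
  have e1 : ∀ x ∈ Finset.Icc 1 g.n, ((List.range' 1 g.n).filter (fun j => g.tile x j == Tile.cross)).length
      = ∑ q ∈ Finset.Icc 1 k, if k < x ∧ w x < w q then 1 else 0 := by
    intro x hx
    simp only [Finset.mem_Icc] at hx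
    rw [filter_range'_Icc, ← Finset.card_filter]
    rcases Nat.lt_or_ge k x with hk | hk
    · symm
      apply Finset.card_bij (fun q _ => w q)
      · intro q hq
        simp only [Finset.mem_filter, Finset.mem_Icc] at hq ⊢
        have := h.gr.pos hq.1.1
        have := h.wle (x := q) (by omega)
        refine ⟨⟨by omega, by omega⟩, ?_⟩
        simp only [beq_iff_eq]
        rw [h.cross_row_gt hk hx.2 (by omega) (by omega)]
        simp; omega
      · intro a _ b _ hab
        exact w.injective hab
      · intro y hy
        simp only [Finset.mem_filter, Finset.mem_Icc, beq_iff_eq] at hy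
        rw [h.cross_row_gt hk hx.2 (by omega) (by omega)] at hy
        refine ⟨w.symm y, ?_, by simp⟩
        simp only [Finset.mem_filter, Finset.mem_Icc]
        have := h.wsymm_pos hy.1.1
        simp; omega
    · rw [Finset.filter_false_of_mem, Finset.filter_false_of_mem]
      · intro q _; omega
      · intro y hy
        simp only [Finset.mem_Icc] at hy
        simp only [beq_iff_eq]
        exact h.cross_row_le hx.1 hk hy.1 hy.2
  rw [Finset.sum_congr rfl e1, Finset.sum_comm]
  have e2 : ∀ q ∈ Finset.Icc 1 k, (∑ x ∈ Finset.Icc 1 g.n, if k < x ∧ w x < w q then 1 else 0) = lam k (k - q) := by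
    intro q hq
    simp only [Finset.mem_Icc] at hq
    rw [← Finset.card_filter]
    have e3 : (Finset.Icc 1 g.n).filter (fun x => k < x ∧ w x < w q)
      = (Finset.Icc (k + 1) g.n).filter (fun x => w x < w q) := by
      ext x; simp only [Finset.mem_filter, Finset.mem_Icc]; omega
    rw [e3]
    have := h.count_small hq.1 hq.2
    rw [h.gr.2.1 q hq.1 hq.2] at this
    simp only [Nat.add_right_cancel_iff] at this
    rw [← this, h.gr.2.1 q hq.1 hq.2]
  rw [Finset.sum_congr rfl e2]
  symm
  apply Finset.sum_bij' (fun p _ => k - p) (fun q _ => k - q)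
  · intro a ha; simp at *; omega
  · intro a ha; simp at *; omega
  · intro a ha; simp at *; omega
  · intro a ha; simp at *; omega
  · intro a ha
    simp only [Finset.mem_range] at ha
    rw [show k - (k - a) = a by omega]

end Desc

end

section

theorem insDesc_zeros (x m : ℕ) : insDesc x (List.replicate m 0) = x :: List.replicate m 0 := by
  induction m with
  | zero => rfl
  | succ m ih =>
    rw [List.replicate_succ, insDesc]
    split_ifs with h
    · rfl
    · obtain rfl : x = 0 := by omega
      rw [ih]

theorem insDesc_append (x m : ℕ) : ∀ A : List ℕ, (∀ a ∈ A, x ≤ a) →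
    insDesc x (A ++ List.replicate m 0) = (A ++ [x]) ++ List.replicate m 0 := by
  intro A
  induction A with
  | nil => intro _; simpa using insDesc_zeros x m
  | cons a A ih =>
    intro h
    have := h a (by simp)
    rw [List.cons_append, insDesc, if_neg (by omega), ih (fun b hb => h b (by simp [hb]))]
    simp

theorem foldr_zeros (m : ℕ) : (List.replicate m 0).foldr insDesc [] = List.replicate m 0 := by
  induction m with
  | zero => rfl
  | succ m ih =>
    rw [List.replicate_succ, List.foldr_cons, ih, insDesc_zeros]

theorem foldr_part {μ : ℕ → ℕ} (hμ : IsPart μ) (m : ℕ) : ∀ k : ℕ,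
    ((List.range k).map μ).reverse.foldr insDesc (List.replicate m 0) = (List.range k).map μ ++ List.replicate m 0 := by
  intro k
  induction k with
  | zero => simp
  | succ k ih =>
    rw [List.range_succ, List.map_append, List.reverse_append]
    simp only [List.map_cons, List.map_nil, List.reverse_cons, List.reverse_nil, List.nil_append,
      List.singleton_append, List.foldr_cons]
    rw [ih, insDesc_append]
    intro a ha
    simp only [List.mem_map, List.mem_range] at ha
    obtain ⟨p, hp, rfl⟩ := ha
    exact hμ.anti hp.le

theorem rev_range' (μ : ℕ → ℕ) (k : ℕ) : (List.range' 1 k).map (fun q => μ (k - q)) = ((List.range k).map μ).reverse := by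
  apply List.ext_getElem
  · simp
  · intro i h1 h2
    simp at h1 h2 ⊢
    congr 1; omega

theorem R_exists {μ : ℕ → ℕ} (hμ : IsPart μ) {k : ℕ} (hk : μ k = 0) : ∃ R, R ≤ k ∧ ∀ p, p < R ↔ 0 < μ p := by
  classical
  have hex : ∃ p, μ p = 0 := ⟨k, hk⟩
  refine ⟨Nat.find hex, Nat.find_min' hex hk, ?_⟩
  intro p
  constructor
  · intro h
    have := Nat.find_min hex h
    omega
  · intro h
    by_contra hc
    have := hμ.anti (show Nat.find hex ≤ p by omega)
    have := Nat.find_spec hex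
    omega

namespace Desc
variable {g : Grid} {k : ℕ} {w : Perm'} {lam : ℕ → ℕ → ℕ}

theorem code_le (h : Desc g k w lam) {q : ℕ} (h1 : 1 ≤ q) (h2 : q ≤ k) : codeOf w q = lam k (k - q) := by
  have e : {j : ℕ | q < j ∧ w j < w q} = ↑((Finset.Icc (k + 1) g.n).filter (fun x => w x < w q)) := by
    ext x
    simp only [Set.mem_ofPred_eq, Finset.coe_filter, Finset.mem_Icc]
    constructor
    · rintro ⟨a, b⟩
      refine ⟨⟨?_, ?_⟩, b⟩
      · by_contra hc
        have := h.wmono h1 a (by omega)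
        omega
      · by_contra hc
        have := h.fix x (by omega)
        have := h.wle (x := q) (by have := h.kn; omega)
        omega
    · rintro ⟨⟨a, b⟩, c⟩
      exact ⟨by omega, c⟩
  unfold codeOf
  rw [e]
  have := h.count_small h1 h2
  rw [Nat.card_coe_set_eq, Set.ncard_coe_finset]
  have h3 := h.gr.2.1 q h1 h2
  omega

theorem code_gt (h : Desc g k w lam) {x : ℕ} (h1 : k < x) : codeOf w x = 0 := by
  have e : {j : ℕ | x < j ∧ w j < w x} = ∅ := by
    ext j
    simp only [Set.mem_ofPred_eq, Set.mem_empty_iff_false, iff_false]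
    rintro ⟨a, b⟩
    have := h.gr.2.2 x j h1 a
    omega
  unfold codeOf
  rw [e]; simp

theorem shape (h : Desc g k w lam) {R : ℕ} (hRk : R ≤ k) (hR : ∀ p, p < R ↔ 0 < lam k p) :
    shapeOf w g.n = (List.range R).map (lam k) := by
  have hkn := h.kn
  unfold shapeOf sortDesc
  have e : List.range' 1 g.n = List.range' 1 k ++ List.range' (1 + k) (g.n - k) := by
    rw [List.range'_append_1]; congr 1; omega
  have e1 : (List.range' 1 k).map (codeOf w) = (List.range' 1 k).map (fun q => lam k (k - q)) := by
    apply List.map_congr_left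
    intro q hq
    simp only [List.mem_range'_1] at hq
    exact h.code_le hq.1 (by omega)
  have e2 : (List.range' (1 + k) (g.n - k)).map (codeOf w) = List.replicate (g.n - k) 0 := by
    rw [List.eq_replicate_iff]
    refine ⟨by simp, ?_⟩
    intro b hb
    simp only [List.mem_map, List.mem_range'_1] at hb
    obtain ⟨x, hx, rfl⟩ := hb
    exact h.code_gt (by omega)
  rw [e, List.map_append, e1, e2, rev_range', List.foldr_append, foldr_zeros, foldr_part (h.gt.part k), List.filter_append]
  have e3 : (List.replicate (g.n - k) 0).filter (fun x => decide (0 < x)) = [] := by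
    rw [List.filter_eq_nil_iff]
    intro x hx
    rw [List.eq_of_mem_replicate hx]; simp
  have e4 : List.range k = List.range R ++ (List.range (k - R)).map (R + ·) := by
    rw [← List.range_add]; congr 1; omega
  rw [e3, List.append_nil, e4, List.map_append, List.filter_append]
  have e5 : (((List.range (k - R)).map (R + ·)).map (lam k)).filter (fun x => decide (0 < x)) = [] := by
    rw [List.filter_eq_nil_iff]
    intro x hx
    simp only [List.mem_map] at hx
    obtain ⟨a, ⟨b, _, rfl⟩, rfl⟩ := hx
    have := hR (R + b)
    simp; omega
  rw [e5, List.append_nil, List.filter_eq_self]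
  intro x hx
  simp only [List.mem_map, List.mem_range] at hx
  obtain ⟨p, hp, rfl⟩ := hx
  simpa using (hR p).1 hp

end Desc

end

section

theorem Tof_prop {lam} (h : GT lam) {k p c : ℕ} (hc : c < lam k p) :
    1 ≤ Tof lam p c ∧ Tof lam p c ≤ k ∧ c < lam (Tof lam p c) p ∧ lam (Tof lam p c - 1) p ≤ c ∧ p < Tof lam p c := by
  have hne : {i | c < lam i p}.Nonempty := ⟨k, hc⟩
  have hm : c < lam (Tof lam p c) p := Nat.sInf_mem hne
  have h1 : 1 ≤ Tof lam p c := by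
    by_contra h0
    rw [show Tof lam p c = 0 by omega, h.1] at hm
    omega
  refine ⟨h1, Nat.sInf_le hc, hm, ?_, ?_⟩
  · by_contra h0
    have : Tof lam p c ≤ Tof lam p c - 1 := Nat.sInf_le (show c < lam (Tof lam p c - 1) p by omega)
    omega
  · by_contra h0
    rw [h.zero _ p (by omega)] at hm
    omega

theorem Tof_eq {lam} (h : GT lam) {i p c : ℕ} (hi : 1 ≤ i) (h1 : lam (i - 1) p ≤ c) (h2 : c < lam i p) :
    Tof lam p c = i := by
  obtain ⟨i, rfl⟩ : ∃ i', i = i' + 1 := ⟨i - 1, by omega⟩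
  exact Tof_spec h i p c h1 h2

theorem Tof_diag {lam} (h : GT lam) {k p c : ℕ} (hc : c + 1 < lam k (p + 1)) :
    Tof lam p c < Tof lam (p + 1) (c + 1) := by
  obtain ⟨h1, h2, h3, h4, h5⟩ := Tof_prop h hc
  have h6 := (h.2 (Tof lam (p + 1) (c + 1) - 1) p).2
  rw [show Tof lam (p + 1) (c + 1) - 1 + 1 = Tof lam (p + 1) (c + 1) by omega] at h6
  have : Tof lam p c ≤ Tof lam (p + 1) (c + 1) - 1 :=
    Nat.sInf_le (show c < lam (Tof lam (p + 1) (c + 1) - 1) p by omega)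
  omega

namespace Desc
variable {g : Grid} {k : ℕ} {w : Perm'} {lam : ℕ → ℕ → ℕ}

theorem blank_gt (h : Desc g k w lam) {x y : ℕ} (h1 : k < x) (h2 : x ≤ g.n) (h3 : 1 ≤ y) (h4 : y ≤ g.n) :
    g.tile x y ≠ Tile.blank := by
  intro hb
  rw [tile_blank h.real (by omega) h2 h3 h4, h.VDge (by omega) h3, h.VDge (by omega) h3, HDge h1] at hb
  have := h.gr.2.2 x (w.symm y) h1 (by omega)
  simp at this
  omega

theorem blank_iff (h : Desc g k w lam) {x y : ℕ} (h1 : 1 ≤ x) (h2 : x ≤ k) (h3 : 1 ≤ y) (h4 : y ≤ g.n) :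
    g.tile x y = Tile.blank ↔ ∃ p c, p < x ∧ y + p = c + x ∧ lam (x - 1) p ≤ c ∧ c < lam x p := by
  have hkn := h.kn
  rw [tile_blank h.real h1 (by omega) h3 h4, VDle (by omega), VDle h2, HDle h2]
  constructor
  · rintro ⟨a, b, c⟩
    have hx : y < sC lam x x := by
      by_contra hc
      exact c ⟨x, h1, le_rfl, by omega, Or.inl rfl⟩
    classical
    have hex : ∃ q, 1 ≤ q ∧ y < sC lam x q := ⟨x, h1, hx⟩
    have hs := Nat.find_spec hex
    have hmin := fun q => Nat.find_min hex (m := q)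
    have hqx : Nat.find hex ≤ x := Nat.find_min' hex ⟨h1, hx⟩
    generalize Nat.find hex = q at *
    have h5 : sC lam (x - 1) (q - 1) < y ∨ q = 1 := by
      by_cases hq1 : q = 1
      · right; exact hq1
      · left
        have h6 := hmin (q - 1) (by omega)
        have h7 : ¬ y < sC lam (x - 1) (q - 1) := by
          intro hh
          exact c ⟨q - 1, by omega, by omega, by omega, Or.inr hh⟩
        have h8 : sC lam (x - 1) (q - 1) ≠ y := by
          intro hh
          exact a ⟨q - 1, by omega, by omega, hh⟩
        omega
    have hqy : q ≤ y := by
      rcases h5 with h5 | h5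
      · simp only [sC] at h5; omega
      · omega
    refine ⟨x - q, y - q, by omega, ?_, ?_, ?_⟩
    · omega
    · rcases h5 with h5 | h5
      · simp only [sC] at h5
        rw [show x - 1 - (q - 1) = x - q by omega] at h5
        omega
      · rw [h.gt.zero _ _ (by omega)]; omega
    · have := hs.2
      simp only [sC] at this
      omega
  · rintro ⟨p, c, a1, a2, a3, a4⟩
    obtain ⟨q, hq⟩ : ∃ q, q = x - p := ⟨_, rfl⟩
    have hy : y < sC lam x q := by simp only [sC]; rw [show x - q = p by omega]; omega
    have lf : ∀ q', 1 ≤ q' → q' < q → sC lam (x - 1) q' < y := by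
      intro q' b1 b2
      have : sC lam (x - 1) (q - 1) < y := by
        simp only [sC]; rw [show x - 1 - (q - 1) = p by omega]; omega
      rcases Nat.eq_or_lt_of_le (show q' ≤ q - 1 by omega) with h5 | h5
      · subst h5; exact this
      · have := sC_mono h.gt (x := x - 1) h5; omega
    refine ⟨?_, ?_, ?_⟩
    · rintro ⟨q', b1, b2, b3⟩
      rcases Nat.lt_or_ge q' q with h5 | h5
      · have := lf q' b1 h5; omega
      · have h6 := sC_down h.gt (x := x - 1) (q := q) (by omega)
        rw [show x - 1 + 1 = x by omega] at h6
        rcases Nat.eq_or_lt_of_le h5 with h5 | h5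
        · subst h5; omega
        · have := sC_mono h.gt (x := x - 1) h5; omega
    · rintro ⟨q', b1, b2, b3⟩
      have h5 : q' < q := by rw [← sC_lt h.gt (x := x)]; omega
      have := lf q' b1 h5
      have h6 := sC_down h.gt (x := x - 1) (q := q') (by omega)
      rw [show x - 1 + 1 = x by omega] at h6
      omega
    · rintro ⟨q', b1, b2, b3, b4⟩
      have h5 : q' < q := by rw [← sC_lt h.gt (x := x)]; omega
      have := lf q' b1 h5
      omega

theorem above_count (h : Desc g k w lam) (y : ℕ) : ∀ x, x ≤ k →
    ∃ m, m ≤ x ∧ (∀ q, 1 ≤ q → q ≤ x → (sC lam x q ≤ y ↔ q ≤ m)) ∧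
      ∀ I : DecidablePred (fun x' => HD k w lam x' y), ((Finset.Icc 1 x).filter (fun x' => HD k w lam x' y)).card = m := by
  intro x
  induction x with
  | zero => intro _; exact ⟨0, le_rfl, by intros; omega, by simp⟩
  | succ x ih =>
    intro hx
    obtain ⟨m, h1, h2, h3⟩ := ih (by omega)
    have hstep : ∀ q, 1 ≤ q → q ≤ m → sC lam (x + 1) q ≤ y := by
      intro q a b
      have := sC_down h.gt (x := x) (q := q) (by omega)
      have := (h2 q a (by omega)).2 b
      omega
    have hstep2 : ∀ q, 1 ≤ q → q ≤ x + 1 → m + 2 ≤ q → ¬ sC lam (x + 1) q ≤ y := by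
      intro q a b c
      have e1 := sC_up h.gt (x := x) (q := q - 1)
      rw [show q - 1 + 1 = q by omega] at e1
      have e2 := h2 (q - 1) (by omega) (by omega)
      omega
    have hcard : ∀ I : DecidablePred (fun x' => HD k w lam x' y), ((Finset.Icc 1 (x + 1)).filter (fun x' => HD k w lam x' y)).card
        = m + if HD k w lam (x + 1) y then 1 else 0 := by
      intro I
      rw [← h3 I, Finset.card_filter, Finset.card_filter, Finset.sum_Icc_succ_top (by omega)]
    by_cases hc : sC lam (x + 1) (m + 1) ≤ y
    · refine ⟨m + 1, by omega, ?_, ?_⟩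
      · intro q a b
        constructor
        · intro hh
          by_contra hq
          exact hstep2 q a b (by omega) hh
        · intro hh
          rcases Nat.eq_or_lt_of_le hh with e | e
          · subst e; exact hc
          · exact hstep q a (by omega)
      · intro I
        rw [hcard I, if_pos]
        rw [HDle hx]
        refine ⟨m + 1, by omega, by omega, hc, ?_⟩
        rcases Nat.eq_or_lt_of_le h1 with e | e
        · left; omega
        · right
          have := h2 (m + 1) (by omega) (by omega)
          simp; omega
    · refine ⟨m, by omega, ?_, ?_⟩
      · intro q a b
        constructor
        · intro hh
          by_contra hq
          rcases Nat.eq_or_lt_of_le (show m + 1 ≤ q by omega) with e | e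
          · subst e; exact hc hh
          · exact hstep2 q a b (by omega) hh
        · exact hstep q a
      · intro I
        rw [hcard I, if_neg, Nat.add_zero]
        rw [HDle hx]
        rintro ⟨q, a, b, c, d⟩
        have hq : q ≤ m := by
          by_contra hq
          rcases Nat.eq_or_lt_of_le (show m + 1 ≤ q by omega) with e | e
          · subst e; exact hc c
          · exact hstep2 q a b (by omega) c
        have := (h2 q a (by omega)).2 hq
        simp at d
        omega

theorem above (h : Desc g k w lam) {p c : ℕ} (hc : c < lam k p) :
    pipesAbove g (Tof lam p c) (Tof lam p c + c - p) + p + 1 = Tof lam p c := by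
  obtain ⟨h1, h2, h3, h4, h5⟩ := Tof_prop h.gt hc
  have hkn := h.kn
  generalize Tof lam p c = x at *
  have hyn : x + c - p ≤ g.n := by
    have := h.sCle h2 (q := x - p) (by omega) (by omega)
    simp only [sC] at this
    rw [show x - (x - p) = p by omega] at this
    omega
  obtain ⟨m, e1, e2, e3⟩ := h.above_count (x + c - p) (x - 1) (by omega)
  classical
  have hpa : pipesAbove g x (x + c - p) = m := by
    unfold pipesAbove
    rw [filter_range'_Icc, ← e3 (Classical.decPred _)]
    congr 1
    ext z
    simp only [Finset.mem_filter, Finset.mem_Icc, Bool.and_eq_true, decide_eq_true_eq]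
    constructor
    · rintro ⟨⟨a, b⟩, c1, d⟩
      rw [(h.real z _ a b (by omega) hyn).2.2.2.1] at d
      exact ⟨⟨a, by omega⟩, d⟩
    · rintro ⟨⟨a, b⟩, d⟩
      refine ⟨⟨a, by omega⟩, by omega, ?_⟩
      rw [(h.real z _ a (by omega) (by omega) hyn).2.2.2.1]
      exact d
  rw [hpa]
  have hs : ∀ q, 1 ≤ q → q ≤ x - 1 → (sC lam (x - 1) q ≤ x + c - p ↔ q ≤ x - p - 1) := by
    intro q a b
    constructor
    · intro hh
      by_contra hq
      have e4 := sC_down h.gt (x := x - 1) (q := x - p) (by omega)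
      rw [show x - 1 + 1 = x by omega] at e4
      have e5 : x + c - p < sC lam x (x - p) := by
        simp only [sC]; rw [show x - (x - p) = p by omega]; omega
      rcases Nat.eq_or_lt_of_le (show x - p ≤ q by omega) with e | e
      · subst e; omega
      · have := sC_mono h.gt (x := x - 1) e; omega
    · intro hh
      have e5 : sC lam (x - 1) (x - p - 1) < x + c - p := by
        simp only [sC]; rw [show x - 1 - (x - p - 1) = p by omega]; omega
      rcases Nat.eq_or_lt_of_le hh with e | e
      · subst e; omega
      · have := sC_mono h.gt (x := x - 1) e; omega
  have f1 := hs m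
  have f2 := e2 m
  have f3 := hs (x - p - 1)
  have f4 := e2 (x - p - 1)
  omega

end Desc

end

section

namespace Desc
variable {g : Grid} {k : ℕ} {w : Perm'} {lam : ℕ → ℕ → ℕ}

theorem yle (h : Desc g k w lam) {p c : ℕ} (hc : c < lam k p) : Tof lam p c + c - p ≤ g.n := by
  obtain ⟨h1, h2, h3, h4, h5⟩ := Tof_prop h.gt hc
  have hkn := h.kn
  generalize Tof lam p c = x at *
  have := h.sCle h2 (q := x - p) (by omega) (by omega)
  simp only [sC] at this
  rw [show x - (x - p) = p by omega] at this
  omega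

theorem blanks (h : Desc g k w lam) {A B : ℕ} (hAB : A = 0 ∨ B = 0) {M : ℕ}
    (hM : ∀ m, m < M ↔ B + m < lam k (A + m)) :
    blanksOnDiag g ((B : ℤ) - (A : ℤ)) = (List.range M).map
      (fun m => (Tof lam (A + m) (B + m), Tof lam (A + m) (B + m) + (B + m) - (A + m))) := by
  have hkn := h.kn
  have hirr : Std.Irrefl (fun a b : ℕ × ℕ => a.1 < b.1) := ⟨fun a => lt_irrefl _⟩
  have hant : Std.Antisymm (fun a b : ℕ × ℕ => a.1 < b.1) := ⟨fun a b h1 h2 => by omega⟩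
  refine List.Pairwise.eq_of_mem_iff (r := fun a b : ℕ × ℕ => a.1 < b.1) ?_ ?_ ?_
  · unfold blanksOnDiag
    refine List.Pairwise.filterMap _ ?_ List.pairwise_lt_range'
    intro a a' haa b hb b' hb'
    simp only at hb hb'
    split_ifs at hb with c1 c2
    split_ifs at hb' with c3 c4
    simp only [Option.some.injEq] at hb hb'
    subst hb; subst hb'
    exact haa
  · rw [List.pairwise_map]
    refine List.Pairwise.imp_of_mem ?_ List.pairwise_lt_range
    intro a b ha hb hab
    simp only [List.mem_range] at ha hb
    simp only
    clear ha
    induction b, hab using Nat.le_induction with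
    | base => exact Tof_diag h.gt ((hM _).1 hb)
    | succ b hab ih =>
      exact (ih (by omega)).trans (Tof_diag h.gt ((hM _).1 hb))
  · rintro ⟨i, j⟩
    simp only [blanksOnDiag, List.mem_filterMap, List.mem_map, List.mem_range, List.mem_range'_1]
    constructor
    · rintro ⟨x, hx, hh⟩
      split_ifs at hh with c1 c2
      simp only [Option.some.injEq, Prod.mk.injEq] at hh
      obtain ⟨rfl, rfl⟩ := hh
      have hxk : x ≤ k := by
        by_contra hc
        exact h.blank_gt (by omega) (by omega) (by omega) (by omega) c2
      rw [h.blank_iff (by omega) hxk (by omega) (by omega)] at c2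
      obtain ⟨p, c, a1, a2, a3, a4⟩ := c2
      have hpA : p = A + (p - A) ∧ c = B + (p - A) := by omega
      refine ⟨p - A, ?_, ?_⟩
      · rw [hM, ← hpA.1, ← hpA.2]
        exact lt_of_lt_of_le a4 (h.gt.mono hxk p)
      · rw [← hpA.1, ← hpA.2, Tof_eq h.gt (by omega) a3 a4]
        simp only [Prod.mk.injEq, true_and]
        omega
    · rintro ⟨m, hm, he⟩
      simp only [Prod.mk.injEq] at he
      have hc := (hM m).1 hm
      have hy := h.yle hc
      obtain ⟨h1, h2, h3, h4, h5⟩ := Tof_prop h.gt hc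
      obtain ⟨e1, e2⟩ := he
      generalize Tof lam (A + m) (B + m) = x at *
      subst e1
      clear hirr hant
      have hj : ((x : ℤ) + ((B : ℤ) - (A : ℤ))).toNat = j := by omega
      refine ⟨x, by omega, ?_⟩
      rw [if_pos (by omega), hj, if_pos]
      rw [h.blank_iff h1 h2 (by omega) (by omega)]
      exact ⟨A + m, B + m, h5, by omega, h4, h3⟩

theorem diag_entry (h : Desc g k w lam) {p c : ℕ} (hc : c < lam k p) :
    (blanksOnDiag g (((c + 1 : ℕ) : ℤ) - ((p + 1 : ℕ) : ℤ))).getD (min (p + 1) (c + 1) - 1) (0, 0)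
      = (Tof lam p c, Tof lam p c + c - p) := by
  obtain ⟨A, hA⟩ : ∃ A, A = p - min p c := ⟨_, rfl⟩
  obtain ⟨B, hB⟩ : ∃ B, B = c - min p c := ⟨_, rfl⟩
  have hp := h.gt.part k
  obtain ⟨M, -, hM⟩ := R_exists (μ := fun m => lam k (A + m) - (B + m)) (k := k)
    (by
      intro m
      have := hp.anti (show A + m ≤ A + (m + 1) by omega)
      show lam k (A + (m + 1)) - (B + (m + 1)) ≤ lam k (A + m) - (B + m); omega)
    (by rw [h.gt.zero k _ (by omega)]; omega)
  have hM' : ∀ m, m < M ↔ B + m < lam k (A + m) := by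
    intro m
    rw [hM m]; omega
  rw [show (((c + 1 : ℕ) : ℤ) - ((p + 1 : ℕ) : ℤ)) = (B : ℤ) - (A : ℤ) by omega,
    h.blanks (by omega) hM', show min (p + 1) (c + 1) - 1 = min p c by omega]
  have hpm : A + min p c = p := by omega
  have hcm : B + min p c = c := by omega
  have hm : min p c < M := by rw [hM', hpm, hcm]; exact hc
  rw [List.getD_eq_getElem _ _ (by simpa using hm)]
  simp only [List.getElem_map, List.getElem_range, hpm, hcm]

theorem weigandt_eq (h : Desc g k w lam) {R : ℕ} (hRk : R ≤ k) (hR : ∀ p, p < R ↔ 0 < lam k p) :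
    weigandt g (shapeOf w g.n) = (List.range R).map (fun p => (List.range (lam k p)).map (Tof lam p)) := by
  rw [h.shape hRk hR]
  unfold weigandt
  simp only [List.length_map, List.length_range]
  apply List.map_congr_left
  intro p hp
  rw [List.mem_range] at hp
  rw [List.getD_eq_getElem _ _ (by simpa using hp)]
  simp only [List.getElem_map, List.getElem_range]
  apply List.map_congr_left
  intro c hc
  rw [List.mem_range] at hc
  rw [h.diag_entry hc]
  have := h.above hc
  simp only
  omega

theorem ssyt (h : Desc g k w lam) {R : ℕ} (hR : ∀ p, p < R ↔ 0 < lam k p) :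
    IsSSYTBounded k ((List.range R).map (fun p => (List.range (lam k p)).map (Tof lam p))) := by
  refine ⟨⟨?_, ?_, ?_, ?_⟩, ?_⟩
  · intro row hrow
    simp only [List.mem_map, List.mem_range] at hrow
    obtain ⟨p, hp, rfl⟩ := hrow
    have := (hR p).1 hp
    intro h0
    have := congrArg List.length h0
    simp at this; omega
  · apply List.Pairwise.isChain
    rw [List.pairwise_map]
    refine List.Pairwise.imp ?_ List.pairwise_lt_range
    intro a b hab
    simp only [List.length_map, List.length_range]
    exact (h.gt.part k).anti hab.le
  · intro row hrow
    simp only [List.mem_map, List.mem_range] at hrow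
    obtain ⟨p, hp, rfl⟩ := hrow
    apply List.Pairwise.isChain
    rw [List.pairwise_map]
    refine List.Pairwise.imp_of_mem ?_ List.pairwise_lt_range
    intro a b ha hb hab
    rw [List.mem_range] at ha hb
    have := Tof_prop h.gt hb
    exact Nat.sInf_le (show a < lam (Tof lam p b) p by omega)
  · intro i j hi hj
    simp only [List.length_map, List.length_range] at hi
    rw [List.getD_eq_getElem (l := (List.range R).map _) (n := i + 1) _ (by simpa using hi)] at hj ⊢
    rw [List.getD_eq_getElem (l := (List.range R).map _) (n := i) _ (by simp; omega)]
    simp only [List.getElem_map, List.getElem_range, List.length_map, List.length_range] at hj ⊢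
    have hij : j < lam k i := lt_of_lt_of_le hj ((h.gt.part k).anti (by omega))
    rw [List.getD_eq_getElem _ _ (by simpa using hij), List.getD_eq_getElem _ _ (by simpa using hj)]
    simp only [List.getElem_map, List.getElem_range]
    obtain ⟨h1, h2, h3, h4, h5⟩ := Tof_prop h.gt hj
    have h6 := (h.gt.2 (Tof lam (i + 1) j - 1) i).2
    rw [show Tof lam (i + 1) j - 1 + 1 = Tof lam (i + 1) j by omega] at h6
    have : Tof lam i j ≤ Tof lam (i + 1) j - 1 :=
      Nat.sInf_le (show j < lam (Tof lam (i + 1) j - 1) i by omega)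
    omega
  · intro row hrow x hx
    simp only [List.mem_map, List.mem_range] at hrow
    obtain ⟨p, hp, rfl⟩ := hrow
    simp only [List.mem_map, List.mem_range] at hx
    obtain ⟨c, hc, rfl⟩ := hx
    exact (Tof_prop h.gt hc).2.1

/-- everything from the description -/
theorem final (h : Desc g k w lam) :
    Qtilde (phi g) = weigandt g (shapeOf w g.n) ∧ IsCompatible w (phi g) ∧
    IsSSYTBounded k (weigandt g (shapeOf w g.n)) := by
  obtain ⟨R, hRk, hR⟩ := R_exists (h.gt.part k) (h.gt.zero k k le_rfl)
  have hnw := phiAux_NW (k := k) (crossCount g) g w lam h h.cross_count.symm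
  rw [h.weigandt_eq hRk hR]
  refine ⟨?_, hnw.compat h.gt h.gr, h.ssyt hR⟩
  obtain ⟨l1, l2, l3⟩ := Lof_all h.gt (Tof lam) (Tof_spec h.gt) k
  unfold Qtilde egPQ phi
  simp only
  rw [← List.zip_of_prod (xs := phiAux (crossCount g) g) rfl rfl]
  rw [Q_main k (Lof lam k) _ (Tof lam) R l2 (hnw.isWordOf h.gt) l3 (by rw [l1]; exact hR), l1]

end Desc

end

section

/-- states reachable by following a pipe forward -/
inductive Rch (g : Grid) (c : ℕ) : ℕ → ℕ → Dir → Prop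
  | start : Rch g c g.n c Dir.north
  | north {x y d} : Rch g c x y d → outDir (g.tile x y) d = some Dir.north → 1 < x →
      Rch g c (x - 1) y Dir.north
  | east {x y d} : Rch g c x y d → outDir (g.tile x y) d = some Dir.east → y < g.n →
      Rch g c x (y + 1) Dir.east

theorem trace_north {g : Grid} {f x y d r} (h : traceAux g f x y d = some r)
    (ho : outDir (g.tile x y) d = some Dir.north) : ∃ f', f = f' + 1 ∧ 1 < x ∧
      traceAux g f' (x - 1) y Dir.north = some r := by
  cases f with
  | zero => simp [traceAux] at h
  | succ f =>
    refine ⟨f, rfl, ?_⟩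
    simp only [traceAux, ho] at h
    split_ifs at h with h1
    exact ⟨by omega, h⟩

theorem trace_east {g : Grid} {f x y d r} (h : traceAux g f x y d = some r)
    (ho : outDir (g.tile x y) d = some Dir.east) : ∃ f', f = f' + 1 ∧
      ((g.n ≤ y ∧ r = x) ∨ (y < g.n ∧ traceAux g f' x (y + 1) Dir.east = some r)) := by
  cases f with
  | zero => simp [traceAux] at h
  | succ f =>
    refine ⟨f, rfl, ?_⟩
    simp only [traceAux, ho] at h
    split_ifs at h with h1
    · left; simp at h; exact ⟨h1, h.symm⟩
    · right; exact ⟨by omega, h⟩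

theorem trace_out {g : Grid} {f x y d r} (h : traceAux g f x y d = some r) :
    ∃ d', outDir (g.tile x y) d = some d' := by
  cases f with
  | zero => simp [traceAux] at h
  | succ f =>
    simp only [traceAux] at h
    cases ho : outDir (g.tile x y) d with
    | none => simp [ho] at h
    | some d' => exact ⟨d', rfl⟩

theorem trace_le {g : Grid} : ∀ {f x y d r}, traceAux g f x y d = some r → r ≤ x := by
  intro f
  induction f with
  | zero => intro x y d r h; simp [traceAux] at h
  | succ f ih =>
    intro x y d r h
    obtain ⟨d', hd⟩ := trace_out h
    cases d' with
    | north =>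
      obtain ⟨f', e, _, h2⟩ := trace_north h hd
      obtain rfl : f = f' := by omega
      have := ih h2; omega
    | east =>
      obtain ⟨f', e, h2⟩ := trace_east h hd
      obtain rfl : f = f' := by omega
      rcases h2 with h2 | h2
      · omega
      · exact ih h2.2

theorem trace_unique {g : Grid} : ∀ {f f' x y d r r'}, traceAux g f x y d = some r →
    traceAux g f' x y d = some r' → r = r' := by
  intro f
  induction f with
  | zero => intro f' x y d r r' h; simp [traceAux] at h
  | succ f ih =>
    intro f' x y d r r' h h'
    obtain ⟨d', hd⟩ := trace_out h
    cases d' with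
    | north =>
      obtain ⟨f1, e, _, h2⟩ := trace_north h hd
      obtain rfl : f = f1 := by omega
      obtain ⟨f2, e', _, h2'⟩ := trace_north h' hd
      exact ih h2 h2'
    | east =>
      obtain ⟨f1, e, h2⟩ := trace_east h hd
      obtain rfl : f = f1 := by omega
      obtain ⟨f2, e', h2'⟩ := trace_east h' hd
      rcases h2 with h2 | h2 <;> rcases h2' with h2' | h2'
      · omega
      · omega
      · omega
      · exact ih h2.2 h2'.2

theorem Rch.spec {g : Grid} {c r : ℕ} (he : exitRow g c = some r) {x y d} (h : Rch g c x y d) :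
    ∃ f, traceAux g f x y d = some r ∧ ∀ t ∈ pathAux g f x y d, t ∈ pipePath g c := by
  induction h with
  | start => exact ⟨_, he, fun t ht => ht⟩
  | north h1 h2 h3 ih =>
    obtain ⟨f, a, b⟩ := ih
    obtain ⟨f', rfl, e, e'⟩ := trace_north a h2
    refine ⟨f', e', fun t ht => b t ?_⟩
    simp only [pathAux, h2]
    rw [if_neg (by omega)]
    exact List.mem_cons_of_mem _ ht
  | east h1 h2 h3 ih =>
    obtain ⟨f, a, b⟩ := ih
    obtain ⟨f', rfl, e⟩ := trace_east a h2
    refine ⟨f', ?_, fun t ht => b t ?_⟩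
    · rcases e with e | e
      · omega
      · exact e.2
    · simp only [pathAux, h2]
      rw [if_neg (by omega)]
      exact List.mem_cons_of_mem _ ht

theorem Rch.trace {g : Grid} {c r : ℕ} (he : exitRow g c = some r) {x y d} (h : Rch g c x y d) :
    ∃ f, traceAux g f x y d = some r := by
  obtain ⟨f, a, _⟩ := h.spec he
  exact ⟨f, a⟩

theorem Rch.le {g : Grid} {c r : ℕ} (he : exitRow g c = some r) {x y d} (h : Rch g c x y d) : r ≤ x := by
  obtain ⟨f, a⟩ := h.trace he
  exact trace_le a

theorem Rch.passes {g : Grid} {c r : ℕ} (he : exitRow g c = some r) {x y d} (h : Rch g c x y d) :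
    passes g c (x, y) := by
  obtain ⟨f, a, b⟩ := h.spec he
  refine ⟨d, b _ ?_⟩
  cases f with
  | zero => simp [traceAux] at a
  | succ f => simp [pathAux]

/-- how a pipe leaves a column -/
theorem Rch.column {g : Grid} {c r : ℕ} : ∀ {f x y d}, Rch g c x y d → traceAux g f x y d = some r →
    ∃ x', x' ≤ x ∧ (∀ z, x' ≤ z → z ≤ x → ∃ d', Rch g c z y d') ∧
      ((g.n ≤ y ∧ r = x') ∨ (y < g.n ∧ Rch g c x' (y + 1) Dir.east)) := by
  intro f
  induction f with
  | zero => intro x y d _ h; simp [traceAux] at h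
  | succ f ih =>
    intro x y d hr h
    obtain ⟨d', hd⟩ := trace_out h
    cases d' with
    | north =>
      obtain ⟨f', e, hx, h2⟩ := trace_north h hd
      obtain rfl : f = f' := by omega
      obtain ⟨x', a, b, c1⟩ := ih (hr.north hd hx) h2
      refine ⟨x', by omega, ?_, c1⟩
      intro z hz hz'
      rcases Nat.eq_or_lt_of_le hz' with rfl | h3
      · exact ⟨d, hr⟩
      · exact b z hz (by omega)
    | east =>
      obtain ⟨f', e, h2⟩ := trace_east h hd
      refine ⟨x, le_rfl, ?_, ?_⟩
      · intro z hz hz'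
        obtain rfl : z = x := by omega
        exact ⟨d, hr⟩
      · rcases h2 with h2 | h2
        · left; exact h2
        · right; exact ⟨h2.1, hr.east hd h2.1⟩

/-- two pipes in the wrong order must meet again -/
theorem Rch.meet {g : Grid} {c c' r r' : ℕ} (he : exitRow g c = some r) (he' : exitRow g c' = some r')
    (hrr : r' < r) : ∀ N y, g.n = y + N → ∀ {x x' d d'}, Rch g c x y d → Rch g c' x' y d' → x < x' →
      ∃ z u d1 d2, y ≤ u ∧ Rch g c z u d1 ∧ Rch g c' z u d2 := by
  intro N
  induction N with
  | zero =>
    intro y hy x x' d d' h h' hx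
    obtain ⟨f, t⟩ := h.trace he
    obtain ⟨f', t'⟩ := h'.trace he'
    obtain ⟨x1, a, b, e⟩ := h.column t
    obtain ⟨x1', a', b', e'⟩ := h'.column t'
    obtain ⟨d1, h1⟩ := b x1 (by omega) (by omega)
    obtain ⟨d2, h2⟩ := b' x1 (by omega) (by omega)
    exact ⟨x1, y, d1, d2, le_rfl, h1, h2⟩
  | succ N ih =>
    intro y hy x x' d d' h h' hx
    obtain ⟨f, t⟩ := h.trace he
    obtain ⟨f', t'⟩ := h'.trace he'
    obtain ⟨x1, a, b, e⟩ := h.column t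
    obtain ⟨x1', a', b', e'⟩ := h'.column t'
    by_cases hc : x1' ≤ x1
    · obtain ⟨d1, h1⟩ := b x1 (by omega) (by omega)
      obtain ⟨d2, h2⟩ := b' x1 (by omega) (by omega)
      exact ⟨x1, y, d1, d2, le_rfl, h1, h2⟩
    · rcases e with e | e
      · omega
      · rcases e' with e' | e'
        · omega
        · obtain ⟨z, u, d1, d2, hu, h1, h2⟩ := ih (y + 1) (by omega) e.2 e'.2 (by omega)
          exact ⟨z, u, d1, d2, by omega, h1, h2⟩

theorem IsBPD.nobump {g : Grid} (h : IsBPD g) (x y : ℕ) : g.tile x y ≠ Tile.bump := by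
  by_cases hi : InGrid g x y
  · exact h.2.2.1 x y hi
  · rw [h.2.1 x y hi]; simp

theorem two_states_cross {t : Tile} {d1 d2 e1 e2 : Dir} (hb : t ≠ Tile.bump) (hd : d1 ≠ d2)
    (h1 : outDir t d1 = some e1) (h2 : outDir t d2 = some e2) : t = Tile.cross := by
  cases t <;> cases d1 <;> cases d2 <;> simp_all [outDir]

/-- the vertical pipe at a crossing exits above the horizontal one, for a left/right pair in order -/
theorem no_bad_cross {g : Grid} (hg : IsBPD g) {c c' r r' x y : ℕ} (hc : 1 ≤ c) (hcn : c ≤ g.n)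
    (hc' : 1 ≤ c') (hcn' : c' ≤ g.n) (he : exitRow g c = some r) (he' : exitRow g c' = some r')
    (hrr : r' < r) (hV : Rch g c x y Dir.north) (hH : Rch g c' x y Dir.east) :
    g.tile x y ≠ Tile.cross := by
  intro ht
  have ho : outDir (g.tile x y) Dir.north = some Dir.north := by rw [ht]; rfl
  have ho' : outDir (g.tile x y) Dir.east = some Dir.east := by rw [ht]; rfl
  obtain ⟨f, t⟩ := hV.trace he
  obtain ⟨f', t'⟩ := hH.trace he'
  obtain ⟨f1, _, hx, _⟩ := trace_north t ho
  have hV1 := hV.north ho hx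
  have hle := hV1.le he
  obtain ⟨f2, _, hh⟩ := trace_east t' ho'
  rcases hh with hh | hh
  · omega
  have hH1 := hH.east ho' hh.1
  obtain ⟨f3, t3⟩ := hV1.trace he
  obtain ⟨x1, a, b, e⟩ := hV1.column t3
  rcases e with e | e
  · omega
  obtain ⟨z, u, d1, d2, hu, h1, h2⟩ := Rch.meet he he' hrr (g.n - (y + 1)) (y + 1) (by omega) e.2 hH1 (by omega)
  have hcc : c ≠ c' := by
    rintro rfl
    rw [he] at he'
    simp at he'; omega
  have hsub := hg.2.2.2.2.2.2.2.2.2 c c' hc hcn hc' hcn' hcc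
  obtain ⟨f4, t4⟩ := h1.trace he
  obtain ⟨f5, t5⟩ := h2.trace he'
  have hzu : g.tile z u = Tile.cross := by
    obtain ⟨e1, o1⟩ := trace_out t4
    obtain ⟨e2, o2⟩ := trace_out t5
    refine two_states_cross (hg.nobump z u) ?_ o1 o2
    rintro rfl
    have := trace_unique t4 t5
    omega
  have := @hsub (x, y) ⟨ht, hV.passes he, hH.passes he'⟩ (z, u) ⟨hzu, h1.passes he, h2.passes he'⟩
  simp only [Prod.mk.injEq] at this
  omega

end

section

def Vb (g : Grid) (x y : ℕ) : Prop := 1 ≤ x ∧ hasS (g.tile x y) = true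
def Hb (g : Grid) (x y : ℕ) : Prop := 1 ≤ y ∧ hasE (g.tile x y) = true

theorem IsBPD.hasN_iff {g : Grid} (h : IsBPD g) {x y : ℕ} (h1 : 1 ≤ x) (h2 : x ≤ g.n) (h3 : 1 ≤ y) (h4 : y ≤ g.n) :
    hasN (g.tile x y) = true ↔ Vb g (x - 1) y := by
  obtain ⟨_, _, _, a, b, c, d, e, f, _⟩ := h
  unfold Vb
  rcases Nat.eq_or_lt_of_le h1 with rfl | h5
  · simp [c y h3 h4]
  · have := a (x - 1) y (by omega) (by omega) h3 h4
    rw [show x - 1 + 1 = x by omega] at this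
    rw [← this]
    constructor
    · intro hh; exact ⟨by omega, hh⟩
    · intro hh; exact hh.2

theorem IsBPD.hasW_iff {g : Grid} (h : IsBPD g) {x y : ℕ} (h1 : 1 ≤ x) (h2 : x ≤ g.n) (h3 : 1 ≤ y) (h4 : y ≤ g.n) :
    hasW (g.tile x y) = true ↔ Hb g x (y - 1) := by
  obtain ⟨_, _, _, a, b, c, d, e, f, _⟩ := h
  unfold Hb
  rcases Nat.eq_or_lt_of_le h3 with rfl | h5
  · simp [e x h1 h2]
  · have := b x (y - 1) (by omega) (by omega) (by omega) (by omega)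
    rw [show y - 1 + 1 = y by omega] at this
    rw [← this]
    constructor
    · intro hh; exact ⟨by omega, hh⟩
    · intro hh; exact hh.2

/-- local structure of a tile -/
theorem IsBPD.loc {g : Grid} (h : IsBPD g) {x y : ℕ} (h1 : 1 ≤ x) (h2 : x ≤ g.n) (h3 : 1 ≤ y) (h4 : y ≤ g.n) :
    (g.tile x y = Tile.cross ∧ Vb g (x - 1) y ∧ Vb g x y ∧ Hb g x (y - 1) ∧ Hb g x y) ∨
    (g.tile x y = Tile.blank ∧ ¬ Vb g (x - 1) y ∧ ¬ Vb g x y ∧ ¬ Hb g x (y - 1) ∧ ¬ Hb g x y) ∨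
    (g.tile x y = Tile.vert ∧ Vb g (x - 1) y ∧ Vb g x y ∧ ¬ Hb g x (y - 1) ∧ ¬ Hb g x y) ∨
    (g.tile x y = Tile.horiz ∧ ¬ Vb g (x - 1) y ∧ ¬ Vb g x y ∧ Hb g x (y - 1) ∧ Hb g x y) ∨
    (g.tile x y = Tile.se ∧ ¬ Vb g (x - 1) y ∧ Vb g x y ∧ ¬ Hb g x (y - 1) ∧ Hb g x y) ∨
    (g.tile x y = Tile.nw ∧ Vb g (x - 1) y ∧ ¬ Vb g x y ∧ Hb g x (y - 1) ∧ ¬ Hb g x y) := by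
  have hb := h.nobump x y
  rw [← h.hasN_iff h1 h2 h3 h4, ← h.hasW_iff h1 h2 h3 h4]
  have e1 : Vb g x y ↔ hasS (g.tile x y) = true := by simp [Vb, h1]
  have e2 : Hb g x y ↔ hasE (g.tile x y) = true := by simp [Hb, h3]
  rw [e1, e2]
  cases hT : g.tile x y <;> simp_all [hasN, hasS, hasE, hasW]

theorem mem_wle {w : Perm'} {g : Grid} (hB : MemBPD w g) {x : ℕ} (hx : x ≤ g.n) : w x ≤ g.n := by
  by_contra hc
  have := hB.2.2.1 (w x) (by omega)
  have := w.injective this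
  omega

theorem mem_wpos {w : Perm'} {g : Grid} (hB : MemBPD w g) {x : ℕ} (hx : 1 ≤ x) : 1 ≤ w x := by
  by_contra hc
  have : w x = w 0 := by rw [hB.2.1]; omega
  have := w.injective this
  omega

theorem mem_exit {w : Perm'} {g : Grid} (hB : MemBPD w g) {x : ℕ} (hx : 1 ≤ x) (hn : x ≤ g.n) : exitRow g (w x) = some x := by
  have := hB.2.2.2 (w x) (mem_wpos hB hx) (mem_wle hB hn)
  simpa using this

set_option maxHeartbeats 1000000 in
/-- one row below the descent -/
theorem row_gt {w : Perm'} {g : Grid} (hB : MemBPD w g) {x : ℕ} (h1 : 1 ≤ x) (hn : x ≤ g.n) (hinc : ∀ z, x < z → w x < w z)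
    (hV : ∀ y, 1 ≤ y → y ≤ g.n → (Vb g x y ↔ w.symm y ≤ x))
    (hS : ∀ y, 1 ≤ y → y ≤ g.n → w.symm y ≤ x → Rch g y x y Dir.north) :
    (∀ y, 1 ≤ y → y ≤ g.n → (Hb g x y ↔ w x ≤ y)) ∧
    (∀ y, 1 ≤ y → y ≤ g.n → (Vb g (x - 1) y ↔ w.symm y ≤ x - 1)) ∧
    (∀ y, 1 ≤ y → y ≤ g.n → w.symm y ≤ x - 1 → Rch g y (x - 1) y Dir.north) := by
  have hg := hB.1
  have hc1 := mem_wpos hB h1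
  have hcn := mem_wle hB hn
  have hex := mem_exit hB h1 hn
  have hspos : ∀ y, 1 ≤ y → 1 ≤ w.symm y := by
    intro y hy
    by_contra hc
    have h3 : w (w.symm y) = y := by simp
    rw [show w.symm y = 0 by omega, hB.2.1] at h3
    omega
  have hRc : Rch g (w x) x (w x) Dir.north := hS _ hc1 hcn (by simp)
  have hVc : Vb g x (w x) := (hV _ hc1 hcn).2 (by simp)
  have hnoN : ∀ y d, Rch g (w x) x y d → outDir (g.tile x y) d ≠ some Dir.north := by
    intro y d hr ho
    obtain ⟨f, t⟩ := hr.trace hex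
    obtain ⟨f', _, hx, _⟩ := trace_north t ho
    have := (hr.north ho hx).le hex
    omega
  have hVne : ∀ y, 1 ≤ y → y ≤ g.n → ¬ Vb g x y → w x < y := by
    intro y hy hyn hv
    rw [hV y hy hyn] at hv
    have := hinc (w.symm y) (by omega)
    simpa using this
  -- left part
  have hLc : ¬ Hb g x (w x - 1) := by
    intro hh
    rcases hg.loc h1 hn hc1 hcn with l | l | l | l | l | l
    · exact hnoN _ _ hRc (by rw [l.1]; rfl)
    all_goals tauto
  have hL : ∀ j, j < w x → ¬ Hb g x (w x - 1 - j) := by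
    intro j
    induction j with
    | zero => intro _; exact hLc
    | succ j ih =>
      intro hj hh
      have hy1 : 1 ≤ w x - 1 - (j + 1) := hh.1
      refine ih (by omega) ?_
      rcases hg.loc h1 hn (y := w x - 1 - j) (by omega) (by omega) with l | l | l | l | l | l
      · exact l.2.2.2.2
      · rw [show w x - 1 - j - 1 = w x - 1 - (j + 1) by omega] at l; tauto
      · rw [show w x - 1 - j - 1 = w x - 1 - (j + 1) by omega] at l; tauto
      · exact l.2.2.2.2
      · exact l.2.2.2.2
      · have := hVne (w x - 1 - j) (by omega) (by omega) l.2.2.1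
        omega
  have hL' : ∀ y, y < w x → ¬ Hb g x y := by
    intro y hy
    have := hL (w x - 1 - y) (by omega)
    rwa [show w x - 1 - (w x - 1 - y) = y by omega] at this
  -- the pipe itself
  have hse : g.tile x (w x) = Tile.se := by
    rcases hg.loc h1 hn hc1 hcn with l | l | l | l | l | l
    · exact absurd l.2.2.2.1 hLc
    · tauto
    · exact absurd (by rw [l.1]; rfl) (hnoN _ _ hRc)
    · tauto
    · exact l.1
    · tauto
  have hR : ∀ y, w x ≤ y → y ≤ g.n → Hb g x y ∧ (y < g.n → Rch g (w x) x (y + 1) Dir.east) := by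
    intro y hy
    induction y, hy using Nat.le_induction with
    | base =>
      intro _
      refine ⟨⟨hc1, by rw [hse]; rfl⟩, fun hlt => hRc.east (by rw [hse]; rfl) hlt⟩
    | succ y hy ih =>
      intro hyn
      obtain ⟨a, b⟩ := ih (by omega)
      have b := b (by omega)
      rcases hg.loc h1 hn (y := y + 1) (by omega) hyn with l | l | l | l | l | l
      · exact ⟨l.2.2.2.2, fun hlt => b.east (by rw [l.1]; rfl) hlt⟩
      · simp at l; tauto
      · simp at l; tauto
      · exact ⟨l.2.2.2.2, fun hlt => b.east (by rw [l.1]; rfl) hlt⟩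
      · simp at l; tauto
      · exact absurd (by rw [l.1]; rfl) (hnoN _ _ b)
  have hVV : ∀ y, 1 ≤ y → y ≤ g.n → (Vb g (x - 1) y ↔ Vb g x y ∧ y ≠ w x) := by
    intro y h3 h4
    have a1 := hL' y
    have a2 := hL' (y - 1)
    have a3 := hR y
    have a4 := hR (y - 1)
    rcases Nat.lt_trichotomy y (w x) with h5 | h5 | h5
    · have a1 := a1 h5
      have a2 := a2 (by omega)
      have : y ≠ w x := by omega
      rcases hg.loc h1 hn h3 h4 with l | l | l | l | l | l <;> tauto
    · have a5 : ¬ Vb g (x - 1) y := by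
        rw [h5]
        intro hv
        rw [← hg.hasN_iff h1 hn hc1 hcn, hse] at hv
        exact absurd hv (by decide)
      exact ⟨fun h => absurd h a5, fun h => absurd h5 h.2⟩
    · have a3 := (a3 (by omega) h4).1
      have a4 := (a4 (by omega) (by omega)).1
      have : y ≠ w x := by omega
      rcases hg.loc h1 hn h3 h4 with l | l | l | l | l | l <;> tauto
  have hV1 : ∀ y, 1 ≤ y → y ≤ g.n → (Vb g (x - 1) y ↔ w.symm y ≤ x - 1) := by
    intro y h3 h4
    rw [hVV y h3 h4, hV y h3 h4]
    have : y = w x ↔ w.symm y = x := by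
      constructor
      · rintro rfl; simp
      · intro h; rw [← h]; simp
    rw [Ne, this]; omega
  refine ⟨?_, hV1, ?_⟩
  · intro y h3 h4
    constructor
    · intro hh
      by_contra hc
      exact hL' y (by omega) hh
    · intro hh; exact (hR y hh h4).1
  · intro y h3 h4 h5
    have b1 := (hV1 y h3 h4).2 h5
    have b2 := ((hVV y h3 h4).1 b1).1
    have b3 := hS y h3 h4 (by omega)
    have hx : 1 < x := by have := hspos y h3; omega
    refine b3.north ?_ hx
    rcases hg.loc h1 hn h3 h4 with l | l | l | l | l | l
    · rw [l.1]; rfl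
    · tauto
    · rw [l.1]; rfl
    all_goals tauto

theorem rows_gt {w : Perm'} {g : Grid} (hB : MemBPD w g) {k : ℕ} (hk : k < g.n) (hinc : ∀ x z, k < x → x < z → w x < w z) : ∀ m, m ≤ g.n - k →
    (∀ y, 1 ≤ y → y ≤ g.n → (Vb g (g.n - m) y ↔ w.symm y ≤ g.n - m)) ∧
    (∀ y, 1 ≤ y → y ≤ g.n → w.symm y ≤ g.n - m → Rch g y (g.n - m) y Dir.north) := by
  intro m
  induction m with
  | zero =>
    intro _
    refine ⟨?_, ?_⟩
    · intro y h1 h2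
      have : w.symm y ≤ g.n := by
        by_contra hc
        have := hB.2.2.1 (w.symm y) (by omega)
        simp at this
        omega
      simp only [Nat.sub_zero, this, iff_true]
      exact ⟨by omega, hB.1.2.2.2.2.2.2.1 y h1 h2⟩
    · intro y _ _ _
      exact Rch.start
  | succ m ih =>
    intro hm
    obtain ⟨a, b⟩ := ih (by omega)
    have := row_gt hB (x := g.n - m) (by omega) (by omega) (fun z hz => hinc _ z (by omega) hz) a b
    rw [show g.n - m - 1 = g.n - (m + 1) by omega] at this
    exact this.2

theorem rows_gt' {w : Perm'} {g : Grid} (hB : MemBPD w g) {k : ℕ} (hk : k < g.n) (hinc : ∀ x z, k < x → x < z → w x < w z) {x : ℕ} (h1 : k ≤ x)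
    (h2 : x ≤ g.n) :
    (∀ y, 1 ≤ y → y ≤ g.n → (Vb g x y ↔ w.symm y ≤ x)) ∧
    (∀ y, 1 ≤ y → y ≤ g.n → w.symm y ≤ x → Rch g y x y Dir.north) ∧
    (k < x → ∀ y, 1 ≤ y → y ≤ g.n → (Hb g x y ↔ w x ≤ y)) := by
  have := rows_gt hB hk hinc (g.n - x) (by omega)
  rw [show g.n - (g.n - x) = x by omega] at this
  refine ⟨this.1, this.2, fun hkx => ?_⟩
  exact (row_gt hB (x := x) (by omega) h2 (fun z hz => hinc _ z hkx hz) this.1 this.2).1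

end

section

structure Inv (g : Grid) (w : Perm') (x : ℕ) (f : ℕ → ℕ) : Prop where
  mono : ∀ q q', 1 ≤ q → q < q' → q' ≤ x → f q < f q'
  pos : ∀ q, 1 ≤ q → q ≤ x → 1 ≤ f q
  le : ∀ q, 1 ≤ q → q ≤ x → f q ≤ g.n
  rch : ∀ q, 1 ≤ q → q ≤ x → Rch g (w q) x (f q) Dir.north
  iff : ∀ y, 1 ≤ y → y ≤ g.n → (Vb g x y ↔ ∃ q, 1 ≤ q ∧ q ≤ x ∧ f q = y)

def Link (g : Grid) (x : ℕ) (f f' : ℕ → ℕ) : Prop :=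
  (∀ q, 1 ≤ q → q < x → f q ≤ f' q ∧ f' q < f (q + 1)) ∧
  ∀ y, 1 ≤ y → y ≤ g.n → (Hb g x y ↔ ∃ q, 1 ≤ q ∧ q ≤ x ∧ f q ≤ y ∧ (q = x ∨ y < f' q))

set_option maxHeartbeats 1000000 in
theorem row_le {w : Perm'} {g : Grid} (hB : MemBPD w g) {x : ℕ} {f : ℕ → ℕ} (h1 : 1 ≤ x) (hn : x ≤ g.n)
    (hf : Inv g w x f) : ∃ f', Inv g w (x - 1) f' ∧ Link g x f f' := by
  have hg := hB.1
  -- horizontal edges come from pipes on the left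
  have hT : ∀ y, y ≤ g.n → Hb g x y → ∃ q, 1 ≤ q ∧ q ≤ x ∧ f q ≤ y ∧ (∀ y', f q ≤ y' → y' ≤ y → Hb g x y') ∧
      (y < g.n → Rch g (w q) x (y + 1) Dir.east) := by
    intro y
    induction y with
    | zero => intro _ hh; exact absurd hh.1 (by omega)
    | succ y ih =>
      intro hy hh
      rcases hg.loc h1 hn (y := y + 1) (by omega) hy with l | l | l | l | l | l
      · obtain ⟨q, a, b, c, d, e⟩ := ih (by omega) l.2.2.2.1
        refine ⟨q, a, b, by omega, ?_, fun hlt => (e (by omega)).east (by rw [l.1]; rfl) hlt⟩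
        intro y' h2 h3
        rcases Nat.eq_or_lt_of_le h3 with rfl | h4
        · exact hh
        · exact d y' h2 (by omega)
      · exact absurd hh l.2.2.2.2
      · exact absurd hh l.2.2.2.2
      · obtain ⟨q, a, b, c, d, e⟩ := ih (by omega) l.2.2.2.1
        refine ⟨q, a, b, by omega, ?_, fun hlt => (e (by omega)).east (by rw [l.1]; rfl) hlt⟩
        intro y' h2 h3
        rcases Nat.eq_or_lt_of_le h3 with rfl | h4
        · exact hh
        · exact d y' h2 (by omega)
      · obtain ⟨q, a, b, c⟩ := (hf.iff (y + 1) (by omega) hy).1 l.2.2.1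
        refine ⟨q, a, b, by omega, ?_, ?_⟩
        · intro y' h2 h3
          obtain rfl : y' = y + 1 := by omega
          exact hh
        · intro hlt
          have := hf.rch q a b
          rw [c] at this
          exact this.east (by rw [l.1]; rfl) hlt
      · exact absurd hh l.2.2.2.2
  have hnc : ∀ y, 1 ≤ y → y ≤ g.n → g.tile x y ≠ Tile.cross := by
    intro y hy hyn ht
    have l : Vb g x y ∧ Hb g x (y - 1) := by
      rcases hg.loc h1 hn hy hyn with l | l | l | l | l | l
      · exact ⟨l.2.2.1, l.2.2.2.1⟩
      all_goals exact absurd ht (by rw [l.1]; simp)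
    obtain ⟨q', a, b, c, d, e⟩ := hT (y - 1) (by omega) l.2
    have e := e (by omega)
    rw [show y - 1 + 1 = y by omega] at e
    obtain ⟨q, a', b', c'⟩ := (hf.iff y hy hyn).1 l.1
    have hqq : q' < q := by
      by_contra hc
      rcases Nat.eq_or_lt_of_le (show q ≤ q' by omega) with h5 | h5
      · subst h5; omega
      · have := hf.mono q q' a' h5 b; omega
    have hr := hf.rch q a' b'
    rw [c'] at hr
    exact no_bad_cross hg (mem_wpos hB a') (mem_wle hB (by omega)) (mem_wpos hB a) (mem_wle hB (by omega))
      (mem_exit hB a' (by omega)) (mem_exit hB a (by omega)) hqq hr e ht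
  have hVH : ∀ y, 1 ≤ y → y ≤ g.n → Vb g x y → ¬ Hb g x (y - 1) := by
    intro y hy hyn hv hh
    rcases hg.loc h1 hn hy hyn with l | l | l | l | l | l
    · exact hnc y hy hyn l.1
    · exact l.2.2.1 hv
    · exact l.2.2.2.1 hh
    · exact l.2.2.1 hv
    · exact l.2.2.2.1 hh
    · exact l.2.2.1 hv
  have hfV : ∀ q, 1 ≤ q → q ≤ x → Vb g x (f q) := fun q a b =>
    (hf.iff _ (hf.pos q a b) (hf.le q a b)).2 ⟨q, a, b, rfl⟩
  -- travelling east
  have hG : ∀ q, 1 ≤ q → q ≤ x → ∀ y, f q ≤ y → y ≤ g.n → (∀ y', f q ≤ y' → y' ≤ y → Hb g x y') →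
      ∃ d, Rch g (w q) x y d ∧ outDir (g.tile x y) d = some Dir.east := by
    intro q a b y hy
    induction y, hy using Nat.le_induction with
    | base =>
      intro hyn hall
      refine ⟨Dir.north, hf.rch q a b, ?_⟩
      have hv := hfV q a b
      have hh := hall _ le_rfl le_rfl
      rcases hg.loc h1 hn (hf.pos q a b) hyn with l | l | l | l | l | l
      · exact absurd l.1 (hnc _ (hf.pos q a b) hyn)
      · exact absurd hh l.2.2.2.2
      · exact absurd hh l.2.2.2.2
      · exact absurd hv l.2.2.1
      · rw [l.1]; rfl
      · exact absurd hh l.2.2.2.2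
    | succ y hy ih =>
      intro hyn hall
      obtain ⟨d, hr, ho⟩ := ih (by omega) (fun y' h2 h3 => hall y' h2 (by omega))
      refine ⟨Dir.east, hr.east ho (by omega), ?_⟩
      have hp := hall y hy (by omega)
      have hh := hall (y + 1) (by omega) le_rfl
      rcases hg.loc h1 hn (y := y + 1) (by omega) hyn with l | l | l | l | l | l
      · rw [l.1]; rfl
      · exact absurd hh l.2.2.2.2
      · exact absurd hh l.2.2.2.2
      · rw [l.1]; rfl
      · exact absurd hp l.2.2.2.1
      · exact absurd hh l.2.2.2.2
  have hEndsAt : ∀ q, 1 ≤ q → q ≤ x → ∀ y, f q ≤ y → y ≤ g.n → ¬ Hb g x y →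
      (∀ y', f q ≤ y' → y' < y → Hb g x y') → Vb g (x - 1) y ∧ Rch g (w q) (x - 1) y Dir.north ∧ q ≤ x - 1 := by
    intro q a b y hy hyn hh hall
    have hex := mem_exit hB a (by omega)
    have key : Vb g (x - 1) y ∧ ∃ d, Rch g (w q) x y d ∧ outDir (g.tile x y) d = some Dir.north := by
      rcases Nat.eq_or_lt_of_le hy with h5 | h5
      · subst h5
        have hv := hfV q a b
        rcases hg.loc h1 hn (hf.pos q a b) hyn with l | l | l | l | l | l
        · exact absurd l.2.2.2.2 hh
        · exact absurd hv l.2.2.1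
        · exact ⟨l.2.1, Dir.north, hf.rch q a b, by rw [l.1]; rfl⟩
        · exact absurd hv l.2.2.1
        · exact absurd l.2.2.2.2 hh
        · exact absurd hv l.2.2.1
      · have hp := hall (y - 1) (by omega) (by omega)
        obtain ⟨d, hr, ho⟩ := hG q a b (y - 1) (by omega) (by omega) (fun y' h2 h3 => hall y' h2 (by omega))
        have hr := hr.east ho (by omega)
        rw [show y - 1 + 1 = y by omega] at hr
        rcases hg.loc h1 hn (y := y) (by omega) hyn with l | l | l | l | l | l
        · exact absurd l.2.2.2.2 hh
        · exact absurd hp l.2.2.2.1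
        · exact absurd hp l.2.2.2.1
        · exact absurd l.2.2.2.2 hh
        · exact absurd l.2.2.2.2 hh
        · exact ⟨l.2.1, Dir.east, hr, by rw [l.1]; rfl⟩
    obtain ⟨k1, d, k2, k3⟩ := key
    obtain ⟨fu, t⟩ := k2.trace hex
    obtain ⟨_, _, hx, _⟩ := trace_north t k3
    have k4 := k2.north k3 hx
    exact ⟨k1, k4, k4.le hex⟩
  have hexist : ∀ q, (1 ≤ q ∧ q < x) → ∃ y, f q ≤ y ∧ y ≤ g.n ∧ ¬ Hb g x y ∧ ∀ y', f q ≤ y' → y' < y → Hb g x y' := by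
    rintro q ⟨a, b⟩
    have hex : ∃ y, f q ≤ y ∧ y ≤ g.n ∧ ¬ Hb g x y := by
      by_contra hc
      push Not at hc
      obtain ⟨d, hr, ho⟩ := hG q a b.le g.n (hf.le q a b.le) le_rfl hc
      obtain ⟨fu, t⟩ := hr.trace (mem_exit hB a (by omega))
      obtain ⟨_, _, hh⟩ := trace_east t ho
      omega
    classical
    refine ⟨Nat.find hex, (Nat.find_spec hex).1, (Nat.find_spec hex).2.1, (Nat.find_spec hex).2.2, ?_⟩
    intro y' h2 h3
    by_contra h4
    have := Nat.find_spec hex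
    exact Nat.find_min hex h3 ⟨h2, by omega, h4⟩
  choose! f' hf'1 hf'2 hf'3 hf'4 using hexist
  have hlt : ∀ q, 1 ≤ q → q < x → f' q < f (q + 1) := by
    intro q a b
    by_contra hc
    have hm := hf.mono q (q + 1) a (by omega) (by omega)
    refine hVH (f (q + 1)) (hf.pos _ (by omega) (by omega)) (hf.le _ (by omega) (by omega))
      (hfV _ (by omega) (by omega)) ?_
    exact hf'4 q ⟨a, b⟩ _ (by omega) (by omega)
  refine ⟨f', ⟨?_, ?_, ?_, ?_, ?_⟩, ?_, ?_⟩
  · intro q q' a b c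
    have e1 := hlt q a (by omega)
    have e2 := hf'1 q' ⟨by omega, by omega⟩
    rcases Nat.eq_or_lt_of_le (show q + 1 ≤ q' by omega) with h5 | h5
    · rw [h5] at e1; omega
    · have := hf.mono (q + 1) q' (by omega) h5 (by omega); omega
  · intro q a b
    have := hf'1 q ⟨a, by omega⟩
    have := hf.pos q a (by omega)
    omega
  · intro q a b
    exact hf'2 q ⟨a, by omega⟩
  · intro q a b
    have hq : 1 ≤ q ∧ q < x := ⟨a, by omega⟩
    exact (hEndsAt q a (by omega) _ (hf'1 q hq) (hf'2 q hq) (hf'3 q hq) (hf'4 q hq)).2.1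
  · intro y hy hyn
    constructor
    · intro hv
      have key : ∃ q, 1 ≤ q ∧ q ≤ x ∧ f q ≤ y ∧ ¬ Hb g x y ∧ ∀ y', f q ≤ y' → y' < y → Hb g x y' := by
        rcases hg.loc h1 hn hy hyn with l | l | l | l | l | l
        · exact absurd l.1 (hnc y hy hyn)
        · exact absurd hv l.2.1
        · obtain ⟨q, a, b, c⟩ := (hf.iff y hy hyn).1 l.2.2.1
          exact ⟨q, a, b, by omega, l.2.2.2.2, fun y' h2 h3 => by omega⟩
        · exact absurd hv l.2.1
        · exact absurd hv l.2.1
        · obtain ⟨q, a, b, c, d, _⟩ := hT (y - 1) (by omega) l.2.2.2.1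
          exact ⟨q, a, b, by omega, l.2.2.2.2, fun y' h2 h3 => d y' h2 (by omega)⟩
      obtain ⟨q, a, b, c, d, e⟩ := key
      have hq := (hEndsAt q a b y c hyn d e).2.2
      have hq' : 1 ≤ q ∧ q < x := ⟨a, by omega⟩
      refine ⟨q, a, hq, ?_⟩
      rcases Nat.lt_trichotomy (f' q) y with h5 | h5 | h5
      · exact absurd (e _ (hf'1 q hq') h5) (hf'3 q hq')
      · exact h5
      · exact absurd (hf'4 q hq' _ c h5) d
    · rintro ⟨q, a, b, rfl⟩
      have hq : 1 ≤ q ∧ q < x := ⟨a, by omega⟩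
      exact (hEndsAt q a (by omega) _ (hf'1 q hq) (hf'2 q hq) (hf'3 q hq) (hf'4 q hq)).1
  · intro q a b
    exact ⟨hf'1 q ⟨a, b⟩, hlt q a b⟩
  · intro y hy hyn
    constructor
    · intro hh
      obtain ⟨q, a, b, c, d, _⟩ := hT y hyn hh
      refine ⟨q, a, b, c, ?_⟩
      by_cases hqx : q = x
      · left; exact hqx
      · right
        by_contra hc
        have hq : 1 ≤ q ∧ q < x := ⟨a, by omega⟩
        exact hf'3 q hq (d _ (hf'1 q hq) (by omega))
    · rintro ⟨q, a, b, c, d⟩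
      rcases d with d | d
      · by_contra hh
        classical
        have hex : ∃ y, f q ≤ y ∧ y ≤ g.n ∧ ¬ Hb g x y := ⟨y, c, hyn, hh⟩
        have hs := Nat.find_spec hex
        have := hEndsAt q a b (Nat.find hex) hs.1 hs.2.1 hs.2.2 (by
          intro y' h2 h3
          by_contra h4
          exact Nat.find_min hex h3 ⟨h2, by omega, h4⟩)
        omega
      · by_cases hqx : q = x
        · by_contra hh
          classical
          have hex : ∃ y, f q ≤ y ∧ y ≤ g.n ∧ ¬ Hb g x y := ⟨y, c, hyn, hh⟩
          have hs := Nat.find_spec hex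
          have := hEndsAt q a b (Nat.find hex) hs.1 hs.2.1 hs.2.2 (by
            intro y' h2 h3
            by_contra h4
            exact Nat.find_min hex h3 ⟨h2, by omega, h4⟩)
          omega
        · exact hf'4 q ⟨a, by omega⟩ y c d

end

section

theorem exists_levels {w : Perm'} {g : Grid} (hB : MemBPD w g) {k : ℕ} (hkn : k ≤ g.n)
    (h0 : Inv g w k (fun q => w q)) : ∃ F : ℕ → ℕ → ℕ, (∀ q, F k q = w q) ∧ (∀ x, x ≤ k → Inv g w x (F x)) ∧
      ∀ x, 1 ≤ x → x ≤ k → Link g x (F x) (F (x - 1)) := by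
  have step : ∀ x f, (1 ≤ x ∧ x ≤ g.n ∧ Inv g w x f) → ∃ f', Inv g w (x - 1) f' ∧ Link g x f f' :=
    fun x f h => row_le hB h.1 h.2.1 h.2.2
  choose! st hst1 hst2 using step
  let G : ℕ → ℕ → ℕ := fun m => Nat.rec (fun q => w q) (fun m f => st (k - m) f) m
  have hG0 : G 0 = fun q => w q := rfl
  have hGs : ∀ m, G (m + 1) = st (k - m) (G m) := fun m => rfl
  have hI : ∀ m, m ≤ k → Inv g w (k - m) (G m) := by
    intro m
    induction m with
    | zero => intro _; exact h0
    | succ m ih =>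
      intro hm
      rw [hGs, show k - (m + 1) = k - m - 1 by omega]
      exact hst1 _ _ ⟨by omega, by omega, ih (by omega)⟩
  refine ⟨fun x => G (k - x), ?_, ?_, ?_⟩
  · intro q; simp [hG0]
  · intro x hx
    have := hI (k - x) (by omega)
    rwa [show k - (k - x) = x by omega] at this
  · intro x h1 hx
    have := hI (k - x) (by omega)
    rw [show k - (k - x) = x by omega] at this
    have h2 := hst2 x _ ⟨h1, by omega, this⟩
    have h3 := hGs (k - x)
    rw [show k - (k - x) = x by omega, show k - x + 1 = k - (x - 1) by omega] at h3
    show Link g x (G (k - x)) (G (k - (x - 1)))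
    rw [h3]
    exact h2

theorem exists_desc {w : Perm'} {g : Grid} (hB : MemBPD w g) {k : ℕ} (hG : Grassmannian w) (hk : Descent w k) :
    ∃ lam, Desc g k w lam := by
  have hg := hB.1
  obtain ⟨hk1, hk2⟩ := hk
  have hfix := hB.2.2.1
  have hkn : k < g.n := by
    by_contra hc
    rw [hfix (k + 1) (by omega)] at hk2
    have h2 := hfix (w k) (by omega)
    have := w.injective h2
    omega
  have hstep : ∀ x, 1 ≤ x → x ≠ k → w x < w (x + 1) := by
    intro x hx hne
    by_contra hc
    have : w x ≠ w (x + 1) := fun h => by have := w.injective h; omega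
    exact hne (hG.2 (show x ∈ {k | Descent w k} from ⟨hx, by omega⟩) (show k ∈ {k | Descent w k} from ⟨hk1, hk2⟩))
  have hinc : ∀ x z, k < x → x < z → w x < w z := by
    intro x z h1 h2
    induction z, h2 using Nat.le_induction with
    | base => exact hstep x (by omega) (by omega)
    | succ z hz ih => exact ih.trans (hstep z (by omega) (by omega))
  have hinc' : ∀ x z, 1 ≤ x → x < z → z ≤ k → w x < w z := by
    intro x z h1 h2
    induction z, h2 using Nat.le_induction with
    | base => intro hz; exact hstep x (by omega) (by omega)
    | succ z hz ih => intro hz'; exact (ih (by omega)).trans (hstep z (by omega) (by omega))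
  have hrow := fun x => rows_gt' hB hkn hinc (x := x)
  have hspos : ∀ y, 1 ≤ y → 1 ≤ w.symm y := by
    intro y hy
    by_contra hc
    have h3 : w (w.symm y) = y := by simp
    rw [show w.symm y = 0 by omega, hB.2.1] at h3
    omega
  have h0 : Inv g w k (fun q => w q) := by
    refine ⟨hinc', fun q a _ => mem_wpos hB a, fun q a b => mem_wle hB (by omega), ?_, ?_⟩
    · intro q a b
      exact (hrow k le_rfl hkn.le).2.1 (w q) (mem_wpos hB a) (mem_wle hB (by omega)) (by simpa using b)
    · intro y hy hyn
      rw [(hrow k le_rfl hkn.le).1 y hy hyn]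
      constructor
      · intro h; exact ⟨w.symm y, hspos y hy, h, by simp⟩
      · rintro ⟨q, a, b, rfl⟩; simpa using b
  obtain ⟨F, hFk, hFI, hFL⟩ := exists_levels hB hkn.le h0
  have hge : ∀ x, x ≤ k → ∀ q, 1 ≤ q → q ≤ x → q ≤ F x q := by
    intro x hx q a
    induction q, a using Nat.le_induction with
    | base => intro h; exact (hFI x hx).pos 1 le_rfl h
    | succ q hq ih =>
      intro h
      have := ih (by omega)
      have := (hFI x hx).mono q (q + 1) hq (by omega) h
      omega
  let lam : ℕ → ℕ → ℕ := fun i p => if p < min i k then F (min i k) (min i k - p) - (min i k - p) else 0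
  have hlam : ∀ i p, lam i p = if p < min i k then F (min i k) (min i k - p) - (min i k - p) else 0 := fun _ _ => rfl
  have hsC : ∀ x q, x ≤ k → 1 ≤ q → q ≤ x → sC lam x q = F x q := by
    intro x q hx a b
    unfold sC
    rw [hlam, show min x k = x by omega, if_pos (by omega), show x - (x - q) = q by omega]
    have := hge x hx q a b
    omega
  have hgt : GT lam := by
    refine ⟨fun p => by rw [hlam]; simp, ?_⟩
    intro i p
    rcases Nat.lt_or_ge i k with hi | hi
    · have e1 : min i k = i := by omega
      have e2 : min (i + 1) k = i + 1 := by omega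
      rw [hlam, hlam, hlam, e1, e2]
      by_cases hp : p < i
      · rw [if_pos hp, if_pos (by omega), if_pos (by omega)]
        have hl := (hFL (i + 1) (by omega) (by omega)).1 (i - p) (by omega) (by omega)
        simp only [Nat.add_sub_cancel] at hl
        rw [show i + 1 - p = i - p + 1 by omega, show i + 1 - (p + 1) = i - p by omega]
        have := hge i (by omega) (i - p) (by omega) (by omega)
        omega
      · rw [if_neg hp, if_neg (show ¬ (p + 1 < i + 1) by omega)]
        omega
    · have e1 : min i k = k := by omega
      have e2 : min (i + 1) k = k := by omega
      rw [hlam, hlam, hlam, e1, e2]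
      refine ⟨le_rfl, ?_⟩
      by_cases hp : p + 1 < k
      · rw [if_pos hp, if_pos (by omega)]
        have := (hFI k le_rfl).mono (k - (p + 1)) (k - p) (by omega) (by omega) (by omega)
        omega
      · rw [if_neg hp]; omega
  have hwk : ∀ q, 1 ≤ q → q ≤ k → w q = lam k (k - q) + q := by
    intro q a b
    rw [← hFk, ← hsC k q le_rfl a b]; rfl
  have hgr : GrP k (lam k) w := ⟨hB.2.1, hwk, hinc⟩
  refine ⟨lam, hkn, hfix, hgt, hgr, ?_⟩
  have hVD : ∀ x y, x ≤ g.n → 1 ≤ y → y ≤ g.n → (Vb g x y ↔ VD k w lam x y) := by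
    intro x y hx hy hyn
    rcases Nat.lt_or_ge k x with h | h
    · rw [(hrow x h.le hx).1 y hy hyn]
      unfold VD; omega
    · rw [Desc.VDle h, (hFI x h).iff y hy hyn]
      constructor
      · rintro ⟨q, a, b, c⟩; exact ⟨q, a, b, by rw [hsC x q h a b, c]⟩
      · rintro ⟨q, a, b, c⟩; exact ⟨q, a, b, by rw [← hsC x q h a b, c]⟩
  have hHD : ∀ x y, 1 ≤ x → x ≤ g.n → y ≤ g.n → (Hb g x y ↔ HD k w lam x y) := by
    intro x y hx1 hx hyn
    rcases Nat.eq_zero_or_pos y with rfl | hy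
    · have e1 : ¬ Hb g x 0 := fun h => absurd h.1 (by omega)
      have e2 : ¬ HD k w lam x 0 := by
        rintro (⟨_, q, a, b, c, _⟩ | ⟨_, b⟩)
        · unfold sC at c; omega
        · have := mem_wpos hB hx1; omega
      exact ⟨fun h => absurd h e1, fun h => absurd h e2⟩
    rcases Nat.lt_or_ge k x with h | h
    · rw [(hrow x h.le hx).2.2 h y hy hyn, Desc.HDge h]
    · rw [Desc.HDle h, (hFL x hx1 h).2 y hy hyn]
      have key : ∀ q, 1 ≤ q → q ≤ x → ((F x q ≤ y ∧ (q = x ∨ y < F (x - 1) q)) ↔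
          (sC lam x q ≤ y ∧ (q = x ∨ y < sC lam (x - 1) q))) := by
        intro q a b
        rw [hsC x q h a b]
        by_cases hqx : q = x
        · simp [hqx]
        · rw [hsC (x - 1) q (by omega) a (by omega)]
      constructor
      · rintro ⟨q, a, b, c⟩; exact ⟨q, a, b, (key q a b).1 c⟩
      · rintro ⟨q, a, b, c⟩; exact ⟨q, a, b, (key q a b).2 c⟩
  intro x y hx hxn hy hyn
  refine ⟨?_, ?_, ?_, ?_, hg.nobump x y⟩
  · rw [hg.hasN_iff hx hxn hy hyn, hVD _ _ (by omega) hy hyn]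
  · rw [← hVD _ _ hxn hy hyn]; simp [Vb, hx]
  · rw [hg.hasW_iff hx hxn hy hyn, hHD _ _ hx hxn (by omega)]
  · rw [← hHD _ _ hx hxn hyn]; simp [Hb, hy]

theorem main_result (w : Perm') (k : ℕ) (hG : Grassmannian w) (hk : Descent w k)
    (B : Grid) (hB : MemBPD w B) :
    Qtilde (phi B) = weigandt B (shapeOf w B.n) ∧
    IsCompatible w (phi B) ∧
    IsSSYTBounded k (weigandt B (shapeOf w B.n)) := by
  obtain ⟨lam, h⟩ := exists_desc hB hG hk
  exact h.final

end

/-- For `w` Grassmannian with descent in position `k` and `B ∈ BPD(w)`,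
`Q̃(φ(B)) = γ(B)`; moreover `φ(B) ∈ PD(w)` and `γ(B) ∈ SSYT_k(λ(w))`, so the
Gao–Huang bijection, Weigandt's bijection and the Edelman–Greene recording-tableau
map form a commuting triangle. -/
theorem stmt1 (w : Perm') (k : ℕ) (hG : Grassmannian w) (hk : Descent w k)
    (B : Grid) (hB : MemBPD w B) :
    Qtilde (phi B) = weigandt B (shapeOf w B.n) ∧
    IsCompatible w (phi B) ∧
    IsSSYTBounded k (weigandt B (shapeOf w B.n)) := by
  exact main_result w k hG hk B hB

end BPDPaper
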